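/- arXiv:2405.19223 — 3 statements merged into one kernel-verified Lean document; each statement's English description precedes it below -/
import Mathlib

section
/- Let p ∈ K[X,Y] with p ∉ K[X] ∪ K[Y] and p(0,…,0) = 0, let I = ⟨p⟩ ⊆ K[X,Y], let P = φ(p), and let Ī = ⟨P⟩ ⊆ K(X,Y)[s,t]. Suppose A(Ī) is not trivial and let (F,G) ∈ K(X,Y)[s] × K(X,Y)[t] be a generator of A(Ī) as a K(X,Y)-algebra such that F and G have all coefficients in K[X,Y], F − G (viewed in K[X,Y][s,t]) has no factor in K[X,Y], and F|_{s=0} = G|_{t=0} = 0. Then A(I) is nontrivial if and only if F ∈ K[X][s], G ∈ K[Y][t], and F|_{s=1} ≠ G|_{t=1}; and in this case (F|_{s=1}, G|_{t=1}) generates A(I) as a K-algebra. -/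
open MvPolynomial

/-- For algebra embeddings `ea : A → T`, `eb : B → T` and an ideal `I ⊆ T`, the subalgebra of
`A × B` consisting of pairs `(f, g)` with `ea f - eb g ∈ I`.  With `ea, eb` the embeddings of
`K[X]` and `K[Y]` into `K[X,Y]`, this is the algebra `A(I)` of separated elements of `I`. -/
noncomputable def sepPair {R A B T : Type} [CommSemiring R] [CommRing A] [CommRing B] [CommRing T]
    [Algebra R A] [Algebra R B] [Algebra R T]
    (ea : A →ₐ[R] T) (eb : B →ₐ[R] T) (I : Ideal T) : Subalgebra R (A × B) where
  carrier := {fg | ea fg.1 - eb fg.2 ∈ I}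
  add_mem' := by
    intro a b ha hb
    show ea (a.1 + b.1) - eb (a.2 + b.2) ∈ I
    have h : ea (a.1 + b.1) - eb (a.2 + b.2)
        = (ea a.1 - eb a.2) + (ea b.1 - eb b.2) := by
      rw [map_add, map_add]; ring
    rw [h]
    exact I.add_mem ha hb
  mul_mem' := by
    intro a b ha hb
    show ea (a.1 * b.1) - eb (a.2 * b.2) ∈ I
    have h : ea (a.1 * b.1) - eb (a.2 * b.2)
        = (ea a.1 - eb a.2) * ea b.1 + eb a.2 * (ea b.1 - eb b.2) := by
      rw [map_mul, map_mul]; ring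
    rw [h]
    exact I.add_mem (I.mul_mem_right _ ha) (I.mul_mem_left _ hb)
  one_mem' := by
    show ea 1 - eb 1 ∈ I
    simp
  zero_mem' := by
    show ea 0 - eb 0 ∈ I
    simp
  algebraMap_mem' := by
    intro r
    show ea (algebraMap R A r) - eb (algebraMap R B r) ∈ I
    rw [AlgHom.commutes, AlgHom.commutes]
    simp

/-- The `K`-algebra homomorphism `φ : K[X,Y] → K(X,Y)[s,t]` with `φ(xᵢ) = s·xᵢ` and
`φ(yⱼ) = t·yⱼ`, where `K(X,Y)[s,t]` is realized as `(K(X,Y)[s])[t]` (inner variable `s`,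
outer variable `t`). -/
noncomputable def phi (K : Type) [Field K] (n m : ℕ) :
    MvPolynomial (Fin n ⊕ Fin m) K →ₐ[K]
      Polynomial (Polynomial (FractionRing (MvPolynomial (Fin n ⊕ Fin m) K))) :=
  aeval (Sum.elim
    (fun i => Polynomial.C (Polynomial.C
        (algebraMap (MvPolynomial (Fin n ⊕ Fin m) K)
          (FractionRing (MvPolynomial (Fin n ⊕ Fin m) K)) (X (Sum.inl i)))
        * Polynomial.X))
    (fun j => Polynomial.C (Polynomial.C
        (algebraMap (MvPolynomial (Fin n ⊕ Fin m) K)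
          (FractionRing (MvPolynomial (Fin n ⊕ Fin m) K)) (X (Sum.inr j))))
        * Polynomial.X))

/-- The algebra `A(Ī)` of separated elements of an ideal `Ī` of `K(X,Y)[s,t]`:
pairs `(F, G) ∈ K(X,Y)[s] × K(X,Y)[t]` with `F - G ∈ Ī`. -/
noncomputable def sepBar (K : Type) [Field K] (n m : ℕ)
    (Ibar : Ideal (Polynomial (Polynomial (FractionRing (MvPolynomial (Fin n ⊕ Fin m) K))))) :
    Subalgebra (FractionRing (MvPolynomial (Fin n ⊕ Fin m) K))
      (Polynomial (FractionRing (MvPolynomial (Fin n ⊕ Fin m) K)) ×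
        Polynomial (FractionRing (MvPolynomial (Fin n ⊕ Fin m) K))) :=
  sepPair Polynomial.CAlgHom (Polynomial.mapAlgHom Polynomial.CAlgHom) Ibar

theorem mem_liftsRing_subfield {L : Type} [Field L] (k : Subfield L) (Q : Polynomial L) :
    Q ∈ Polynomial.liftsRing k.subtype ↔ ∀ i, Q.coeff i ∈ k := by
  have h : Q ∈ Polynomial.liftsRing k.subtype ↔ Q ∈ Polynomial.lifts k.subtype := Iff.rfl
  rw [h, Polynomial.lifts_iff_coeff_lifts]
  simp

theorem split_subfield {L : Type} [Field L] (k : Subfield L) (Q : Polynomial L) :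
    Q ∈ Polynomial.liftsRing k.subtype ∨ ∃ V W : Polynomial L, Q = V + W ∧
      V ∈ Polynomial.liftsRing k.subtype ∧ W.leadingCoeff ∉ k ∧ W.natDegree ≤ Q.natDegree := by
  induction hn : Q.support.card using Nat.strong_induction_on generalizing Q with
  | _ N ih =>
    by_cases hQ : Q = 0
    · left; rw [hQ]; exact zero_mem _
    by_cases hl : Q.leadingCoeff ∈ k
    · have hlt : Q.eraseLead.support.card < N := by
        rw [← hn]; exact Polynomial.eraseLead_support_card_lt hQ
      have hm : Polynomial.monomial Q.natDegree Q.leadingCoeff ∈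
          Polynomial.liftsRing k.subtype := by
        rw [mem_liftsRing_subfield]
        intro i
        rw [Polynomial.coeff_monomial]
        split_ifs
        · exact hl
        · exact zero_mem _
      have hdec := Polynomial.eraseLead_add_monomial_natDegree_leadingCoeff Q
      rcases ih _ hlt Q.eraseLead rfl with h | ⟨V, W, h1, h2, h3, h4⟩
      · left; rw [← hdec]; exact add_mem h hm
      · right
        refine ⟨V + Polynomial.monomial Q.natDegree Q.leadingCoeff, W, ?_, add_mem h2 hm, h3,
          h4.trans Polynomial.eraseLead_natDegree_le_aux⟩
        conv_lhs => rw [← hdec, h1]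
        ring
    · right
      exact ⟨0, Q, by simp, zero_mem _, hl, le_rfl⟩

theorem comp_mem_liftsRing {L : Type} [Field L] (k : Subfield L) {u F : Polynomial L}
    (hu : u ∈ Polynomial.liftsRing k.subtype) (hF : F ∈ Polynomial.liftsRing k.subtype) :
    u.comp F ∈ Polynomial.liftsRing k.subtype := by
  obtain ⟨u', rfl⟩ := hu
  obtain ⟨F', rfl⟩ := hF
  exact ⟨u'.comp F', by simp [Polynomial.map_comp]⟩

theorem descent_outer {L : Type} [Field L] (k : Subfield L) {u F : Polynomial L}
    (hF : F ∈ Polynomial.liftsRing k.subtype) (hd : F.natDegree ≠ 0)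
    (h : u.comp F ∈ Polynomial.liftsRing k.subtype) : u ∈ Polynomial.liftsRing k.subtype := by
  rcases split_subfield k u with h' | ⟨V, W, h1, h2, h3, -⟩
  · exact h'
  exfalso
  apply h3
  have hW : W.comp F ∈ Polynomial.liftsRing k.subtype := by
    have : W.comp F = u.comp F - V.comp F := by rw [h1, Polynomial.add_comp]; ring
    rw [this]
    exact sub_mem h (comp_mem_liftsRing k h2 hF)
  have hF' := (mem_liftsRing_subfield k F).1 hF
  have h5 := (mem_liftsRing_subfield k _).1 hW (W.comp F).natDegree
  have h6 : (W.comp F).leadingCoeff = W.leadingCoeff * F.leadingCoeff ^ W.natDegree :=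
    Polynomial.leadingCoeff_comp hd
  have h7 : F.leadingCoeff ≠ 0 := by
    intro h0
    rw [Polynomial.leadingCoeff_eq_zero] at h0
    simp [h0] at hd
  rw [Polynomial.coeff_natDegree, h6] at h5
  have h8 : F.leadingCoeff ^ W.natDegree ∈ k := pow_mem (hF' _) _
  have := mul_mem h5 (inv_mem h8)
  rwa [mul_assoc, mul_inv_cancel₀ (pow_ne_zero _ h7), mul_one] at this

theorem descent_inner {L : Type} [Field L] [CharZero L] (k : Subfield L) {u F : Polynomial L}
    (hu : u.natDegree ≠ 0) (hF0 : F.coeff 0 = 0) (hlc : F.leadingCoeff ∈ k)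
    (hd : F.natDegree ≠ 0) (h : u.comp F ∈ Polynomial.liftsRing k.subtype) :
    F ∈ Polynomial.liftsRing k.subtype := by
  rcases split_subfield k F with h' | ⟨V, W, h1, h2, h3, h4⟩
  · exact h'
  exfalso
  have hV := (mem_liftsRing_subfield k V).1 h2
  have hWc : ∀ i, F.coeff i ∈ k → W.coeff i ∈ k := by
    intro i hi
    have : W.coeff i = F.coeff i - V.coeff i := by rw [h1]; simp
    rw [this]; exact sub_mem hi (hV i)
  set a := F.natDegree with ha
  set j := W.natDegree with hj
  have hj0 : j ≠ 0 := by
    intro h0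
    apply h3
    rw [Polynomial.leadingCoeff, ← hj, h0]
    exact hWc 0 (by rw [hF0]; exact zero_mem _)
  have hja : j < a := by
    refine lt_of_le_of_ne h4 fun h0 => h3 ?_
    rw [Polynomial.leadingCoeff, ← hj, h0]
    exact hWc _ hlc
  have hlc0 : F.leadingCoeff ≠ 0 := by
    intro h0
    rw [Polynomial.leadingCoeff_eq_zero] at h0
    rw [ha, h0] at hd; simp at hd
  obtain ⟨q, hq⟩ : ∃ q, u.natDegree = q + 1 := Nat.exists_eq_succ_of_ne_zero hu
  -- leading coefficient of u in k
  have hucF := (mem_liftsRing_subfield k _).1 h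
  have hulc : u.leadingCoeff ∈ k := by
    have h5 := hucF (u.comp F).natDegree
    rw [Polynomial.coeff_natDegree, Polynomial.leadingCoeff_comp hd] at h5
    have h8 : F.leadingCoeff ^ u.natDegree ∈ k := pow_mem hlc _
    have := mul_mem h5 (inv_mem h8)
    rwa [mul_assoc, mul_inv_cancel₀ (pow_ne_zero _ hlc0), mul_one] at this
  have hulc0 : u.leadingCoeff ≠ 0 := by
    intro h0
    rw [Polynomial.leadingCoeff_eq_zero] at h0
    rw [h0] at hu; simp at hu
  have hVa : V.coeff a = F.leadingCoeff := by
    rw [Polynomial.leadingCoeff, h1, Polynomial.coeff_add, ← h1, ← ha,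
      Polynomial.coeff_eq_zero_of_natDegree_lt hja, add_zero]
  have hVd : V.natDegree ≤ a := by
    have : V = F - W := by rw [h1]; ring
    rw [this]
    exact (Polynomial.natDegree_sub_le _ _).trans (max_le le_rfl h4)
  set N := q * a + j with hN
  -- coefficient of F^(q+1) at N
  have hdec := Polynomial.eraseLead_add_C_mul_X_pow u
  have hlow : (u.eraseLead.comp F).coeff N = 0 := by
    apply Polynomial.coeff_eq_zero_of_natDegree_lt
    refine lt_of_le_of_lt Polynomial.natDegree_comp_le ?_
    have : u.eraseLead.natDegree ≤ q := by
      have := Polynomial.eraseLead_natDegree_le u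
      omega
    calc u.eraseLead.natDegree * F.natDegree ≤ q * a := Nat.mul_le_mul_right _ this
      _ < N := by omega
  have hFN : (F ^ (q + 1)).coeff N ∈ k := by
    have h5 : (u.comp F).coeff N = u.leadingCoeff * (F ^ (q + 1)).coeff N := by
      conv_lhs => rw [← hdec]
      rw [Polynomial.add_comp, Polynomial.coeff_add, hlow, zero_add, hq]
      simp
    have h6 := hucF N
    rw [h5] at h6
    have := mul_mem (inv_mem hulc) h6
    rwa [← mul_assoc, inv_mul_cancel₀ hulc0, one_mul] at this
  have hVN : (V ^ (q + 1)).coeff N ∈ k :=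
    (mem_liftsRing_subfield k _).1 (pow_mem h2 _) N
  obtain ⟨S, hS, hSd⟩ : ∃ S : Polynomial L, F ^ (q + 1) = V ^ (q + 1) + S * W ∧
      ((S * W).coeff N = ((q : L) + 1) * F.leadingCoeff ^ q * W.leadingCoeff) := by
    refine ⟨∑ i ∈ Finset.range (q + 1), F ^ i * V ^ (q + 1 - 1 - i), ?_, ?_⟩
    · have hW : W = F - V := by rw [h1]; ring
      rw [hW, Commute.geom_sum₂_mul (Commute.all F V)]; ring
    · rw [hN, Polynomial.coeff_mul_add_eq_of_natDegree_le]
      · congr 1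
        rw [Polynomial.finsetSum_coeff]
        have : ∀ i ∈ Finset.range (q + 1), (F ^ i * V ^ (q + 1 - 1 - i)).coeff (q * a) =
            F.leadingCoeff ^ q := by
          intro i hi
          have hi' : i ≤ q := by simpa [Nat.lt_succ_iff] using hi
          have e : q * a = i * a + (q - i) * a := by
            rw [← Nat.add_mul]; congr 1; omega
          have e2 : q + 1 - 1 - i = q - i := by omega
          rw [e, e2, Polynomial.coeff_mul_add_eq_of_natDegree_le
            (Polynomial.natDegree_pow_le_of_le _ le_rfl) (Polynomial.natDegree_pow_le_of_le _ hVd),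
            Polynomial.coeff_pow_of_natDegree_le le_rfl, Polynomial.coeff_pow_of_natDegree_le hVd,
            hVa, Polynomial.coeff_natDegree, ← pow_add]
          congr 1; omega
        rw [Finset.sum_congr rfl this]
        simp
      · refine Polynomial.natDegree_sum_le_of_forall_le _ _ ?_
        intro i hi
        have hi' : i ≤ q := by simpa [Nat.lt_succ_iff] using hi
        have e : q * a = i * a + (q - i) * a := by
          rw [← Nat.add_mul]; congr 1; omega
        have e2 : q + 1 - 1 - i = q - i := by omega
        rw [e, e2]
        exact Polynomial.natDegree_mul_le_of_le (Polynomial.natDegree_pow_le_of_le _ le_rfl)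
          (Polynomial.natDegree_pow_le_of_le _ hVd)
      · exact le_rfl
  apply h3
  have h9 : ((q : L) + 1) * F.leadingCoeff ^ q * W.leadingCoeff ∈ k := by
    rw [← hSd]
    have : (S * W).coeff N = (F ^ (q + 1)).coeff N - (V ^ (q + 1)).coeff N := by
      rw [hS]; simp
    rw [this]; exact sub_mem hFN hVN
  have h10 : ((q : L) + 1) * F.leadingCoeff ^ q ∈ k :=
    mul_mem (add_mem (natCast_mem k q) (one_mem k)) (pow_mem hlc _)
  have h11 : ((q : L) + 1) * F.leadingCoeff ^ q ≠ 0 :=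
    mul_ne_zero (by exact_mod_cast Nat.succ_ne_zero q) (pow_ne_zero _ hlc0)
  have := mul_mem (inv_mem h10) h9
  rwa [← mul_assoc, inv_mul_cancel₀ h11, one_mul] at this

theorem supported_of_dvd {K σ : Type} [Field K] {s : Set σ} {a b : MvPolynomial σ K}
    (hab : a ∣ b) (hb0 : b ≠ 0) (hb : b ∈ supported K s) : a ∈ supported K s := by
  obtain ⟨c, rfl⟩ := hab
  rw [mem_supported] at hb ⊢
  intro i hi
  apply hb
  have hi' : i ∈ a.vars := hi
  have ha0 : a ≠ 0 := left_ne_zero_of_mul hb0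
  have hc0 : c ≠ 0 := right_ne_zero_of_mul hb0
  show i ∈ (a * c).vars
  rw [mem_vars_iff_degreeOf_ne_zero] at hi' ⊢
  rw [degreeOf_mul_eq ha0 hc0]
  omega

theorem const_of_supported {K σ : Type} [Field K] {s t : Set σ} (hst : Disjoint s t)
    {a : MvPolynomial σ K} (hs : a ∈ supported K s) (ht : a ∈ supported K t) :
    ∃ c : K, a = MvPolynomial.C c := by
  rw [mem_supported] at hs ht
  refine ⟨a.coeff 0, vars_eq_empty_iff_eq_C.1 ?_⟩
  rw [← Finset.coe_eq_empty]
  exact Set.subset_eq_empty (Set.subset_inter hs ht) hst.inter_eq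

/-- The subfield of the fraction field generated by polynomials supported on `s`. -/
noncomputable def kf (K : Type) {σ : Type} [Field K] (s : Set σ) :
    Subfield (FractionRing (MvPolynomial σ K)) :=
  Subfield.closure
    (((supported K s).toSubring.map
      (algebraMap (MvPolynomial σ K) (FractionRing (MvPolynomial σ K)))) :
      Set (FractionRing (MvPolynomial σ K)))

theorem mem_kf {K σ : Type} [Field K] {s : Set σ} {q : FractionRing (MvPolynomial σ K)} :
    q ∈ kf K s ↔ ∃ a ∈ supported K s, ∃ b ∈ supported K s,
      q = algebraMap _ (FractionRing (MvPolynomial σ K)) a / algebraMap _ _ b := by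
  rw [kf, Subfield.mem_closure_iff, Subring.closure_eq]
  constructor
  · rintro ⟨_, ⟨a, ha, rfl⟩, _, ⟨b, hb, rfl⟩, rfl⟩
    exact ⟨a, ha, b, hb, rfl⟩
  · rintro ⟨a, ha, b, hb, rfl⟩
    exact ⟨_, ⟨a, ha, rfl⟩, _, ⟨b, hb, rfl⟩, rfl⟩

theorem algebraMap_mem_kf {K σ : Type} [Field K] {s : Set σ} {a : MvPolynomial σ K} :
    algebraMap _ (FractionRing (MvPolynomial σ K)) a ∈ kf K s ↔ a ∈ supported K s := by
  constructor
  · intro h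
    obtain ⟨b, hb, c, hc, h⟩ := mem_kf.1 h
    by_cases ha0 : a = 0
    · rw [ha0]; exact zero_mem _
    by_cases hc0 : c = 0
    · rw [hc0, map_zero, div_zero] at h
      exact absurd ((IsFractionRing.injective (MvPolynomial σ K)
        (FractionRing (MvPolynomial σ K))) (h.trans (map_zero _).symm)) ha0
    have hc0' : algebraMap _ (FractionRing (MvPolynomial σ K)) c ≠ 0 := by
      simpa using hc0
    rw [eq_div_iff hc0', ← map_mul] at h
    have h' := IsFractionRing.injective (MvPolynomial σ K) (FractionRing (MvPolynomial σ K)) h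
    refine supported_of_dvd ⟨c, h'.symm⟩ ?_ hb
    rw [← h']; exact mul_ne_zero ha0 hc0
  · intro h
    exact mem_kf.2 ⟨a, h, 1, one_mem _, by simp⟩

theorem kf_inter {K σ : Type} [Field K] [CharZero K] {s t : Set σ} (hst : Disjoint s t)
    {q : FractionRing (MvPolynomial σ K)} (hs : q ∈ kf K s) (ht : q ∈ kf K t) :
    ∃ e : K, q = algebraMap (MvPolynomial σ K) _ (MvPolynomial.C e) := by
  classical
  obtain ⟨a, ha, b, hb, h1⟩ := mem_kf.1 hs
  obtain ⟨c, hc, d, hd, h2⟩ := mem_kf.1 ht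
  by_cases hb0 : b = 0
  · exact ⟨0, by rw [h1, hb0]; simp⟩
  by_cases hd0 : d = 0
  · exact ⟨0, by rw [h2, hd0]; simp⟩
  have inj := IsFractionRing.injective (MvPolynomial σ K) (FractionRing (MvPolynomial σ K))
  have hb0' : algebraMap _ (FractionRing (MvPolynomial σ K)) b ≠ 0 := by simpa using hb0
  have hd0' : algebraMap _ (FractionRing (MvPolynomial σ K)) d ≠ 0 := by simpa using hd0
  have h3 : a * d = c * b := by
    apply inj
    rw [map_mul, map_mul]
    rw [h1, div_eq_div_iff hb0' hd0'] at h2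
    exact h2
  obtain ⟨z, hz⟩ : ∃ z, eval z d ≠ 0 := by
    by_contra hcon
    push Not at hcon
    exact hd0 (MvPolynomial.funext fun z => by rw [hcon z, map_zero])
  let h : MvPolynomial σ K →ₐ[K] MvPolynomial σ K :=
    aeval (fun i => if i ∈ s then X i else MvPolynomial.C (z i))
  have hfix : ∀ r ∈ supported K s, h r = r := by
    intro r hr
    rw [mem_supported] at hr
    have := MvPolynomial.hom_congr_vars (f₁ := (h : MvPolynomial σ K →+* MvPolynomial σ K))
      (f₂ := RingHom.id _) (p₁ := r) (p₂ := r) (by ext x; simp [h]) (fun i hi _ => by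
        have : i ∈ s := hr hi
        simp [h, this]) rfl
    simpa using this
  have hev : ∀ r ∈ supported K t, h r = MvPolynomial.C (eval z r) := by
    intro r hr
    rw [mem_supported] at hr
    have := MvPolynomial.hom_congr_vars (f₁ := (h : MvPolynomial σ K →+* MvPolynomial σ K))
      (f₂ := (MvPolynomial.C : K →+* MvPolynomial σ K).comp (eval z)) (p₁ := r) (p₂ := r)
      (by ext x; simp [h]) (fun i hi _ => by
        have h1 : i ∈ t := hr hi
        have : i ∉ s := fun h2 => Set.disjoint_left.1 hst h2 h1
        simp [h, this]) rfl
    simpa using this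
  have h4 := congrArg h h3
  rw [map_mul, map_mul, hfix a ha, hfix b hb, hev c hc, hev d hd] at h4
  refine ⟨eval z c / eval z d, ?_⟩
  rw [h1, div_eq_iff hb0', ← map_mul]
  congr 1
  have h5 : (MvPolynomial.C (eval z d) : MvPolynomial σ K) ≠ 0 := by simpa using hz
  apply mul_right_cancel₀ h5
  rw [h4, mul_right_comm, ← MvPolynomial.C_mul, div_mul_cancel₀ _ hz]

theorem ufd_split {K σ : Type} [Field K] {s t : Set σ} (hst : Disjoint s t)
    {α β f g : MvPolynomial σ K} {k : ℕ} (hk : k ≠ 0) (hα : α ≠ 0)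
    (hf0 : f ≠ 0) (hg0 : g ≠ 0)
    (hf : f ∈ supported K s) (hg : g ∈ supported K t) (h : α ^ k * g = β ^ k * f) :
    ∃ γ α₁ β₁ : MvPolynomial σ K, γ ≠ 0 ∧ α = γ * α₁ ∧ β = γ * β₁ ∧
      α₁ ∈ supported K s ∧ β₁ ∈ supported K t ∧ ∃ c : K, f = MvPolynomial.C c * α₁ ^ k := by
  obtain ⟨α₁, β₁, γ, hrel, h1, h2⟩ := UniqueFactorizationMonoid.exists_reduced_factors α hα β
  have hγ : γ ≠ 0 := by rintro rfl; simp at h1; exact hα h1.symm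
  have h3 : α₁ ^ k * g = β₁ ^ k * f := by
    apply mul_left_cancel₀ (pow_ne_zero k hγ)
    rw [← mul_assoc, ← mul_assoc, ← mul_pow, ← mul_pow, h1, h2, h]
  have hrel' : IsRelPrime (α₁ ^ k) (β₁ ^ k) := IsRelPrime.pow hrel
  obtain ⟨c, hc⟩ : α₁ ^ k ∣ f := hrel'.dvd_of_dvd_mul_left ⟨g, h3.symm⟩
  have hα₁ : α₁ ≠ 0 := by rintro rfl; simp at h1; exact hα h1.symm
  have h4 : g = β₁ ^ k * c := by
    apply mul_left_cancel₀ (pow_ne_zero k hα₁)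
    rw [h3, hc]; ring
  obtain ⟨c', hc'⟩ := const_of_supported hst
    (supported_of_dvd (a := c) (b := f) ⟨α₁ ^ k, by rw [hc]; ring⟩ hf0 hf)
    (supported_of_dvd (a := c) (b := g) ⟨β₁ ^ k, by rw [h4]; ring⟩ hg0 hg)
  refine ⟨γ, α₁, β₁, hγ, h1.symm, h2.symm, ?_, ?_, c', ?_⟩
  · exact supported_of_dvd ((dvd_pow_self _ hk).trans ⟨c, hc⟩) hf0 hf
  · exact supported_of_dvd ((dvd_pow_self _ hk).trans ⟨c, h4⟩) hg0 hg
  · rw [hc, hc']; ring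

theorem integral_coeffs {K R L : Type} [Field K] [CommRing R] [IsDomain R] [IsIntegrallyClosed R]
    [Field L] [Algebra K R] [Algebra R L] [IsFractionRing R L]
    (v : Polynomial K) (hv : v.natDegree ≠ 0) (Q : Polynomial L) (f : Polynomial R)
    (h : (v.map ((algebraMap R L).comp (algebraMap K R))).comp Q = f.map (algebraMap R L)) :
    ∃ Q' : Polynomial R, Q'.map (algebraMap R L) = Q := by
  set j : K →+* L := (algebraMap R L).comp (algebraMap K R) with hj
  have hv0 : v ≠ 0 := by rintro rfl; simp at hv
  have hl : v.leadingCoeff ≠ 0 := by simpa using hv0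
  letI : Algebra (Polynomial R) (Polynomial L) := Polynomial.algebra R L
  have hint : IsIntegral (Polynomial R) Q := by
    let w : Polynomial (Polynomial R) :=
      (v * Polynomial.C v.leadingCoeff⁻¹).map (Polynomial.C.comp (algebraMap K R))
    have hw : w.Monic := (Polynomial.monic_mul_leadingCoeff_inv hv0).map _
    have hd : w.natDegree ≠ 0 := by
      rw [Polynomial.natDegree_map_eq_of_injective
        (f := Polynomial.C.comp (algebraMap K R))
        (by simpa using Polynomial.C_injective.comp (algebraMap K R).injective),
        Polynomial.natDegree_mul_C (inv_ne_zero hl)]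
      exact hv
    refine IsIntegral.of_aeval_monic hw hd ?_
    have : Polynomial.aeval Q w =
        algebraMap (Polynomial R) (Polynomial L) (f * Polynomial.C (algebraMap K R v.leadingCoeff⁻¹)) := by
      rw [map_mul]
      have e : algebraMap (Polynomial R) (Polynomial L) f = f.map (algebraMap R L) := rfl
      rw [e, ← h]
      simp only [w, Polynomial.map_mul, map_mul, Polynomial.map_C]
      congr 1
      · rw [Polynomial.aeval_def, Polynomial.eval₂_map, Polynomial.comp, Polynomial.eval₂_map]
        congr 1
        ext x
        simp [hj]
      · simp
    rw [this]
    exact isIntegral_algebraMap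
  have hc : Q ∈ Polynomial.lifts (algebraMap R L) := by
    rw [Polynomial.lifts_iff_coeff_lifts]
    intro i
    exact IsIntegrallyClosed.isIntegral_iff.mp (hint.coeff i)
  exact (Polynomial.mem_lifts _).1 hc

theorem clear_denoms_one {R L : Type} [CommRing R] [IsDomain R] [Field L] [Algebra R L]
    [IsFractionRing R L] (Q : Polynomial L) :
    ∃ d : R, d ≠ 0 ∧ ∃ Q' : Polynomial R,
      Q'.map (algebraMap R L) = Polynomial.C (algebraMap R L d) * Q := by
  induction Q using Polynomial.induction_on' with
  | add p q hp hq =>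
    obtain ⟨d, hd, p', hp'⟩ := hp
    obtain ⟨e, he, q', hq'⟩ := hq
    refine ⟨d * e, mul_ne_zero hd he, Polynomial.C e * p' + Polynomial.C d * q', ?_⟩
    simp only [Polynomial.map_add, Polynomial.map_mul, hp', hq', Polynomial.map_C, map_mul]
    ring
  | monomial i a =>
    obtain ⟨x, y, hy, rfl⟩ := IsFractionRing.div_surjective (A := R) a
    have hy0 : y ≠ 0 := nonZeroDivisors.ne_zero hy
    have hy' : algebraMap R L y ≠ 0 := by simpa using hy0
    refine ⟨y, hy0, Polynomial.monomial i x, ?_⟩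
    rw [Polynomial.map_monomial, Polynomial.C_mul_monomial, mul_div_cancel₀ _ hy']

theorem clear_denoms_two {R L : Type} [CommRing R] [IsDomain R] [Field L] [Algebra R L]
    [IsFractionRing R L] (Q : Polynomial (Polynomial L)) :
    ∃ d : R, d ≠ 0 ∧ ∃ Q' : Polynomial (Polynomial R),
      Q'.map (Polynomial.mapRingHom (algebraMap R L)) =
        Polynomial.C (Polynomial.C (algebraMap R L d)) * Q := by
  induction Q using Polynomial.induction_on' with
  | add p q hp hq =>
    obtain ⟨d, hd, p', hp'⟩ := hp
    obtain ⟨e, he, q', hq'⟩ := hq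
    refine ⟨d * e, mul_ne_zero hd he,
      Polynomial.C (Polynomial.C e) * p' + Polynomial.C (Polynomial.C d) * q', ?_⟩
    simp only [Polynomial.map_add, Polynomial.map_mul, hp', hq', Polynomial.map_C, map_mul,
      Polynomial.coe_mapRingHom]
    ring
  | monomial i a =>
    obtain ⟨d, hd, a', ha'⟩ := clear_denoms_one (R := R) a
    refine ⟨d, hd, Polynomial.monomial i a', ?_⟩
    rw [Polynomial.map_monomial, Polynomial.C_mul_monomial, Polynomial.coe_mapRingHom, ha']

theorem gauss_two {R : Type} [CommRing R] [IsDomain R] [UniqueFactorizationMonoid R]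
    {P W : Polynomial (Polynomial R)}
    (hP : ∀ π : R, Prime π → ¬ Polynomial.C (Polynomial.C π) ∣ P) (d : R) :
    d ≠ 0 → ∀ Q, Polynomial.C (Polynomial.C d) * W = Q * P → P ∣ W := by
  induction d using UniqueFactorizationMonoid.induction_on_prime with
  | h₁ => intro h; exact absurd rfl h
  | h₂ x hx =>
    intro _ Q h
    have hu : IsUnit (Polynomial.C (Polynomial.C x)) :=
      (hx.map (Polynomial.C)).map (Polynomial.C)
    exact (hu.dvd_mul_left).1 ⟨Q, by rw [h]; ring⟩
  | h₃ a π ha hπ ih =>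
    intro _ Q h
    have hπ' : Prime (Polynomial.C (Polynomial.C π)) := by
      rw [Polynomial.prime_C_iff, Polynomial.prime_C_iff]; exact hπ
    have h1 : Polynomial.C (Polynomial.C π) ∣ Q * P := by
      rw [← h]; simp only [map_mul, mul_assoc]; exact dvd_mul_right _ _
    obtain ⟨Q', rfl⟩ := (hπ'.dvd_or_dvd h1).resolve_right (hP π hπ)
    refine ih ha Q' (mul_left_cancel₀ hπ'.ne_zero ?_)
    rw [← mul_assoc, ← mul_assoc, ← h]; simp only [map_mul]

/-- `φ` with values in `K[X,Y][s,t]`. -/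
noncomputable def Phi0 (K : Type) [Field K] (n m : ℕ) :
    MvPolynomial (Fin n ⊕ Fin m) K →ₐ[K]
      Polynomial (Polynomial (MvPolynomial (Fin n ⊕ Fin m) K)) :=
  aeval (Sum.elim
    (fun i => Polynomial.C (Polynomial.C (X (Sum.inl i)) * Polynomial.X))
    (fun j => Polynomial.C (Polynomial.C (X (Sum.inr j))) * Polynomial.X))

noncomputable def phi1 (K : Type) [Field K] (n m : ℕ) :
    MvPolynomial (Fin n) K →ₐ[K] Polynomial (MvPolynomial (Fin n ⊕ Fin m) K) :=
  aeval (fun i => Polynomial.C (X (Sum.inl i)) * Polynomial.X)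

noncomputable def phi2 (K : Type) [Field K] (n m : ℕ) :
    MvPolynomial (Fin m) K →ₐ[K] Polynomial (MvPolynomial (Fin n ⊕ Fin m) K) :=
  aeval (fun i => Polynomial.C (X (Sum.inr i)) * Polynomial.X)

theorem hom_eq_of_X {K σ T : Type} [Field K] [Semiring T] {f g : MvPolynomial σ K →+* T}
    (hC : ∀ c, f (MvPolynomial.C c) = g (MvPolynomial.C c)) (hX : ∀ i, f (X i) = g (X i))
    (p : MvPolynomial σ K) : f p = g p := by
  have : f = g := MvPolynomial.ringHom_ext hC hX
  rw [this]

theorem Phi0_C (K : Type) [Field K] (n m : ℕ) (c : K) :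
    Phi0 K n m (MvPolynomial.C c) = Polynomial.C (Polynomial.C (MvPolynomial.C c)) := by
  rw [Phi0, MvPolynomial.aeval_C]; rfl

theorem phi1_C (K : Type) [Field K] (n m : ℕ) (c : K) :
    phi1 K n m (MvPolynomial.C c) = Polynomial.C (MvPolynomial.C c) := by
  rw [phi1, MvPolynomial.aeval_C]; rfl

theorem phi2_C (K : Type) [Field K] (n m : ℕ) (c : K) :
    phi2 K n m (MvPolynomial.C c) = Polynomial.C (MvPolynomial.C c) := by
  rw [phi2, MvPolynomial.aeval_C]; rfl

theorem phi_eq_map (K : Type) [Field K] (n m : ℕ) (p : MvPolynomial (Fin n ⊕ Fin m) K) :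
    phi K n m p = (Phi0 K n m p).map (Polynomial.mapRingHom (algebraMap _
      (FractionRing (MvPolynomial (Fin n ⊕ Fin m) K)))) := by
  refine hom_eq_of_X (f := (phi K n m).toRingHom)
    (g := (Polynomial.mapRingHom (Polynomial.mapRingHom (algebraMap _
      (FractionRing (MvPolynomial (Fin n ⊕ Fin m) K))))).comp (Phi0 K n m).toRingHom) ?_ ?_ p
  · intro c
    simp only [AlgHom.toRingHom_eq_coe, RingHom.coe_coe, RingHom.comp_apply, Phi0_C]
    rw [phi, MvPolynomial.aeval_C]
    simp only [Polynomial.coe_mapRingHom, Polynomial.map_C]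
    rfl
  · rintro (i | i) <;> simp [phi, Phi0]

theorem Phi0_inl (K : Type) [Field K] (n m : ℕ) (f : MvPolynomial (Fin n) K) :
    Phi0 K n m (rename Sum.inl f) = Polynomial.C (phi1 K n m f) := by
  refine hom_eq_of_X (f := ((Phi0 K n m).comp (rename Sum.inl)).toRingHom)
    (g := Polynomial.C.comp (phi1 K n m).toRingHom) ?_ ?_ f
  · intro c; simp [Phi0_C, phi1_C]
  · intro i; simp [Phi0, phi1]

theorem Phi0_inr (K : Type) [Field K] (n m : ℕ) (g : MvPolynomial (Fin m) K) :
    Phi0 K n m (rename Sum.inr g) = (phi2 K n m g).map Polynomial.C := by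
  refine hom_eq_of_X (f := ((Phi0 K n m).comp (rename Sum.inr)).toRingHom)
    (g := (Polynomial.mapRingHom Polynomial.C).comp (phi2 K n m).toRingHom) ?_ ?_ g
  · intro c; simp [Phi0_C, phi2_C]
  · intro i; simp [Phi0, phi2]

theorem phi1_eval (K : Type) [Field K] (n m : ℕ) (f : MvPolynomial (Fin n) K) :
    (phi1 K n m f).eval 1 = rename Sum.inl f := by
  refine hom_eq_of_X (f := (Polynomial.evalRingHom 1).comp (phi1 K n m).toRingHom)
    (g := (rename Sum.inl : MvPolynomial (Fin n) K →ₐ[K] MvPolynomial (Fin n ⊕ Fin m) K).toRingHom)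
    ?_ ?_ f
  · intro c; simp [phi1_C]
  · intro i; simp [phi1]

theorem phi2_eval (K : Type) [Field K] (n m : ℕ) (f : MvPolynomial (Fin m) K) :
    (phi2 K n m f).eval 1 = rename Sum.inr f := by
  refine hom_eq_of_X (f := (Polynomial.evalRingHom 1).comp (phi2 K n m).toRingHom)
    (g := (rename Sum.inr : MvPolynomial (Fin m) K →ₐ[K] MvPolynomial (Fin n ⊕ Fin m) K).toRingHom)
    ?_ ?_ f
  · intro c; simp [phi2_C]
  · intro i; simp [phi2]

theorem rename_inl_mem (K : Type) [Field K] (n m : ℕ) (f : MvPolynomial (Fin n) K) :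
    rename Sum.inl f ∈ supported K (Set.range (Sum.inl : Fin n → Fin n ⊕ Fin m)) := by
  classical
  rw [mem_supported]
  intro i hi
  have := vars_rename (Sum.inl : Fin n → Fin n ⊕ Fin m) f hi
  rw [Finset.mem_image] at this
  obtain ⟨a, _, rfl⟩ := this
  exact ⟨a, rfl⟩

theorem rename_inr_mem (K : Type) [Field K] (n m : ℕ) (f : MvPolynomial (Fin m) K) :
    rename Sum.inr f ∈ supported K (Set.range (Sum.inr : Fin m → Fin n ⊕ Fin m)) := by
  classical
  rw [mem_supported]
  intro i hi
  have := vars_rename (Sum.inr : Fin m → Fin n ⊕ Fin m) f hi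
  rw [Finset.mem_image] at this
  obtain ⟨a, _, rfl⟩ := this
  exact ⟨a, rfl⟩

theorem coeffs_supported {K σ τ : Type} [Field K] (s : Set σ)
    (h : MvPolynomial τ K →+* Polynomial (MvPolynomial σ K))
    (hC : ∀ c, h (MvPolynomial.C c) = Polynomial.C (MvPolynomial.C c))
    (hX : ∀ i, ∃ j ∈ s, h (X i) = Polynomial.C (X j) * Polynomial.X) (f : MvPolynomial τ K) :
    ∀ i, (h f).coeff i ∈ supported K s := by
  induction f using MvPolynomial.induction_on with
  | C a =>
    intro i
    rw [hC, Polynomial.coeff_C]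
    split_ifs
    · exact (supported K s).algebraMap_mem a
    · exact zero_mem _
  | add p q hp hq => intro i; rw [map_add, Polynomial.coeff_add]; exact add_mem (hp i) (hq i)
  | mul_X p j hp =>
    obtain ⟨l, hl, e⟩ := hX j
    intro i
    rw [map_mul, e, ← mul_assoc]
    rcases i with _ | i
    · simp
    · rw [Polynomial.coeff_mul_X, Polynomial.coeff_mul_C]
      exact mul_mem (hp i) (X_mem_supported.2 hl)

theorem phi1_coeff (K : Type) [Field K] (n m : ℕ) (f : MvPolynomial (Fin n) K) (i : ℕ) :
    (phi1 K n m f).coeff i ∈ supported K (Set.range (Sum.inl : Fin n → Fin n ⊕ Fin m)) :=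
  coeffs_supported _ (phi1 K n m).toRingHom (phi1_C K n m)
    (fun i => ⟨Sum.inl i, Set.mem_range_self i, by simp [phi1]⟩) f i

theorem phi2_coeff (K : Type) [Field K] (n m : ℕ) (f : MvPolynomial (Fin m) K) (i : ℕ) :
    (phi2 K n m f).coeff i ∈ supported K (Set.range (Sum.inr : Fin m → Fin n ⊕ Fin m)) :=
  coeffs_supported _ (phi2 K n m).toRingHom (phi2_C K n m)
    (fun i => ⟨Sum.inr i, Set.mem_range_self i, by simp [phi2]⟩) f i

theorem Phi0_t0 (K : Type) [Field K] (n m : ℕ) (p : MvPolynomial (Fin n ⊕ Fin m) K) :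
    (Phi0 K n m p).eval 0 = phi1 K n m (aeval (Sum.elim X (fun _ => 0)) p) := by
  refine hom_eq_of_X (f := (Polynomial.evalRingHom 0).comp (Phi0 K n m).toRingHom)
    (g := (phi1 K n m).toRingHom.comp (aeval (Sum.elim X (fun _ => 0)) :
      MvPolynomial (Fin n ⊕ Fin m) K →ₐ[K] MvPolynomial (Fin n) K).toRingHom) ?_ ?_ p
  · intro c; simp [Phi0_C, phi1_C, MvPolynomial.algebraMap_eq]
  · rintro (i | i) <;> simp [Phi0, phi1]

theorem Phi0_s0 (K : Type) [Field K] (n m : ℕ) (p : MvPolynomial (Fin n ⊕ Fin m) K) :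
    (Phi0 K n m p).map (Polynomial.evalRingHom 0) =
      phi2 K n m (aeval (Sum.elim (fun _ => 0) X) p) := by
  refine hom_eq_of_X
    (f := (Polynomial.mapRingHom (Polynomial.evalRingHom 0)).comp (Phi0 K n m).toRingHom)
    (g := (phi2 K n m).toRingHom.comp (aeval (Sum.elim (fun _ => 0) X) :
      MvPolynomial (Fin n ⊕ Fin m) K →ₐ[K] MvPolynomial (Fin m) K).toRingHom) ?_ ?_ p
  · intro c; simp [Phi0_C, phi2_C, MvPolynomial.algebraMap_eq]
  · rintro (i | i) <;> simp [Phi0, phi2]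

theorem Phi0_11 (K : Type) [Field K] (n m : ℕ) (p : MvPolynomial (Fin n ⊕ Fin m) K) :
    (Phi0 K n m p).evalEval 1 1 = p := by
  refine hom_eq_of_X (f := (Polynomial.evalEvalRingHom 1 1).comp (Phi0 K n m).toRingHom)
    (g := RingHom.id _) ?_ ?_ p
  · intro c; simp [Phi0_C, Polynomial.evalEval]
  · rintro (i | i) <;> simp [Phi0, Polynomial.evalEval]

theorem disj_ranges (n m : ℕ) : Disjoint (Set.range (Sum.inl : Fin n → Fin n ⊕ Fin m))
    (Set.range (Sum.inr : Fin m → Fin n ⊕ Fin m)) := by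
  rw [Set.disjoint_left]
  rintro _ ⟨a, rfl⟩ ⟨b, hb⟩
  cases hb

theorem primitive_Phi0 (K : Type) [Field K] (n m : ℕ) (p : MvPolynomial (Fin n ⊕ Fin m) K)
    (π : MvPolynomial (Fin n ⊕ Fin m) K) (hπ : Prime π)
    (h : Polynomial.C (Polynomial.C π) ∣ Phi0 K n m p) :
    (Phi0 K n m p).eval 0 = 0 ∨ (Phi0 K n m p).map (Polynomial.evalRingHom 0) = 0 := by
  by_cases hX : π ∈ supported K (Set.range (Sum.inl : Fin n → Fin n ⊕ Fin m))
  · right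
    have hY : π ∉ supported K (Set.range (Sum.inr : Fin m → Fin n ⊕ Fin m)) := by
      intro hY
      obtain ⟨c, hc⟩ := const_of_supported (disj_ranges n m) hX hY
      have hc0 : c ≠ 0 := by rintro rfl; exact hπ.ne_zero (by simpa using hc)
      exact hπ.not_isUnit (by rw [hc]; exact (isUnit_iff_ne_zero.2 hc0).map _)
    have h1 : Polynomial.C π ∣ (Phi0 K n m p).map (Polynomial.evalRingHom 0) := by
      have := map_dvd (Polynomial.mapRingHom (Polynomial.evalRingHom
        (0 : MvPolynomial (Fin n ⊕ Fin m) K))) h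
      simpa using this
    rw [Polynomial.C_dvd_iff_dvd_coeff] at h1
    ext1 i
    by_contra h0
    refine hY (supported_of_dvd (h1 i) h0 ?_)
    rw [Phi0_s0]; exact phi2_coeff K n m _ i
  · left
    have h1 : Polynomial.C π ∣ (Phi0 K n m p).eval 0 := by
      have := map_dvd (Polynomial.evalRingHom
        (0 : Polynomial (MvPolynomial (Fin n ⊕ Fin m) K))) h
      simpa using this
    rw [Polynomial.C_dvd_iff_dvd_coeff] at h1
    ext1 i
    by_contra h0
    refine hX (supported_of_dvd (h1 i) h0 ?_)
    rw [Phi0_t0]; exact phi1_coeff K n m _ i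

theorem mem_sepPair_gen {L : Type} [Field L] {P : Polynomial (Polynomial L)}
    {F G : Polynomial L} :
    (F, G) ∈ sepPair (R := L) Polynomial.CAlgHom (Polynomial.mapAlgHom Polynomial.CAlgHom)
      (Ideal.span {P}) ↔ P ∣ Polynomial.C F - G.map Polynomial.C := by
  rw [← Ideal.mem_span_singleton]
  exact Iff.rfl

theorem nonvan_one {R : Type} [CommRing R] [IsDomain R] {P Q : Polynomial (Polynomial R)} {d : R}
    {F G : Polynomial R} (hd : d ≠ 0)
    (hQ : Polynomial.C (Polynomial.C d) * (Polynomial.C F - G.map Polynomial.C) = Q * P)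
    (hF : F = 0) (hG : G ≠ 0) : ∃ r : Polynomial R, P = r.map Polynomial.C := by
  have hdCC : Polynomial.C (Polynomial.C d) ≠ 0 := by simpa using hd
  have h1 := congrArg Polynomial.Bivariate.swap hQ
  rw [hF, map_zero, zero_sub, map_mul, map_mul, map_neg, Polynomial.Bivariate.swap_map_C,
    Polynomial.Bivariate.swap_C_C] at h1
  have hne0 : Polynomial.C (Polynomial.C d) * -Polynomial.C G ≠ 0 :=
    mul_ne_zero hdCC (neg_ne_zero.2 (by simpa using hG))
  have h2 : (Polynomial.Bivariate.swap P).natDegree = 0 := by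
    have h3 : (Polynomial.C (Polynomial.C d) * -Polynomial.C G).natDegree = 0 := by
      rw [← Polynomial.C_neg, ← Polynomial.C_mul, Polynomial.natDegree_C]
    rw [h1] at h3 hne0
    rw [Polynomial.natDegree_mul (left_ne_zero_of_mul hne0) (right_ne_zero_of_mul hne0)] at h3
    omega
  rw [Polynomial.natDegree_eq_zero] at h2
  obtain ⟨r, hr⟩ := h2
  refine ⟨r, ?_⟩
  rw [← Polynomial.Bivariate.swap_swap_apply P, ← hr, Polynomial.Bivariate.swap_C]

theorem nonvan_two {R : Type} [CommRing R] [IsDomain R] {P Q : Polynomial (Polynomial R)} {d : R}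
    {F G : Polynomial R} (hd : d ≠ 0)
    (hQ : Polynomial.C (Polynomial.C d) * (Polynomial.C F - G.map Polynomial.C) = Q * P)
    (hF : F ≠ 0) (hG : G = 0) : ∃ r : Polynomial R, P = Polynomial.C r := by
  have hdCC : Polynomial.C (Polynomial.C d) ≠ 0 := by simpa using hd
  rw [hG, Polynomial.map_zero, sub_zero] at hQ
  have hne0 : Polynomial.C (Polynomial.C d) * Polynomial.C F ≠ 0 :=
    mul_ne_zero hdCC (by simpa using hF)
  have h2 : P.natDegree = 0 := by
    have h3 : (Polynomial.C (Polynomial.C d) * Polynomial.C F).natDegree = 0 := by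
      rw [← Polynomial.C_mul, Polynomial.natDegree_C]
    rw [hQ] at h3 hne0
    rw [Polynomial.natDegree_mul (left_ne_zero_of_mul hne0) (right_ne_zero_of_mul hne0)] at h3
    omega
  rw [Polynomial.natDegree_eq_zero] at h2
  obtain ⟨r, hr⟩ := h2
  exact ⟨r, hr.symm⟩

theorem nonvan_three {R : Type} [CommRing R] [IsDomain R] {P Q : Polynomial (Polynomial R)} {d : R}
    {F G : Polynomial R} (hd : d ≠ 0)
    (hQ : Polynomial.C (Polynomial.C d) * (Polynomial.C F - G.map Polynomial.C) = Q * P)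
    (hG0 : G.coeff 0 = 0) (h0 : P.eval 0 = 0) : F = 0 := by
  have hdC : Polynomial.C d ≠ 0 := by simpa using hd
  have h1 := congrArg (Polynomial.eval 0) hQ
  rw [Polynomial.eval_mul, Polynomial.eval_mul, h0, mul_zero, Polynomial.eval_C,
    Polynomial.eval_sub, Polynomial.eval_C, ← Polynomial.coeff_zero_eq_eval_zero,
    Polynomial.coeff_map, hG0, map_zero, sub_zero] at h1
  exact (mul_eq_zero.1 h1).resolve_left hdC

theorem nonvan_four {R : Type} [CommRing R] [IsDomain R] {P Q : Polynomial (Polynomial R)} {d : R}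
    {F G : Polynomial R} (hd : d ≠ 0)
    (hQ : Polynomial.C (Polynomial.C d) * (Polynomial.C F - G.map Polynomial.C) = Q * P)
    (hF0 : F.coeff 0 = 0) (h0 : P.map (Polynomial.evalRingHom 0) = 0) : G = 0 := by
  have hdC : Polynomial.C d ≠ 0 := by simpa using hd
  have h1 := congrArg (Polynomial.map (Polynomial.evalRingHom 0)) hQ
  rw [Polynomial.map_mul, Polynomial.map_mul, h0, mul_zero, Polynomial.map_C,
    Polynomial.map_sub, Polynomial.map_C, Polynomial.map_map, Polynomial.coe_evalRingHom,
    Polynomial.eval_C, ← Polynomial.coeff_zero_eq_eval_zero, hF0, map_zero, zero_sub] at h1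
  have e : (Polynomial.evalRingHom (0 : R)).comp Polynomial.C = RingHom.id _ := by
    ext x; simp
  rw [e, Polynomial.map_id] at h1
  exact neg_eq_zero.1 ((mul_eq_zero.1 h1).resolve_left hdC)

abbrev Rp (K : Type) [Field K] (n m : ℕ) : Type := MvPolynomial (Fin n ⊕ Fin m) K

abbrev Lp (K : Type) [Field K] (n m : ℕ) : Type := FractionRing (MvPolynomial (Fin n ⊕ Fin m) K)

theorem mem_sepBar {K : Type} [Field K] {n m : ℕ} {p : Rp K n m}
    {F G : Polynomial (Lp K n m)} :
    (F, G) ∈ sepBar K n m (Ideal.span {phi K n m p}) ↔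
      phi K n m p ∣ Polynomial.C F - G.map Polynomial.C := by
  exact mem_sepPair_gen

theorem mem_sepPair {K : Type} [Field K] {n m : ℕ} {p : Rp K n m}
    {f : MvPolynomial (Fin n) K} {g : MvPolynomial (Fin m) K} :
    (f, g) ∈ sepPair (rename Sum.inl) (rename Sum.inr) (Ideal.span {p}) ↔
      p ∣ rename Sum.inl f - rename Sum.inr g := by
  rw [← Ideal.mem_span_singleton]
  exact Iff.rfl

theorem map_map_injective (K : Type) [Field K] (n m : ℕ) : Function.Injective
    (Polynomial.map (Polynomial.mapRingHom (algebraMap (Rp K n m) (Lp K n m)))) :=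
  Polynomial.map_injective _ (Polynomial.map_injective _ (IsFractionRing.injective _ _))

theorem sep_cleared {K : Type} [Field K] {n m : ℕ} {p : Rp K n m}
    {F₀ G₀ : Polynomial (Rp K n m)}
    (h : phi K n m p ∣ Polynomial.C (F₀.map (algebraMap (Rp K n m) (Lp K n m))) -
      (G₀.map (algebraMap (Rp K n m) (Lp K n m))).map Polynomial.C) :
    ∃ d : Rp K n m, d ≠ 0 ∧ ∃ Q, Polynomial.C (Polynomial.C d) *
      (Polynomial.C F₀ - G₀.map Polynomial.C) = Q * Phi0 K n m p := by
  obtain ⟨Q, hQ⟩ := h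
  obtain ⟨d, hd, Q', hQ'⟩ := clear_denoms_two (R := Rp K n m) Q
  refine ⟨d, hd, Q', map_map_injective K n m ?_⟩
  rw [Polynomial.map_mul, Polynomial.map_mul, hQ', ← phi_eq_map]
  have e : Polynomial.map (Polynomial.mapRingHom (algebraMap (Rp K n m) (Lp K n m)))
      (Polynomial.C F₀ - G₀.map Polynomial.C) =
      Polynomial.C (F₀.map (algebraMap (Rp K n m) (Lp K n m))) -
      (G₀.map (algebraMap (Rp K n m) (Lp K n m))).map Polynomial.C := by
    rw [Polynomial.map_sub, Polynomial.map_C, Polynomial.map_map, Polynomial.map_map]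
    congr 2
    ext x <;> simp
  rw [e, hQ]
  simp only [Polynomial.map_C, Polynomial.coe_mapRingHom]
  ring

theorem evalEval_10 (K : Type) [Field K] (n m : ℕ) (p : Rp K n m) :
    (Phi0 K n m p).evalEval 1 0 ∈
      supported K (Set.range (Sum.inl : Fin n → Fin n ⊕ Fin m)) := by
  rw [Polynomial.evalEval, map_zero, Phi0_t0, phi1_eval]
  exact rename_inl_mem K n m _

theorem evalEval_01 (K : Type) [Field K] (n m : ℕ) (p : Rp K n m) :
    (Phi0 K n m p).evalEval 0 1 ∈
      supported K (Set.range (Sum.inr : Fin m → Fin n ⊕ Fin m)) := by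
  rw [← Polynomial.map_evalRingHom_eval, Phi0_s0, phi2_eval]
  exact rename_inr_mem K n m _

theorem setup_facts {K : Type} [Field K] {n m : ℕ} {p : Rp K n m}
    (hpX : p ∉ supported K (Set.range (Sum.inl : Fin n → Fin n ⊕ Fin m)))
    (hpY : p ∉ supported K (Set.range (Sum.inr : Fin m → Fin n ⊕ Fin m)))
    {F₀ G₀ : Polynomial (Rp K n m)} (hne : ¬ (F₀ = 0 ∧ G₀ = 0))
    (hF₀0 : F₀.coeff 0 = 0) (hG₀0 : G₀.coeff 0 = 0)
    (h : phi K n m p ∣ Polynomial.C (F₀.map (algebraMap (Rp K n m) (Lp K n m))) -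
      (G₀.map (algebraMap (Rp K n m) (Lp K n m))).map Polynomial.C) :
    F₀ ≠ 0 ∧ G₀ ≠ 0 ∧ Phi0 K n m p ∣ Polynomial.C F₀ - G₀.map Polynomial.C := by
  obtain ⟨d, hd, Q, hQ⟩ := sep_cleared h
  have hF : F₀ ≠ 0 := by
    intro hF
    obtain ⟨r, h4⟩ := nonvan_one hd hQ hF (fun hG => hne ⟨hF, hG⟩)
    apply hpY
    have h5 := evalEval_01 K n m p
    rw [h4, Polynomial.evalEval_map_C] at h5
    rwa [← Phi0_11 K n m p, h4, Polynomial.evalEval_map_C]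
  have hG : G₀ ≠ 0 := by
    intro hG
    obtain ⟨r, h4⟩ := nonvan_two hd hQ hF hG
    apply hpX
    have h5 := evalEval_10 K n m p
    rw [h4, Polynomial.evalEval_C] at h5
    rwa [← Phi0_11 K n m p, h4, Polynomial.evalEval_C]
  refine ⟨hF, hG, gauss_two ?_ d hd Q hQ⟩
  intro π hπ hdvd
  rcases primitive_Phi0 K n m p π hπ hdvd with h0 | h0
  · exact hF (nonvan_three hd hQ hG₀0 h0)
  · exact hG (nonvan_four hd hQ hF₀0 h0)

theorem const_of_rename_eq {K : Type} [Field K] {n m : ℕ}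
    {f : MvPolynomial (Fin n) K} {g : MvPolynomial (Fin m) K}
    (h : (rename Sum.inl f : Rp K n m) = rename Sum.inr g) :
    ∃ c : K, (f, g) = (MvPolynomial.C c, MvPolynomial.C c) := by
  obtain ⟨c, hc⟩ := const_of_supported (disj_ranges n m) (rename_inl_mem K n m f)
    (h ▸ rename_inr_mem K n m g)
  refine ⟨c, Prod.ext ?_ ?_⟩
  · apply rename_injective (Sum.inl : Fin n → Fin n ⊕ Fin m) Sum.inl_injective
    rw [hc, rename_C]
  · apply rename_injective (Sum.inr : Fin m → Fin n ⊕ Fin m) Sum.inr_injective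
    rw [← h, hc, rename_C]

theorem exists_outer {K : Type} [Field K] {n m : ℕ} {p : Rp K n m}
    {F G : Polynomial (Lp K n m)}
    (hgen : Algebra.adjoin (Lp K n m) {(F, G)} = sepBar K n m (Ideal.span {phi K n m p}))
    {f : MvPolynomial (Fin n) K} {g : MvPolynomial (Fin m) K}
    (h : p ∣ rename Sum.inl f - rename Sum.inr g) :
    ∃ u : Polynomial (Lp K n m),
      u.comp F = (phi1 K n m f).map (algebraMap (Rp K n m) (Lp K n m)) ∧
      u.comp G = (phi2 K n m g).map (algebraMap (Rp K n m) (Lp K n m)) := by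
  have h1 : ((phi1 K n m f).map (algebraMap (Rp K n m) (Lp K n m)),
      (phi2 K n m g).map (algebraMap (Rp K n m) (Lp K n m))) ∈
      sepBar K n m (Ideal.span {phi K n m p}) := by
    rw [mem_sepBar]
    have h2 := map_dvd (phi K n m) h
    rw [map_sub, phi_eq_map K n m (rename Sum.inl f), phi_eq_map K n m (rename Sum.inr g),
      Phi0_inl, Phi0_inr, Polynomial.map_C, Polynomial.map_map] at h2
    rw [Polynomial.map_map]
    have e : (Polynomial.mapRingHom (algebraMap (Rp K n m) (Lp K n m))).comp Polynomial.C =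
        Polynomial.C.comp (algebraMap (Rp K n m) (Lp K n m)) := by
      ext x <;> simp
    rw [e] at h2
    exact h2
  rw [← hgen, Algebra.adjoin_singleton_eq_range_aeval] at h1
  obtain ⟨u, hu⟩ := h1
  have hu' : Polynomial.aeval (F, G) u = _ := hu
  refine ⟨u, ?_, ?_⟩
  · have := congrArg (AlgHom.fst (Lp K n m) _ _) hu'
    rw [← Polynomial.aeval_algHom_apply] at this
    rw [Polynomial.comp_eq_aeval]
    exact this
  · have := congrArg (AlgHom.snd (Lp K n m) _ _) hu'
    rw [← Polynomial.aeval_algHom_apply] at this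
    rw [Polynomial.comp_eq_aeval]
    exact this

theorem lift_to_base {K σ : Type} [Field K] [CharZero K] {s t : Set σ} (hst : Disjoint s t)
    {u : Polynomial (FractionRing (MvPolynomial σ K))}
    (hs : u ∈ Polynomial.liftsRing (kf K s).subtype)
    (ht : u ∈ Polynomial.liftsRing (kf K t).subtype) :
    ∃ v : Polynomial K, v.map ((algebraMap (MvPolynomial σ K)
      (FractionRing (MvPolynomial σ K))).comp (algebraMap K (MvPolynomial σ K))) = u := by
  rw [mem_liftsRing_subfield] at hs ht
  have h : u ∈ Polynomial.lifts ((algebraMap (MvPolynomial σ K)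
      (FractionRing (MvPolynomial σ K))).comp (algebraMap K (MvPolynomial σ K))) := by
    rw [Polynomial.lifts_iff_coeff_lifts]
    intro i
    obtain ⟨e, he⟩ := kf_inter hst (hs i) (ht i)
    exact ⟨e, he.symm⟩
  exact (Polynomial.mem_lifts u).1 h

theorem map_mem_kf {K σ : Type} [Field K] {s : Set σ} {f : Polynomial (MvPolynomial σ K)} :
    f.map (algebraMap _ (FractionRing (MvPolynomial σ K))) ∈
      Polynomial.liftsRing (kf K s).subtype ↔ ∀ i, f.coeff i ∈ supported K s := by
  rw [mem_liftsRing_subfield]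
  simp only [Polynomial.coeff_map, algebraMap_mem_kf]

theorem lc_relation {R L : Type} [CommRing R] [IsDomain R] [Field L] [Algebra R L]
    [IsFractionRing R L] {F G f g : Polynomial R} {u : Polynomial L} (hu : u ≠ 0)
    (hF : F.natDegree ≠ 0) (hG : G.natDegree ≠ 0)
    (h1 : u.comp (F.map (algebraMap R L)) = f.map (algebraMap R L))
    (h2 : u.comp (G.map (algebraMap R L)) = g.map (algebraMap R L)) :
    f.leadingCoeff ≠ 0 ∧ g.leadingCoeff ≠ 0 ∧
    F.leadingCoeff ^ u.natDegree * g.leadingCoeff =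
      G.leadingCoeff ^ u.natDegree * f.leadingCoeff := by
  have hinj : Function.Injective (algebraMap R L) := IsFractionRing.injective R L
  have key : ∀ F f : Polynomial R, F.natDegree ≠ 0 →
      u.comp (F.map (algebraMap R L)) = f.map (algebraMap R L) →
      algebraMap R L f.leadingCoeff =
        u.leadingCoeff * (algebraMap R L F.leadingCoeff) ^ u.natDegree := by
    intro F f hF h
    have := congrArg Polynomial.leadingCoeff h
    rw [Polynomial.leadingCoeff_comp (by rwa [Polynomial.natDegree_map_eq_of_injective hinj]),
      Polynomial.leadingCoeff_map_of_injective hinj,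
      Polynomial.leadingCoeff_map_of_injective hinj] at this
    exact this.symm
  have nz : ∀ F f : Polynomial R, F.natDegree ≠ 0 →
      u.comp (F.map (algebraMap R L)) = f.map (algebraMap R L) → f.leadingCoeff ≠ 0 := by
    intro F f hF h h0
    have h3 := key F f hF h
    rw [h0, map_zero] at h3
    have hF0 : F ≠ 0 := by rintro rfl; simp at hF
    refine absurd h3.symm (mul_ne_zero (by simpa using hu) (pow_ne_zero _ ?_))
    rw [Ne, map_eq_zero_iff _ hinj]
    simpa using hF0
  refine ⟨nz F f hF h1, nz G g hG h2, hinj ?_⟩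
  rw [map_mul, map_mul, map_pow, map_pow, key F f hF h1, key G g hG h2]
  ring

theorem core_forward {K σ : Type} [Field K] [CharZero K] {s t : Set σ} (hst : Disjoint s t)
    {F₀ G₀ f g : Polynomial (MvPolynomial σ K)}
    {u : Polynomial (FractionRing (MvPolynomial σ K))} (hu : u.natDegree ≠ 0)
    (hF0 : F₀.coeff 0 = 0) (hG0 : G₀.coeff 0 = 0)
    (hdF : F₀.natDegree ≠ 0) (hdG : G₀.natDegree ≠ 0)
    (hf : ∀ i, f.coeff i ∈ supported K s) (hg : ∀ i, g.coeff i ∈ supported K t)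
    (h1 : u.comp (F₀.map (algebraMap _ (FractionRing (MvPolynomial σ K)))) =
      f.map (algebraMap _ _))
    (h2 : u.comp (G₀.map (algebraMap _ (FractionRing (MvPolynomial σ K)))) =
      g.map (algebraMap _ _))
    (hnofac : ∀ c : MvPolynomial σ K, (∃ F1 G1 : Polynomial (MvPolynomial σ K),
      F₀ = Polynomial.C c * F1 ∧ G₀ = Polynomial.C c * G1) → IsUnit c) :
    (∀ j, F₀.coeff j ∈ supported K s) ∧ (∀ j, G₀.coeff j ∈ supported K t) := by
  classical
  set R := MvPolynomial σ K with hR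
  set L := FractionRing (MvPolynomial σ K) with hL
  have hinj : Function.Injective (algebraMap R L) := IsFractionRing.injective R L
  have : CharZero L := charZero_of_injective_algebraMap hinj
  have hu0 : u ≠ 0 := by rintro rfl; simp at hu
  have hF₀ne : F₀ ≠ 0 := by rintro rfl; simp at hdF
  obtain ⟨hf0, hg0, hrel⟩ := lc_relation hu0 hdF hdG h1 h2
  obtain ⟨γ, α₁, β₁, hγ, hα, hβ, hα₁, hβ₁, -⟩ := ufd_split hst hu
    (by simpa using hF₀ne) hf0 hg0 (hf _) (hg _) hrel
  have hγL : algebraMap R L γ ≠ 0 := by rwa [Ne, map_eq_zero_iff _ hinj]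
  set ut : Polynomial L := u.comp (Polynomial.C (algebraMap R L γ) * Polynomial.X) with hut
  have hutd : ut.natDegree ≠ 0 := by
    rw [hut, Polynomial.natDegree_comp, Polynomial.natDegree_C_mul_X _ hγL, mul_one]
    exact hu
  have comp_eq : ∀ H : Polynomial R,
      ut.comp (Polynomial.C (algebraMap R L γ)⁻¹ * H.map (algebraMap R L)) =
        u.comp (H.map (algebraMap R L)) := by
    intro H
    rw [hut, Polynomial.comp_assoc, Polynomial.mul_comp, Polynomial.C_comp, Polynomial.X_comp,
      ← mul_assoc, ← Polynomial.C_mul, mul_inv_cancel₀ hγL, Polynomial.C_1, one_mul]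
  have inner : ∀ (r : Set σ) (H h : Polynomial R) (a : R), H.coeff 0 = 0 → H.natDegree ≠ 0 →
      (∀ i, h.coeff i ∈ supported K r) →
      u.comp (H.map (algebraMap R L)) = h.map (algebraMap R L) → H.leadingCoeff = γ * a →
      a ∈ supported K r →
      (Polynomial.C (algebraMap R L γ)⁻¹ * H.map (algebraMap R L) ∈
        Polynomial.liftsRing (kf K r).subtype) ∧
      ut ∈ Polynomial.liftsRing (kf K r).subtype := by
    intro r H h a hH0 hHd hh hcomp hlc ha
    have hd : (Polynomial.C (algebraMap R L γ)⁻¹ * H.map (algebraMap R L)).natDegree ≠ 0 := by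
      rw [Polynomial.natDegree_C_mul (inv_ne_zero hγL),
        Polynomial.natDegree_map_eq_of_injective hinj]
      exact hHd
    have hc : ut.comp (Polynomial.C (algebraMap R L γ)⁻¹ * H.map (algebraMap R L)) ∈
        Polynomial.liftsRing (kf K r).subtype := by
      rw [comp_eq, hcomp]
      exact map_mem_kf.2 hh
    have hin := descent_inner (kf K r) hutd (by
        rw [Polynomial.coeff_C_mul, Polynomial.coeff_map, hH0, map_zero, mul_zero]) (by
        rw [Polynomial.leadingCoeff_mul, Polynomial.leadingCoeff_C,
          Polynomial.leadingCoeff_map_of_injective hinj, hlc, map_mul, ← mul_assoc,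
          inv_mul_cancel₀ hγL, one_mul]
        exact algebraMap_mem_kf.2 ha) hd hc
    exact ⟨hin, descent_outer (kf K r) hin hd hc⟩
  obtain ⟨hFt, hus⟩ := inner s F₀ f α₁ hF0 hdF hf h1 hα hα₁
  obtain ⟨hGt, hut'⟩ := inner t G₀ g β₁ hG0 hdG hg h2 hβ hβ₁
  obtain ⟨v, hv⟩ := lift_to_base hst hus hut'
  have hvd : v.natDegree ≠ 0 := by
    intro h0
    apply hutd
    rw [← hv, Polynomial.natDegree_map_eq_of_injective (RingHom.injective _), h0]
  have fin : ∀ (r : Set σ) (H h : Polynomial R),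
      u.comp (H.map (algebraMap R L)) = h.map (algebraMap R L) →
      (Polynomial.C (algebraMap R L γ)⁻¹ * H.map (algebraMap R L) ∈
        Polynomial.liftsRing (kf K r).subtype) →
      ∃ H1 : Polynomial R, H = Polynomial.C γ * H1 ∧ ∀ i, H1.coeff i ∈ supported K r := by
    intro r H h hcomp hlift
    obtain ⟨H1, hH1⟩ := integral_coeffs v hvd
      (Polynomial.C (algebraMap R L γ)⁻¹ * H.map (algebraMap R L)) h
      (by rw [hv, comp_eq, hcomp])
    refine ⟨H1, Polynomial.map_injective _ hinj ?_, ?_⟩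
    · rw [Polynomial.map_mul, Polynomial.map_C, hH1, ← mul_assoc, ← Polynomial.C_mul,
        mul_inv_cancel₀ hγL, Polynomial.C_1, one_mul]
    · rw [← hH1] at hlift
      exact map_mem_kf.1 hlift
  obtain ⟨F1, hF1, hF1s⟩ := fin s F₀ f h1 hFt
  obtain ⟨G1, hG1, hG1t⟩ := fin t G₀ g h2 hGt
  have hunit := hnofac γ ⟨F1, G1, hF1, hG1⟩
  have hγs : ∀ r : Set σ, γ ∈ supported K r := fun r =>
    supported_of_dvd (isUnit_iff_dvd_one.1 hunit) one_ne_zero (one_mem _)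
  constructor
  · intro j
    rw [hF1, Polynomial.coeff_C_mul]
    exact mul_mem (hγs s) (hF1s j)
  · intro j
    rw [hG1, Polynomial.coeff_C_mul]
    exact mul_mem (hγs t) (hG1t j)

theorem dvd_of_common {R : Type} [CommRing R] {c : R} {F G : Polynomial R}
    (h : ∃ F1 G1 : Polynomial R, F = Polynomial.C c * F1 ∧ G = Polynomial.C c * G1) :
    Polynomial.C (Polynomial.C c) ∣ Polynomial.C F - G.map Polynomial.C := by
  obtain ⟨F1, G1, rfl, rfl⟩ := h
  refine ⟨Polynomial.C F1 - G1.map Polynomial.C, ?_⟩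
  rw [Polynomial.C_mul, Polynomial.map_mul, Polynomial.map_C]
  ring

theorem dvd_eval_one {R : Type} [CommRing R] {P : Polynomial (Polynomial R)} {F G : Polynomial R}
    (h : P ∣ Polynomial.C F - G.map Polynomial.C) :
    P.evalEval 1 1 ∣ F.eval 1 - G.eval 1 := by
  have h1 := map_dvd (Polynomial.evalEvalRingHom (1 : R) 1) h
  rw [map_sub] at h1
  simpa [Polynomial.evalEval_C, Polynomial.evalEval_map_C, Polynomial.evalEval] using h1

theorem trivial_of_zero {L : Type} [Field L] (x : Polynomial L × Polynomial L)
    (hx : x ∈ Algebra.adjoin L {((0 : Polynomial L), (0 : Polynomial L))}) :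
    ∃ c : L, x = (Polynomial.C c, Polynomial.C c) := by
  rw [show ((0 : Polynomial L), (0 : Polynomial L)) = 0 from rfl,
    Algebra.adjoin_singleton_zero, Algebra.mem_bot] at hx
  obtain ⟨c, rfl⟩ := hx
  exact ⟨c, rfl⟩

theorem natDegree_ne_zero_of_coeff {R : Type} [CommRing R] {F : Polynomial R} (hF : F ≠ 0)
    (h0 : F.coeff 0 = 0) : F.natDegree ≠ 0 := by
  intro h
  apply hF
  rw [Polynomial.eq_C_of_natDegree_eq_zero h, h0, map_zero]

theorem eval_comp_map {R L : Type} [CommRing R] [Field L] [Algebra R L] {u : Polynomial L}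
    {F f : Polynomial R} (h : u.comp (F.map (algebraMap R L)) = f.map (algebraMap R L)) :
    u.eval (algebraMap R L (F.eval 1)) = algebraMap R L (f.eval 1) := by
  have h1 := congrArg (Polynomial.eval 1) h
  rw [Polynomial.eval_comp, Polynomial.eval_one_map, Polynomial.eval_one_map] at h1
  exact h1

theorem eval_mem_supported {K σ : Type} [Field K] {s : Set σ} {F : Polynomial (MvPolynomial σ K)}
    (hF : ∀ j, F.coeff j ∈ supported K s) : F.eval 1 ∈ supported K s := by
  rw [Polynomial.eval_eq_sum_range]
  refine sum_mem fun i _ => ?_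
  rw [one_pow, mul_one]
  exact hF i

theorem exists_rename_of_supported {K σ τ : Type} [Field K] {e : τ → σ}
    (he : Function.Injective e)
    {a : MvPolynomial σ K} (ha : a ∈ supported K (Set.range e)) :
    ∃ f : MvPolynomial τ K, rename e f = a := by
  rw [mem_supported] at ha
  obtain ⟨f, hf⟩ := exists_rename_eq_of_vars_subset_range a e he ha
  exact ⟨f, hf⟩

theorem aeval_of_eval {K σ τ : Type} [Field K] {e : τ → σ} (he : Function.Injective e)
    {v : Polynomial K} {f f' : MvPolynomial τ K}
    (h : (v.map ((algebraMap (MvPolynomial σ K) (FractionRing (MvPolynomial σ K))).comp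
      (algebraMap K (MvPolynomial σ K)))).eval (algebraMap _ _ (rename e f)) =
      algebraMap _ _ (rename e f')) : Polynomial.aeval f v = f' := by
  apply rename_injective e he
  apply IsFractionRing.injective (MvPolynomial σ K) (FractionRing (MvPolynomial σ K))
  rw [← h, Polynomial.eval_map, ← Polynomial.hom_eval₂, ← Polynomial.aeval_def,
    Polynomial.aeval_algHom_apply]

theorem aeval_prod {K A B : Type} [Field K] [CommRing A] [CommRing B] [Algebra K A] [Algebra K B]
    (v : Polynomial K) (a : A) (b : B) :
    Polynomial.aeval (a, b) v = (Polynomial.aeval a v, Polynomial.aeval b v) := by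
  refine Prod.ext ?_ ?_
  · exact (Polynomial.aeval_algHom_apply (AlgHom.fst K A B) (a, b) v).symm
  · exact (Polynomial.aeval_algHom_apply (AlgHom.snd K A B) (a, b) v).symm

/-- Theorem 5 ("Theorem `thm:5`"): let `p ∈ K[X,Y] \ (K[X] ∪ K[Y])` with `p(0) = 0`,
`I = ⟨p⟩`, `P = φ(p)`, and `Ī = ⟨P⟩ ⊆ K(X,Y)[s,t]`.  Suppose `A(Ī)` is not trivial and let
`(F, G)` be a generator of `A(Ī)` as a `K(X,Y)`-algebra such that `F` and `G` have all
coefficients in `K[X,Y]` (here `F = F₀`, `G = G₀` mapped into `K(X,Y)[s]`, `K(X,Y)[t]`),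
`F - G` has no factor in `K[X,Y]`, and `F|_{s=0} = G|_{t=0} = 0`.  Then `A(I)` is nontrivial
iff `F ∈ K[X][s]`, `G ∈ K[Y][t]` and `F|_{s=1} ≠ G|_{t=1}`; and in this case
`(F|_{s=1}, G|_{t=1})` generates `A(I)` as a `K`-algebra. -/
theorem sepPair_principal_generator (K : Type) [Field K] [CharZero K] (n m : ℕ)
    (p : MvPolynomial (Fin n ⊕ Fin m) K)
    (hpX : p ∉ supported K (Set.range (Sum.inl : Fin n → Fin n ⊕ Fin m)))
    (hpY : p ∉ supported K (Set.range (Sum.inr : Fin m → Fin n ⊕ Fin m)))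
    (hp0 : eval (fun _ => (0 : K)) p = 0)
    (F₀ G₀ : Polynomial (MvPolynomial (Fin n ⊕ Fin m) K))
    (hbar_nontrivial :
      ¬ ∀ FG ∈ sepBar K n m (Ideal.span {phi K n m p}),
        ∃ c : FractionRing (MvPolynomial (Fin n ⊕ Fin m) K),
          FG = (Polynomial.C c, Polynomial.C c))
    (hgen : Algebra.adjoin (FractionRing (MvPolynomial (Fin n ⊕ Fin m) K))
        {(F₀.map (algebraMap (MvPolynomial (Fin n ⊕ Fin m) K)
            (FractionRing (MvPolynomial (Fin n ⊕ Fin m) K))),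
          G₀.map (algebraMap (MvPolynomial (Fin n ⊕ Fin m) K)
            (FractionRing (MvPolynomial (Fin n ⊕ Fin m) K))))} =
      sepBar K n m (Ideal.span {phi K n m p}))
    (hnofac : ∀ c : MvPolynomial (Fin n ⊕ Fin m) K,
      Polynomial.C (Polynomial.C c) ∣ (Polynomial.C F₀ - G₀.map Polynomial.C) → IsUnit c)
    (hF₀0 : F₀.coeff 0 = 0) (hG₀0 : G₀.coeff 0 = 0) :
    ((¬ ∀ fg ∈ sepPair (rename Sum.inl) (rename Sum.inr) (Ideal.span {p}),
        ∃ c : K, fg = (MvPolynomial.C c, MvPolynomial.C c)) ↔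
      ((∀ j, F₀.coeff j ∈ supported K (Set.range (Sum.inl : Fin n → Fin n ⊕ Fin m))) ∧
       (∀ j, G₀.coeff j ∈ supported K (Set.range (Sum.inr : Fin m → Fin n ⊕ Fin m))) ∧
       F₀.eval 1 ≠ G₀.eval 1)) ∧
    (((∀ j, F₀.coeff j ∈ supported K (Set.range (Sum.inl : Fin n → Fin n ⊕ Fin m))) ∧
      (∀ j, G₀.coeff j ∈ supported K (Set.range (Sum.inr : Fin m → Fin n ⊕ Fin m))) ∧
      F₀.eval 1 ≠ G₀.eval 1) →
      ∃ (f : MvPolynomial (Fin n) K) (g : MvPolynomial (Fin m) K),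
        rename Sum.inl f = F₀.eval 1 ∧ rename Sum.inr g = G₀.eval 1 ∧
        Algebra.adjoin K {(f, g)} =
          sepPair (rename Sum.inl) (rename Sum.inr) (Ideal.span {p})) := by
  have hmem : phi K n m p ∣ Polynomial.C (F₀.map (algebraMap (Rp K n m) (Lp K n m))) -
      (G₀.map (algebraMap (Rp K n m) (Lp K n m))).map Polynomial.C := by
    rw [← mem_sepBar, ← hgen]
    exact Algebra.subset_adjoin (Set.mem_singleton _)
  have hne : ¬ (F₀ = 0 ∧ G₀ = 0) := by
    rintro ⟨h1, h2⟩
    apply hbar_nontrivial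
    intro FG hFG
    rw [← hgen, h1, h2, Polynomial.map_zero] at hFG
    exact trivial_of_zero FG hFG
  obtain ⟨hF, hG, hdvd⟩ := setup_facts hpX hpY hne hF₀0 hG₀0 hmem
  have hdF := natDegree_ne_zero_of_coeff hF hF₀0
  have hdG := natDegree_ne_zero_of_coeff hG hG₀0
  have hinj : Function.Injective (algebraMap (Rp K n m) (Lp K n m)) :=
    IsFractionRing.injective _ _
  have hdF' : (F₀.map (algebraMap (Rp K n m) (Lp K n m))).natDegree ≠ 0 := by
    rwa [Polynomial.natDegree_map_eq_of_injective hinj]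
  have hdG' : (G₀.map (algebraMap (Rp K n m) (Lp K n m))).natDegree ≠ 0 := by
    rwa [Polynomial.natDegree_map_eq_of_injective hinj]
  have hgenerate : ((∀ j, F₀.coeff j ∈ supported K (Set.range (Sum.inl : Fin n → Fin n ⊕ Fin m))) ∧
      (∀ j, G₀.coeff j ∈ supported K (Set.range (Sum.inr : Fin m → Fin n ⊕ Fin m))) ∧
      F₀.eval 1 ≠ G₀.eval 1) →
      ∃ (f : MvPolynomial (Fin n) K) (g : MvPolynomial (Fin m) K),
        rename Sum.inl f = F₀.eval 1 ∧ rename Sum.inr g = G₀.eval 1 ∧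
        Algebra.adjoin K {(f, g)} =
          sepPair (rename Sum.inl) (rename Sum.inr) (Ideal.span {p}) := by
    rintro ⟨hFX, hGY, hne1⟩
    obtain ⟨f, hf⟩ := exists_rename_of_supported Sum.inl_injective (eval_mem_supported hFX)
    obtain ⟨g, hg⟩ := exists_rename_of_supported Sum.inr_injective (eval_mem_supported hGY)
    refine ⟨f, g, hf, hg, le_antisymm ?_ ?_⟩
    · refine Algebra.adjoin_le (Set.singleton_subset_iff.2 ?_)
      refine mem_sepPair.2 ?_
      have h1 := dvd_eval_one hdvd
      rwa [Phi0_11, ← hf, ← hg] at h1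
    · rintro ⟨f', g'⟩ hfg
      obtain ⟨u, hu1, hu2⟩ := exists_outer hgen (mem_sepPair.1 hfg)
      have hus := descent_outer (kf K (Set.range (Sum.inl : Fin n → Fin n ⊕ Fin m)))
        (map_mem_kf.2 hFX) hdF' (hu1 ▸ map_mem_kf.2 (phi1_coeff K n m f'))
      have hut := descent_outer (kf K (Set.range (Sum.inr : Fin m → Fin n ⊕ Fin m)))
        (map_mem_kf.2 hGY) hdG' (hu2 ▸ map_mem_kf.2 (phi2_coeff K n m g'))
      obtain ⟨v, hv⟩ := lift_to_base (disj_ranges n m) hus hut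
      have e1 := eval_comp_map hu1
      have e2 := eval_comp_map hu2
      rw [phi1_eval, ← hf, ← hv] at e1
      rw [phi2_eval, ← hg, ← hv] at e2
      rw [Algebra.adjoin_singleton_eq_range_aeval]
      refine ⟨v, ?_⟩
      have e3 := aeval_prod v f g
      rw [aeval_of_eval Sum.inl_injective e1, aeval_of_eval Sum.inr_injective e2] at e3
      exact e3
  refine ⟨⟨?_, ?_⟩, hgenerate⟩
  · intro hnt
    push Not at hnt
    obtain ⟨⟨f, g⟩, hfg, hnc⟩ := hnt
    have hrn : (rename Sum.inl f : Rp K n m) ≠ rename Sum.inr g := by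
      intro h
      obtain ⟨c, hc⟩ := const_of_rename_eq h
      exact hnc c hc
    obtain ⟨u, hu1, hu2⟩ := exists_outer hgen (mem_sepPair.1 hfg)
    have e1 := eval_comp_map hu1
    have e2 := eval_comp_map hu2
    rw [phi1_eval] at e1
    rw [phi2_eval] at e2
    have hud : u.natDegree ≠ 0 := by
      intro h
      apply hrn
      apply hinj
      rw [← e1, ← e2, Polynomial.eq_C_of_natDegree_eq_zero h, Polynomial.eval_C,
        Polynomial.eval_C]
    obtain ⟨h1, h2⟩ := core_forward (disj_ranges n m) hud hF₀0 hG₀0 hdF hdG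
      (phi1_coeff K n m f) (phi2_coeff K n m g) hu1 hu2
      (fun c hc => hnofac c (dvd_of_common hc))
    refine ⟨h1, h2, fun h => hrn (hinj ?_)⟩
    rw [← e1, ← e2, h]
  · intro h htriv
    obtain ⟨f, g, hf, hg, hadj⟩ := hgenerate h
    have hfg : (f, g) ∈ sepPair (rename Sum.inl) (rename Sum.inr) (Ideal.span {p}) := by
      rw [← hadj]
      exact Algebra.subset_adjoin (Set.mem_singleton _)
    obtain ⟨c, hc⟩ := htriv _ hfg
    apply h.2.2
    have c1 : f = MvPolynomial.C c := congrArg Prod.fst hc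
    have c2 : g = MvPolynomial.C c := congrArg Prod.snd hc
    rw [← hf, ← hg, c1, c2, rename_C, rename_C]
end

section
/- For every p ∈ K[X,Y] with p ∉ K[X] ∪ K[Y], the algebra A(⟨p⟩) is simple, i.e., it is generated by a single element as a K-algebra: there exists (f,g) ∈ A(⟨p⟩) such that A(⟨p⟩) equals the K-subalgebra of K[X] × K[Y] generated by (f,g). -/
section
open Polynomial IntermediateField WithZero

theorem val_aeval {K L Γ : Type} [Field K] [Field L] [Algebra K L]
    [LinearOrderedCommGroupWithZero Γ] (w : Valuation L Γ)
    (hw : ∀ c : K, c ≠ 0 → w (algebraMap K L c) = 1) (h : L) (hh : 1 < w h) (N : ℕ) :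
    ∀ r : K[X], r ≠ 0 → r.natDegree = N → w (aeval h r) = w h ^ N := by
  induction N with
  | zero =>
    intro r hr hN
    rw [Polynomial.eq_C_of_natDegree_eq_zero hN] at hr ⊢
    simp only [aeval_C, pow_zero]
    exact hw _ (by simpa using hr)
  | succ N ih =>
    intro r hr hN
    have hd : r.divX.natDegree = N := by rw [natDegree_divX_eq_natDegree_tsub_one, hN]; rfl
    have hd0 : r.divX ≠ 0 := by
      intro h0
      have := divX_eq_zero_iff.mp h0
      rw [this, natDegree_C] at hN
      omega
    have h1 := ih _ hd0 hd
    rw [← divX_mul_X_add r]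
    simp only [map_add, map_mul, aeval_X, aeval_C]
    have h2 : w (aeval h r.divX * h) = w h ^ (N+1) := by rw [map_mul, h1, pow_succ]
    have h3 : 1 < w h ^ (N+1) := one_lt_pow₀ hh (by omega)
    have h4 : w (algebraMap K L (r.coeff 0)) ≤ 1 := by
      by_cases hc : r.coeff 0 = 0
      · simp [hc]
      · exact (hw _ hc).le
    rw [Valuation.map_add_eq_of_lt_left, h2]
    rw [h2]; exact h4.trans_lt h3

open Classical in
theorem infty_poly {K : Type} [Field K] {q : K[X]} (hq : q ≠ 0) :
    RatFunc.inftyValuation K (algebraMap K[X] (RatFunc K) q) = exp (q.natDegree : ℤ) := by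
  rw [RatFunc.inftyValuation_apply, RatFunc.inftyValuation.polynomial _ hq]

open Classical in
theorem exists_infty {K : Type} [Field K] (g : RatFunc K) (hg : ¬ ∃ c, g = RatFunc.C c) :
    ∃ h : RatFunc K, K⟮h⟯ = K⟮g⟯ ∧ 1 < RatFunc.inftyValuation K h := by
  by_cases h1 : 1 < RatFunc.inftyValuation K g
  · exact ⟨g, rfl, h1⟩
  push Not at h1
  obtain ⟨c, hc⟩ : ∃ c : K, RatFunc.inftyValuation K (g - algebraMap K _ c) < 1 := by
    rcases h1.lt_or_eq with h | h
    · exact ⟨0, by simpa using h⟩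
    · have hg0 : g ≠ 0 := by rintro rfl; simp at h
      have hn : g.num ≠ 0 := RatFunc.num_ne_zero hg0
      have hd : g.denom ≠ 0 := RatFunc.denom_ne_zero g
      have hdeg : g.num.natDegree = g.denom.natDegree := by
        rw [RatFunc.inftyValuation_apply, RatFunc.inftyValuation_of_nonzero _ hg0, RatFunc.intDegree] at h
        rw [exp_eq_one] at h
        omega
      refine ⟨g.num.leadingCoeff / g.denom.leadingCoeff, ?_⟩
      set c := g.num.leadingCoeff / g.denom.leadingCoeff with hc
      have hc0 : c ≠ 0 := div_ne_zero (by simpa using hn) (by simpa using hd)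
      have e : g - algebraMap K _ c = algebraMap K[X] (RatFunc K) (g.num - C c * g.denom) /
          algebraMap K[X] (RatFunc K) g.denom := by
        have hd' : algebraMap K[X] (RatFunc K) g.denom ≠ 0 := RatFunc.algebraMap_ne_zero hd
        rw [map_sub, map_mul, sub_div, mul_div_cancel_right₀ _ hd', RatFunc.num_div_denom,
          RatFunc.algebraMap_C]
        rfl
      by_cases hz : g.num - C c * g.denom = 0
      · rw [e, hz]; simp
      rw [e, map_div₀, infty_poly hz, infty_poly hd]
      have hlt : (g.num - C c * g.denom).degree < g.num.degree := by
        apply degree_sub_lt_left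
        · rw [degree_C_mul hc0, degree_eq_natDegree hn, degree_eq_natDegree hd, hdeg]
        · exact hn
        · rw [leadingCoeff_mul, leadingCoeff_C, hc, div_mul_cancel₀ _ (by simpa using hd)]
      have := natDegree_lt_natDegree hz hlt
      rw [div_lt_one₀ (by simp), exp_lt_exp]
      omega
  have hne : g - algebraMap K _ c ≠ 0 := fun h0 => hg ⟨c, by
    rw [sub_eq_zero] at h0; exact h0⟩
  refine ⟨(g - algebraMap K _ c)⁻¹, ?_, ?_⟩
  · apply le_antisymm
    · rw [adjoin_simple_le_iff]
      exact inv_mem (sub_mem (mem_adjoin_simple_self K g) (IntermediateField.algebraMap_mem _ c))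
    · rw [adjoin_simple_le_iff]
      have := add_mem (inv_mem (mem_adjoin_simple_self K (g - algebraMap K _ c)⁻¹))
        (IntermediateField.algebraMap_mem _ c)
      rwa [inv_inv, sub_add_cancel] at this
  · rw [map_inv₀]
    exact (one_lt_inv₀ (zero_lt_iff.mpr ((Valuation.ne_zero_iff _).mpr hne))).mpr hc

open Classical in
theorem luroth_poly {K : Type} [Field K] (E : IntermediateField K (RatFunc K)) (b0 : K[X])
    (hb0 : b0.natDegree ≠ 0) (hb0E : algebraMap K[X] (RatFunc K) b0 ∈ E) :
    ∃ h : K[X], algebraMap K[X] (RatFunc K) h ∈ E ∧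
      ∀ b : K[X], algebraMap K[X] (RatFunc K) b ∈ E → ∃ r : K[X], b = r.comp h := by
  have hE : E ≠ ⊥ := by
    rintro rfl
    rw [IntermediateField.mem_bot] at hb0E
    obtain ⟨c, hc⟩ := hb0E
    apply hb0
    have : b0 = C c := RatFunc.algebraMap_injective K (by rw [← hc, RatFunc.algebraMap_C]; rfl)
    rw [this, natDegree_C]
  obtain ⟨h, hh, hinf⟩ := exists_infty _ (RatFunc.Luroth.generator_ne_C hE)
  rw [← RatFunc.Luroth.eq_adjoin_generator] at hh
  have hb0' : b0 ≠ 0 := by rintro rfl; simp at hb0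
  have key : h ∈ (algebraMap K[X] (RatFunc K)).range := by
    apply IsDedekindDomain.HeightOneSpectrum.mem_integers_of_valuation_le_one
    intro v
    by_contra hv
    push Not at hv
    rw [← hh, mem_adjoin_simple_iff] at hb0E
    obtain ⟨r, s, hrs⟩ := hb0E
    have hne : algebraMap K[X] (RatFunc K) b0 ≠ 0 := RatFunc.algebraMap_ne_zero hb0'
    have hr : r ≠ 0 := by rintro rfl; simp at hrs; exact hb0' hrs
    have hs : s ≠ 0 := by rintro rfl; simp at hrs; exact hb0' hrs
    have A1 := val_aeval (K := K) (RatFunc.inftyValuation K)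
      (fun c hc => by
        rw [RatFunc.inftyValuation_apply]; exact RatFunc.inftyValuation.C K hc) h hinf
    have hvK : ∀ c : K, c ≠ 0 → v.valuation (RatFunc K) (algebraMap K (RatFunc K) c) = 1 := by
      intro c hc
      have : algebraMap K (RatFunc K) c = algebraMap K[X] (RatFunc K) (C c) := by
        rw [RatFunc.algebraMap_C]; rfl
      rw [this, IsDedekindDomain.HeightOneSpectrum.valuation_eq_one_iff_notMem]
      intro hmem
      exact v.isPrime.ne_top (Ideal.eq_top_of_isUnit_mem _ hmem (isUnit_C.mpr hc.isUnit))
    have A2 := val_aeval (K := K) (v.valuation (RatFunc K)) hvK h hv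
    have B1 := congrArg (RatFunc.inftyValuation K) hrs
    have B2 := congrArg (v.valuation (RatFunc K)) hrs
    rw [map_div₀, A1 _ r hr rfl, A1 _ s hs rfl, infty_poly hb0'] at B1
    rw [map_div₀, A2 _ r hr rfl, A2 _ s hs rfl] at B2
    have C2 : r.natDegree ≤ s.natDegree := by
      have := v.valuation_le_one (K := RatFunc K) b0
      rw [B2, div_le_one₀ (pow_pos (zero_lt_one.trans hv) _)] at this
      exact (pow_le_pow_iff_right₀ hv).mp this
    have C1 : ¬ r.natDegree ≤ s.natDegree := by
      intro hle
      have h1 : (1 : ℤᵐ⁰) < exp (b0.natDegree : ℤ) := by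
        rw [← exp_zero, exp_lt_exp]; omega
      rw [B1, one_lt_div₀ (pow_pos (zero_lt_one.trans hinf) _)] at h1
      exact absurd ((pow_le_pow_iff_right₀ hinf).mpr hle) (not_le.mpr h1)
    exact C1 C2
  obtain ⟨h', rfl⟩ := key
  have hae : ∀ r : K[X], aeval (algebraMap K[X] (RatFunc K) h') r =
      algebraMap K[X] (RatFunc K) (r.comp h') := by
    intro r
    rw [aeval_algebraMap_apply]; rfl
  refine ⟨h', hh ▸ mem_adjoin_simple_self K _, fun b hb => ?_⟩
  have hdeg : h'.natDegree ≠ 0 := by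
    intro h0
    have hz : h' ≠ 0 := by rintro rfl; simp at hinf
    rw [infty_poly hz, h0] at hinf
    simp at hinf
  rw [← hh, mem_adjoin_simple_iff] at hb
  obtain ⟨r, s, hrs⟩ := hb
  by_cases hs : s = 0
  · subst hs
    refine ⟨0, ?_⟩
    simpa using hrs
  obtain ⟨d, r', s', hcop, rfl, rfl⟩ : ∃ d r' s' : K[X], IsCoprime r' s' ∧ r = d * r' ∧ s = d * s' := by
    obtain ⟨r', hr'⟩ := EuclideanDomain.gcd_dvd_left r s
    obtain ⟨s', hs'⟩ := EuclideanDomain.gcd_dvd_right r s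
    refine ⟨EuclideanDomain.gcd r s, r', s', ?_, hr', hs'⟩
    have hg : EuclideanDomain.gcd r s ≠ 0 := by
      intro h0; rw [h0, zero_mul] at hs'; exact hs hs'
    have e := EuclideanDomain.gcd_eq_gcd_ab r s
    refine ⟨EuclideanDomain.gcdA r s, EuclideanDomain.gcdB r s, ?_⟩
    apply mul_left_cancel₀ hg
    calc _ = (EuclideanDomain.gcd r s * r') * EuclideanDomain.gcdA r s
            + (EuclideanDomain.gcd r s * s') * EuclideanDomain.gcdB r s := by ring
      _ = _ := by rw [← hr', ← hs', ← e, mul_one]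
  have hds : (d * s').comp h' ≠ 0 := by
    intro h0
    rw [comp_eq_zero_iff] at h0
    rcases h0 with h0 | ⟨_, h0⟩
    · exact hs h0
    · exact hdeg (by rw [h0, natDegree_C])
  rw [hae, hae, eq_div_iff (RatFunc.algebraMap_ne_zero hds), ← map_mul] at hrs
  have hrs := RatFunc.algebraMap_injective K hrs
  rw [mul_comp] at hds
  rw [mul_comp, mul_comp] at hrs
  have h5 : b * s'.comp h' = r'.comp h' := by
    apply mul_left_cancel₀ (left_ne_zero_of_mul hds)
    rw [← hrs]; ring
  obtain ⟨u, v, huv⟩ := hcop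
  have h6 := congrArg (fun z => z.comp h') huv
  simp only [add_comp, mul_comp, one_comp] at h6
  have h7 : IsUnit (s'.comp h') := by
    apply IsUnit.of_mul_eq_one (u.comp h' * b + v.comp h')
    rw [← h6, ← h5]; ring
  have h8 := natDegree_eq_zero_of_isUnit h7
  rw [natDegree_comp] at h8
  have h9 : s'.natDegree = 0 := by
    rcases Nat.mul_eq_zero.mp h8 with h | h
    · exact h
    · exact absurd h hdeg
  rw [eq_C_of_natDegree_eq_zero h9, C_comp] at h5 h7
  have h10 : s'.coeff 0 ≠ 0 := by
    intro h0; rw [h0] at h7; simp at h7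
  refine ⟨C (s'.coeff 0)⁻¹ * r', ?_⟩
  rw [mul_comp, ← h5, C_comp, mul_comm b, ← mul_assoc, ← C_mul, inv_mul_cancel₀ h10]; simp

end

section
open Polynomial
theorem dvd_of_homog {K P : Type} [Field K] [CommRing P] [IsDomain P] [IsIntegrallyClosed P]
    [Algebra K P] (r : K[X]) (hr : r.natDegree ≠ 0) (f f1 f2 : P) (hf2 : f2 ≠ 0)
    (h : ∑ i ∈ Finset.range (r.natDegree + 1), r.coeff i • (f1 ^ i * f2 ^ (r.natDegree - i))
      = f * f2 ^ r.natDegree) : f2 ∣ f1 := by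
  let F := FractionRing P
  have h0 : algebraMap P F f2 ≠ 0 := by simpa using hf2
  have key : aeval (algebraMap P F f1 / algebraMap P F f2) r = algebraMap P F f := by
    have := congrArg (algebraMap P F) h
    simp only [map_sum, Algebra.smul_def, map_mul, map_pow] at this
    rw [aeval_eq_sum_range]
    apply mul_right_cancel₀ (pow_ne_zero r.natDegree h0)
    rw [← this, Finset.sum_mul]
    refine Finset.sum_congr rfl fun i hi => ?_
    have hi' : i ≤ r.natDegree := by simpa [Nat.lt_succ_iff] using hi
    rw [Algebra.smul_def, IsScalarTower.algebraMap_apply K P F, div_pow]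
    conv_lhs => rw [← Nat.sub_add_cancel hi', pow_add]
    rw [mul_assoc, mul_comm (_ ^ (_ - _)), ← mul_assoc (_ / _),
      div_mul_cancel₀ _ (pow_ne_zero i h0)]
  have hr0 : r ≠ 0 := by rintro rfl; simp at hr
  have hl : r.leadingCoeff ≠ 0 := by simpa using hr0
  have hintg : IsIntegral P (algebraMap P F f1 / algebraMap P F f2) := by
    let s : K[X] := C (r.leadingCoeff)⁻¹ * r
    have hs : s.Monic := by
      change (C (r.leadingCoeff)⁻¹ * r).Monic
      rw [mul_comm]; exact monic_mul_leadingCoeff_inv hr0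
    have hsd : s.natDegree = r.natDegree := natDegree_C_mul (inv_ne_zero hl)
    refine ⟨s.map (algebraMap K P) - C (algebraMap K P r.leadingCoeff⁻¹ * f), ?_, ?_⟩
    · apply (hs.map _).sub_of_left
      refine degree_C_le.trans_lt ?_
      rw [hs.degree_map, degree_eq_natDegree hs.ne_zero, hsd]
      exact_mod_cast Nat.pos_of_ne_zero hr
    · rw [eval₂_sub, eval₂_C, eval₂_map, ← IsScalarTower.algebraMap_eq, ← aeval_def,
        map_mul, aeval_C, key, map_mul, ← IsScalarTower.algebraMap_apply, sub_self]
  obtain ⟨z, hz⟩ := IsIntegrallyClosed.isIntegral_iff.mp hintg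
  refine ⟨z, ?_⟩
  apply IsFractionRing.injective P F
  rw [map_mul, hz, mul_div_cancel₀ _ h0]

theorem simple_of_spec {K P Q : Type} [Field K] [CommRing P] [IsDomain P] [IsIntegrallyClosed P]
    [CommRing Q] [IsDomain Q] [IsIntegrallyClosed Q] [Algebra K P] [Algebra K Q]
    (A : Subalgebra K (P × Q)) (φ : P →ₐ[K] K[X])
    (hφ : ∀ a ∈ A, φ a.1 = 0 → a = 0)
    (h2 : ∀ a ∈ A, a.2 = 0 → a = 0)
    (hcl : ∀ c ∈ A, c ≠ 0 → ∀ z, c * z ∈ A → z ∈ A)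
    (a : P × Q) (haA : a ∈ A) (ha : (φ a.1).natDegree ≠ 0) :
    ∃ z ∈ A, Algebra.adjoin K {z} = A := by
  let ψ : (P × Q) →ₐ[K] K[X] := φ.comp (AlgHom.fst K P Q)
  let ι : K[X] →ₐ[K] RatFunc K := IsScalarTower.toAlgHom K K[X] (RatFunc K)
  have hι : ∀ x, ι x = algebraMap K[X] (RatFunc K) x := fun _ => rfl
  let B : Subalgebra K (RatFunc K) := A.map (ι.comp ψ)
  have hB : ∀ x, x ∈ IntermediateField.adjoin K (B : Set (RatFunc K)) ↔
      ∃ u ∈ A, ∃ v ∈ A, x = ι (ψ u) / ι (ψ v) := by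
    intro x
    rw [IntermediateField.mem_adjoin_iff_div, Algebra.adjoin_eq]
    constructor
    · rintro ⟨_, ⟨u, hu, rfl⟩, _, ⟨v, hv, rfl⟩, rfl⟩
      exact ⟨u, hu, v, hv, rfl⟩
    · rintro ⟨u, hu, v, hv, rfl⟩
      exact ⟨_, ⟨u, hu, rfl⟩, _, ⟨v, hv, rfl⟩, rfl⟩
  have hBA : ∀ b ∈ A, algebraMap K[X] (RatFunc K) (ψ b) ∈
      IntermediateField.adjoin K (B : Set (RatFunc K)) := by
    intro b hb
    exact IntermediateField.subset_adjoin _ _ ⟨b, hb, rfl⟩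
  obtain ⟨h, hhE, hh⟩ := luroth_poly (IntermediateField.adjoin K (B : Set (RatFunc K)))
    (φ a.1) ha (hBA a haA)
  have hinj : ∀ u ∈ A, ∀ v ∈ A, ψ u = ψ v → u = v := by
    intro u hu v hv huv
    rw [← sub_eq_zero]
    apply hφ _ (A.sub_mem hu hv)
    have : ψ (u - v) = 0 := by rw [map_sub, huv, sub_self]
    exact this
  obtain ⟨r, hr⟩ := hh _ (hBA a haA)
  have hrdeg : r.natDegree ≠ 0 := by
    intro h0
    apply ha
    change (ψ a).natDegree = 0
    rw [hr, natDegree_comp, h0, zero_mul]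
  obtain ⟨u, hu, v, hv, huv⟩ := (hB _).mp hhE
  have hh0 : h ≠ 0 := by
    rintro rfl
    apply ha
    change (ψ a).natDegree = 0
    rw [hr]; simp
  have hψv : ψ v ≠ 0 := by
    intro h0
    rw [h0, map_zero, div_zero] at huv
    exact hh0 (by simpa using huv)
  have hv0 : v ≠ 0 := by rintro rfl; simp at hψv
  have huv' : h * ψ v = ψ u := by
    apply RatFunc.algebraMap_injective K
    rw [map_mul, huv, ← hι (ψ v), div_mul_cancel₀]
    · rfl
    · rw [hι]; exact RatFunc.algebraMap_ne_zero hψv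
  have main : ∑ i ∈ Finset.range (r.natDegree + 1), r.coeff i • (u ^ i * v ^ (r.natDegree - i))
      = a * v ^ r.natDegree := by
    apply hinj
    · exact A.sum_mem fun i _ => A.smul_mem (A.mul_mem (A.pow_mem hu _) (A.pow_mem hv _)) _
    · exact A.mul_mem haA (A.pow_mem hv _)
    · rw [map_mul, map_pow, hr, map_sum, comp, eval₂_eq_sum_range, Finset.sum_mul]
      refine Finset.sum_congr rfl fun i hi => ?_
      have hi' : i ≤ r.natDegree := by simpa [Nat.lt_succ_iff] using hi
      rw [map_smul, map_mul, map_pow, map_pow, ← huv', smul_eq_C_mul]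
      conv_rhs => rw [← Nat.sub_add_cancel hi', pow_add]
      rw [mul_pow]
      ring
  have hv1 : v.1 ≠ 0 := by
    intro h0
    apply hψv
    change φ v.1 = 0
    rw [h0, map_zero]
  have hv2 : v.2 ≠ 0 := fun h0 => hv0 (h2 v hv h0)
  obtain ⟨z1, hz1⟩ : v.1 ∣ u.1 := by
    apply dvd_of_homog r hrdeg a.1 _ _ hv1
    simpa [Prod.fst_sum] using congrArg Prod.fst main
  obtain ⟨z2, hz2⟩ : v.2 ∣ u.2 := by
    apply dvd_of_homog r hrdeg a.2 _ _ hv2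
    simpa [Prod.snd_sum] using congrArg Prod.snd main
  have hvz : v * (z1, z2) = u := by
    ext
    · exact hz1.symm
    · exact hz2.symm
  have hz : (z1, z2) ∈ A := hcl v hv hv0 _ (by rw [hvz]; exact hu)
  refine ⟨_, hz, ?_⟩
  have hψz : ψ (z1, z2) = h := by
    apply mul_right_cancel₀ hψv
    rw [huv', mul_comm, ← map_mul, hvz]
  have hle : Algebra.adjoin K {(z1, z2)} ≤ A := Algebra.adjoin_le (by simpa using hz)
  apply le_antisymm hle
  intro b hb
  obtain ⟨s, hs⟩ := hh _ (hBA b hb)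
  have hm := aeval_mem_adjoin_singleton K (z1, z2) (p := s)
  have : b = aeval (z1, z2) s := by
    apply hinj _ hb _ (hle hm)
    rw [hs, ← aeval_algHom_apply, hψz]; rfl
  rw [this]; exact hm

theorem exists_line {K : Type} [Field K] [CharZero K] {n : ℕ} (f : MvPolynomial (Fin n) K)
    (hf : ∀ c, f ≠ MvPolynomial.C c) :
    ∃ φ : MvPolynomial (Fin n) K →ₐ[K] K[X], (φ f).natDegree ≠ 0 := by
  obtain ⟨x, hx⟩ : ∃ x, MvPolynomial.eval x f ≠ MvPolynomial.eval 0 f := by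
    by_contra! h
    exact hf (MvPolynomial.eval 0 f) (MvPolynomial.funext fun x => by simp [h x])
  refine ⟨MvPolynomial.aeval fun i => C (x i) * X, fun h0 => hx ?_⟩
  have key : ∀ t : K, eval t (MvPolynomial.aeval (fun i => C (x i) * X) f) =
      MvPolynomial.eval (fun i => x i * t) f := by
    intro t
    have : (aeval t : K[X] →ₐ[K] K).comp (MvPolynomial.aeval fun i => C (x i) * X) =
        MvPolynomial.aeval (fun i => x i * t) := by
      ext i; simp
    have h2 := DFunLike.congr_fun this f
    rw [MvPolynomial.aeval_eq_eval] at h2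
    simpa [coe_aeval_eq_eval] using h2
  have e1 := key 1
  have e0 := key 0
  rw [eq_C_of_natDegree_eq_zero h0, eval_C] at e1 e0
  simp only [mul_one, mul_zero] at e1 e0
  exact e1.symm.trans e0

theorem spec_inj {K P : Type} [Field K] [CommRing P] [IsDomain P] [Algebra K P]
    (φ : P →ₐ[K] K[X]) (a b : P) (ha : (φ a).natDegree ≠ 0) (hb : φ b = 0)
    (hdep : IsAlgebraic (Algebra.adjoin K {a}) b) : b = 0 := by
  by_contra hb0
  obtain ⟨q, hq0, hq⟩ := hdep.exists_nonzero_coeff_and_aeval_eq_zero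
    (mem_nonZeroDivisors_of_ne_zero hb0)
  have h1 := q.divX_mul_X_add
  have h2 := congrArg (aeval b) h1
  rw [hq, map_add, map_mul, aeval_X, aeval_C] at h2
  have h3 := congrArg φ h2
  rw [map_add, map_mul, hb, mul_zero, zero_add, map_zero] at h3
  have hmem : ((q.coeff 0 : Algebra.adjoin K {a}) : P) ∈ (aeval (R := K) a).range :=
    Algebra.adjoin_singleton_eq_range_aeval K a ▸ (q.coeff 0).2
  obtain ⟨G, hG⟩ := hmem
  have h4 : φ ((q.coeff 0 : Algebra.adjoin K {a}) : P) = 0 := h3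
  have hG' : aeval a G = ((q.coeff 0 : Algebra.adjoin K {a}) : P) := hG
  rw [← hG', ← aeval_algHom_apply] at h4
  have h5 : G.comp (φ a) = 0 := h4
  rw [comp_eq_zero_iff] at h5
  rcases h5 with h5 | ⟨_, h5⟩
  · rw [h5, map_zero] at hG'
    exact hq0 (Subtype.ext hG'.symm)
  · exact ha (by rw [h5, natDegree_C])

end

open MvPolynomial in
theorem supp_of_dvd {K σ : Type} [Field K] {q F : MvPolynomial σ K} {s : Set σ} (hqF : q ∣ F)
    (hF : F ≠ 0) (hs : F ∈ supported K s) : q ∈ supported K s := by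
  rw [mem_supported] at hs ⊢
  obtain ⟨u, rfl⟩ := hqF
  intro i hi
  apply hs
  have hq := left_ne_zero_of_mul hF
  have hu := right_ne_zero_of_mul hF
  have hi' : i ∈ q.vars := hi
  show i ∈ (q * u).vars
  rw [mem_vars_iff_degreeOf_ne_zero] at hi' ⊢
  rw [degreeOf_mul_eq hq hu]
  omega

open MvPolynomial in
theorem rename_mem_supp {K σ ρ : Type} [Field K] (i : σ → ρ) (f : MvPolynomial σ K) :
    rename i f ∈ supported K (Set.range i) := by
  classical
  rw [mem_supported]
  intro x hx
  have := vars_rename i f hx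
  simp only [Finset.mem_image] at this
  obtain ⟨y, _, rfl⟩ := this
  exact ⟨y, rfl⟩

open MvPolynomial in
theorem supp_exists {K σ ρ : Type} [Field K] (i : σ → ρ) (q : MvPolynomial ρ K)
    (hq : q ∈ supported K (Set.range i)) : ∃ f, q = rename i f := by
  have : supported K (Set.range i) ≤ (rename (R := K) i).range := by
    rw [supported_eq_adjoin_X, Algebra.adjoin_le_iff]
    rintro _ ⟨_, ⟨x, rfl⟩, rfl⟩
    exact ⟨X x, by simp⟩
  obtain ⟨f, hf⟩ := this hq
  exact ⟨f, hf.symm⟩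

open MvPolynomial in
theorem no_factor {K σ τ ρ : Type} [Field K] (i : σ → ρ) (j : τ → ρ)
    (hj : Function.Injective j) (hij : Disjoint (Set.range i) (Set.range j))
    (q : MvPolynomial ρ K) (hq : Irreducible q) (f : MvPolynomial σ K) (g : MvPolynomial τ K)
    (hg : ∀ c, g ≠ C c) (hd : q ∣ rename i f - rename j g) :
    q ∉ supported K (Set.range i) := by
  classical
  intro hs
  obtain ⟨q', hq'⟩ := supp_exists i q hs
  let ev : MvPolynomial ρ K →ₐ[K] MvPolynomial ρ K :=
    aeval fun k => if k ∈ Set.range j then 0 else X k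
  have hi : ∀ F : MvPolynomial σ K, ev (rename i F) = rename i F := by
    intro F
    have : ev.comp (rename i) = rename i := by
      ext k
      have : i k ∉ Set.range j := fun h => Set.disjoint_left.mp hij ⟨k, rfl⟩ h
      simp only [ev, AlgHom.comp_apply, rename_X, aeval_X, if_neg this]
    exact DFunLike.congr_fun this F
  have hjg : ev (rename j g) = rename j (C (eval 0 g)) := by
    have : ev.comp (rename j) = (Algebra.ofId K _).comp (aeval (0 : τ → K)) := by
      ext k
      have : j k ∈ Set.range j := ⟨k, rfl⟩
      simp only [ev, AlgHom.comp_apply, rename_X, aeval_X, if_pos this]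
      simp
    have h := DFunLike.congr_fun this g
    rw [AlgHom.comp_apply, AlgHom.comp_apply] at h
    rw [h, rename_C]
    rfl
  have h1 : q ∣ rename i f - rename j (C (eval 0 g)) := by
    have := map_dvd ev hd
    rwa [hq', hi, map_sub, hi, hjg, ← hq'] at this
  have h2 : q ∣ rename j (g - C (eval 0 g)) := by
    rw [map_sub]
    have := dvd_sub h1 hd
    convert this using 1
    ring
  have h3 : rename j (g - C (eval 0 g)) ≠ 0 := by
    intro h0
    rw [← map_zero (rename (R := K) j)] at h0
    have := rename_injective j hj h0
    rw [sub_eq_zero] at this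
    exact hg _ this
  have h4 := supp_of_dvd h2 h3 (rename_mem_supp j _)
  rw [mem_supported] at hs h4
  have h5 : q.vars = ∅ := by
    rw [Finset.eq_empty_iff_forall_notMem]
    intro x hx
    exact Set.disjoint_left.mp hij (hs hx) (h4 hx)
  rw [vars_eq_empty_iff_eq_C] at h5
  apply hq.not_isUnit
  rw [h5]
  refine IsUnit.map C (IsUnit.mk0 _ ?_)
  intro h0
  rw [h0, C_0] at h5
  exact hq.ne_zero h5

open Polynomial in
theorem transc_of_nonconst {K : Type} [Field K] [CharZero K] {n : ℕ} (f : MvPolynomial (Fin n) K)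
    (hf : ∀ c, f ≠ MvPolynomial.C c) : Transcendental K f := by
  obtain ⟨φ, hφ⟩ := exists_line f hf
  rintro ⟨G, hG0, hG⟩
  have h4 := congrArg φ hG
  rw [← aeval_algHom_apply, map_zero] at h4
  have h5 : G.comp (φ f) = 0 := h4
  rw [comp_eq_zero_iff] at h5
  rcases h5 with h5 | ⟨_, h5⟩
  · exact hG0 h5
  · exact hφ (by rw [h5, natDegree_C])

open MvPolynomial in
theorem dep_of_irred {K : Type} [Field K] [CharZero K] {n m : ℕ}
    (q : MvPolynomial (Fin n ⊕ Fin m) K) (hq : Irreducible q)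
    (hqX : q ∉ supported K (Set.range (Sum.inl : Fin n → Fin n ⊕ Fin m)))
    (f1 f2 : MvPolynomial (Fin n) K) (g1 g2 : MvPolynomial (Fin m) K)
    (h1 : q ∣ rename Sum.inl f1 - rename Sum.inr g1)
    (h2 : q ∣ rename Sum.inl f2 - rename Sum.inr g2)
    (hf1 : ∀ c, f1 ≠ C c) : IsAlgebraic (Algebra.adjoin K {f1}) f2 := by
  classical
  by_contra hdep
  have hprime : (Ideal.span {q}).IsPrime := by
    rw [Ideal.span_singleton_prime hq.ne_zero]; exact hq.prime
  let D := MvPolynomial (Fin n ⊕ Fin m) K ⧸ Ideal.span {q}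
  let mk : MvPolynomial (Fin n ⊕ Fin m) K →ₐ[K] D := Ideal.Quotient.mkₐ K _
  have hmk : ∀ F, mk F = 0 ↔ q ∣ F := by
    intro F
    rw [← Ideal.mem_span_singleton]
    exact Ideal.Quotient.eq_zero_iff_mem
  let M := AlgebraicIndependent.matroid K D
  let x : Fin n ⊕ Fin m → D := fun k => mk (X k)
  let π : MvPolynomial (Fin n) K →ₐ[K] D := mk.comp (rename Sum.inl)
  let π' : MvPolynomial (Fin m) K →ₐ[K] D := mk.comp (rename Sum.inr)
  have hπ : Function.Injective π := by
    rw [injective_iff_map_eq_zero]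
    intro F hF
    by_contra hF0
    have hF' : rename (Sum.inl : Fin n → Fin n ⊕ Fin m) F ≠ 0 := by
      intro h0
      exact hF0 (rename_injective _ Sum.inl_injective (by rw [h0, map_zero]))
    exact hqX (supp_of_dvd ((hmk _).mp hF) hF' (rename_mem_supp _ _))
  have hind : AlgebraicIndepOn K id ({f2, f1} : Set (MvPolynomial (Fin n) K)) := by
    apply AlgebraicIndepOn.insert
    · rw [AlgebraicIndepOn]
      rw [algebraicIndependent_unique_type_iff]
      exact transc_of_nonconst f1 hf1
    · rw [Set.image_id]; exact hdep
  have hne : f2 ≠ f1 := by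
    rintro rfl
    exact hdep (isAlgebraic_algebraMap
      (⟨f2, Algebra.self_mem_adjoin_singleton K f2⟩ : Algebra.adjoin K {f2}))
  have hI := (AlgebraicIndependent.map' hind (f := π) hπ).to_subtype_range
  have hrange : Set.range (π ∘ fun i : ({f2, f1} : Set (MvPolynomial (Fin n) K)) => id i.1)
      = π '' {f2, f1} := by
    rw [Set.range_comp]
    congr 1
    exact Subtype.range_coe
  rw [hrange] at hI
  have hI2 : M.Indep (π '' {f2, f1}) := hI
  have hcard : (π '' {f2, f1}).encard = 2 := by
    rw [hπ.encard_image, Set.encard_pair hne]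
  let S := M.closure (Set.range fun k : Fin n => x (Sum.inl k))
  let T := M.closure (Set.range fun k : Fin m => x (Sum.inr k))
  have hcl : ∀ s : Set D, (Algebra.adjoin K s : Set D) ⊆ M.closure s := by
    intro s y hy
    rw [AlgebraicIndependent.matroid_closure_eq]
    exact isAlgebraic_algebraMap (⟨y, hy⟩ : Algebra.adjoin K s)
  have hS : ∀ F, π F ∈ S := by
    intro F
    apply hcl
    have e : π = aeval (fun k => x (Sum.inl k)) := by
      ext k; simp [π, x]
    rw [e, Algebra.adjoin_range_eq_range_aeval]
    exact ⟨F, rfl⟩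
  have hT : ∀ F, π' F ∈ T := by
    intro F
    apply hcl
    have e : π' = aeval (fun k => x (Sum.inr k)) := by
      ext k; simp [π', x]
    rw [e, Algebra.adjoin_range_eq_range_aeval]
    exact ⟨F, rfl⟩
  have e1 : π f1 = π' g1 := by
    rw [← sub_eq_zero]
    have := (hmk _).mpr h1
    rwa [map_sub] at this
  have e2 : π f2 = π' g2 := by
    rw [← sub_eq_zero]
    have := (hmk _).mpr h2
    rwa [map_sub] at this
  have hsub : π '' {f2, f1} ⊆ S ∩ T := by
    rintro _ ⟨F, rfl | rfl, rfl⟩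
    · exact ⟨hS _, e2 ▸ hT _⟩
    · exact ⟨hS _, e1 ▸ hT _⟩
  have r1 : 2 ≤ M.eRk (S ∩ T) := hcard ▸ hI2.encard_le_eRk_of_subset hsub
  have r2 : M.eRk S ≤ n := by
    rw [Matroid.eRk_closure_eq]
    refine (M.eRk_le_encard _).trans ?_
    rw [← Set.image_univ]
    refine (Set.encard_image_le _ _).trans ?_
    simp
  have r3 : M.eRk T ≤ m := by
    rw [Matroid.eRk_closure_eq]
    refine (M.eRk_le_encard _).trans ?_
    rw [← Set.image_univ]
    refine (Set.encard_image_le _ _).trans ?_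
    simp
  obtain ⟨z, hz⟩ : ∃ z, z ∈ q.vars := by
    by_contra! h
    apply hqX
    rw [mem_supported, Finset.eq_empty_of_forall_notMem h]
    simp
  have hx : AlgebraicIndependent K (fun k : {k // k ≠ z} => x k) := by
    rw [algebraicIndependent_iff]
    intro F hF
    by_contra hF0
    have hF' : rename (Subtype.val : {k // k ≠ z} → _) F ≠ 0 := by
      intro h0
      exact hF0 (rename_injective _ Subtype.val_injective (by rw [h0, map_zero]))
    have e : mk (rename (Subtype.val : {k // k ≠ z} → _) F) = 0 := by
      rw [← hF]
      have : mk.comp (rename Subtype.val) = aeval (fun k : {k // k ≠ z} => x k) := by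
        ext k; simp [x]
      exact DFunLike.congr_fun this F
    have h3 := supp_of_dvd ((hmk _).mp e) hF' (rename_mem_supp _ _)
    rw [mem_supported] at h3
    obtain ⟨w, hw⟩ := h3 hz
    exact w.2 hw
  have hJ : M.Indep (Set.range (fun k : {k // k ≠ z} => x k)) := hx.to_subtype_range
  have hJc : (Set.range (fun k : {k // k ≠ z} => x k)).encard + 1 = n + m := by
    rw [← Set.image_univ, hx.injective.encard_image, Set.encard_univ, ENat.card_eq_coe_fintype_card]
    have : Fintype.card {k // k ≠ z} + 1 = n + m := by
      have h5 := Fintype.card_subtype_compl (fun k => k = z)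
      have h6 : 0 < Fintype.card (Fin n ⊕ Fin m) := Fintype.card_pos_iff.mpr ⟨z⟩
      simp only [Fintype.card_subtype_eq, Fintype.card_sum, Fintype.card_fin] at h5 h6
      have h7 : Fintype.card {k // k ≠ z} = n + m - 1 := by rw [← h5]
      omega
    exact_mod_cast this
  have r4 : (Set.range (fun k : {k // k ≠ z} => x k)).encard ≤ M.eRk (S ∪ T) := by
    apply hJ.encard_le_eRk_of_subset
    rintro _ ⟨⟨k | k, hk⟩, rfl⟩
    · left
      have := hS (X k)
      simpa [π, x] using this
    · right
      have := hT (X k)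
      simpa [π', x] using this
  have r5 := M.eRk_inter_add_eRk_union_le S T
  have r6 : (2 : ℕ∞) + (Set.range (fun k : {k // k ≠ z} => x k)).encard ≤ n + m :=
    (add_le_add r1 r4).trans (r5.trans (add_le_add r2 r3))
  rw [← hJc, add_comm] at r6
  have hfin : (Set.range (fun k : {k // k ≠ z} => x k)).encard ≠ ⊤ :=
    (Set.finite_range _).encard_lt_top.ne
  have := (ENat.add_le_add_iff_left hfin).mp r6
  exact absurd this (by norm_num)

open MvPolynomial

/-- Corollary ("Corollary `cor:simpleness`"): for every `p ∈ K[X,Y] \ (K[X] ∪ K[Y])`, the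
algebra `A(⟨p⟩)` is simple, i.e. generated by a single element as a `K`-algebra. -/
theorem sepPair_principal_is_simple (K : Type) [Field K] [CharZero K] (n m : ℕ)
    (p : MvPolynomial (Fin n ⊕ Fin m) K)
    (hpX : p ∉ supported K (Set.range (Sum.inl : Fin n → Fin n ⊕ Fin m)))
    (hpY : p ∉ supported K (Set.range (Sum.inr : Fin m → Fin n ⊕ Fin m))) :
    ∃ fg : MvPolynomial (Fin n) K × MvPolynomial (Fin m) K,
      fg ∈ sepPair (rename Sum.inl) (rename Sum.inr) (Ideal.span {p}) ∧
      Algebra.adjoin K {fg} = sepPair (rename Sum.inl) (rename Sum.inr) (Ideal.span {p}) := by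
  set A : Subalgebra K (MvPolynomial (Fin n) K × MvPolynomial (Fin m) K) :=
    sepPair (rename Sum.inl) (rename Sum.inr) (Ideal.span {p}) with hA
  have hmem : ∀ a, a ∈ A ↔ p ∣ rename Sum.inl a.1 - rename Sum.inr a.2 := by
    intro a
    rw [← Ideal.mem_span_singleton]
    exact Iff.rfl
  have hdisj : Disjoint (Set.range (Sum.inl : Fin n → Fin n ⊕ Fin m))
      (Set.range (Sum.inr : Fin m → Fin n ⊕ Fin m)) := by
    rw [Set.disjoint_left]
    rintro _ ⟨i, rfl⟩ ⟨j, hj⟩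
    exact absurd hj (by simp)
  have hinl0 : ∀ f : MvPolynomial (Fin n) K, f ≠ 0 →
      rename (Sum.inl : Fin n → Fin n ⊕ Fin m) f ≠ 0 := by
    intro f hf h0
    exact hf (rename_injective _ Sum.inl_injective (by rw [h0, map_zero]))
  have hinr0 : ∀ f : MvPolynomial (Fin m) K, f ≠ 0 →
      rename (Sum.inr : Fin m → Fin n ⊕ Fin m) f ≠ 0 := by
    intro f hf h0
    exact hf (rename_injective _ Sum.inr_injective (by rw [h0, map_zero]))
  have h1 : ∀ a ∈ A, a.1 = 0 → a = 0 := by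
    intro a ha h
    refine Prod.ext h ?_
    by_contra h2
    rw [hmem, h, map_zero, zero_sub, dvd_neg] at ha
    exact hpY (supp_of_dvd ha (hinr0 _ h2) (rename_mem_supp _ _))
  have h2 : ∀ a ∈ A, a.2 = 0 → a = 0 := by
    intro a ha h
    refine Prod.ext ?_ h
    by_contra h2
    rw [hmem, h, map_zero, sub_zero] at ha
    exact hpX (supp_of_dvd ha (hinl0 _ h2) (rename_mem_supp _ _))
  by_cases hbot : A ≤ ⊥
  · refine ⟨0, A.zero_mem, ?_⟩
    rw [le_bot_iff.mp hbot, Algebra.adjoin_singleton_zero]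
  obtain ⟨a, haA, hab⟩ := Set.not_subset.mp hbot
  have haA : a ∈ A := haA
  have hcon1 : ∀ c, a.1 ≠ C c := by
    intro c hc
    apply hab
    have := h1 (a - algebraMap K _ c) (A.sub_mem haA (A.algebraMap_mem c))
      (by rw [Prod.fst_sub, hc]; exact sub_self _)
    rw [sub_eq_zero] at this
    rw [this]
    exact (⊥ : Subalgebra K _).algebraMap_mem c
  have hcon2 : ∀ c, a.2 ≠ C c := by
    intro c hc
    apply hab
    have := h2 (a - algebraMap K _ c) (A.sub_mem haA (A.algebraMap_mem c))
      (by rw [Prod.snd_sub, hc]; exact sub_self _)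
    rw [sub_eq_zero] at this
    rw [this]
    exact (⊥ : Subalgebra K _).algebraMap_mem c
  have hap := (hmem a).mp haA
  have hqX : ∀ q, Irreducible q → q ∣ p →
      q ∉ supported K (Set.range (Sum.inl : Fin n → Fin n ⊕ Fin m)) := by
    intro q hq hqp
    exact no_factor Sum.inl Sum.inr Sum.inr_injective hdisj q hq a.1 a.2 hcon2 (hqp.trans hap)
  have hp0 : p ≠ 0 := by
    rintro rfl
    exact hpX (Subalgebra.zero_mem _)
  have hpu : ¬ IsUnit p := by
    intro hu
    exact hpX (supp_of_dvd (hu.dvd : p ∣ 1) one_ne_zero (Subalgebra.one_mem _))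
  have hcl : ∀ c ∈ A, c ≠ 0 → ∀ z, c * z ∈ A → z ∈ A := by
    intro c hc hc0 z hz
    have hc1 : c.1 ≠ 0 := fun h => hc0 (h1 c hc h)
    rw [hmem] at hc hz ⊢
    have hd : p ∣ rename Sum.inl c.1 * (rename Sum.inl z.1 - rename Sum.inr z.2) := by
      have := dvd_sub hz (hc.mul_left (rename Sum.inr z.2))
      rw [Prod.fst_mul, Prod.snd_mul, map_mul, map_mul] at this
      convert this using 1
      ring
    refine IsRelPrime.dvd_of_dvd_mul_left ?_ hd
    intro d hdp hdc
    by_contra hdu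
    have hd0 : d ≠ 0 := ne_zero_of_dvd_ne_zero hp0 hdp
    obtain ⟨q, hq, hqd⟩ := WfDvdMonoid.exists_irreducible_factor hdu hd0
    exact hqX q hq (hqd.trans hdp)
      (supp_of_dvd (hqd.trans hdc) (hinl0 _ hc1) (rename_mem_supp _ _))
  obtain ⟨q, hq, hqp⟩ := WfDvdMonoid.exists_irreducible_factor hpu hp0
  obtain ⟨φ, hφ⟩ := exists_line a.1 hcon1
  refine simple_of_spec A φ ?_ h2 hcl a haA hφ
  intro b hb hb0
  exact h1 b hb (spec_inj φ a.1 b.1 hφ hb0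
    (dep_of_irred q hq (hqX q hq hqp) a.1 b.1 a.2 b.2 (hqp.trans hap)
      (hqp.trans ((hmem b).mp hb)) hcon1))
end

section
/- Let p ∈ K[X,Y] with p ∉ K[X] ∪ K[Y]. If p has a nonzero separated multiple, i.e., there exist f ∈ K[X] and g ∈ K[Y] with f − g ≠ 0 and p dividing f − g in K[X,Y], then p has a minimal separated multiple: there exist f₀ ∈ K[X] and g₀ ∈ K[Y] with f₀ − g₀ ≠ 0 and p ∣ f₀ − g₀ such that f₀ − g₀ divides f − g in K[X,Y] for all f ∈ K[X] and g ∈ K[Y] with p ∣ f − g. -/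
open MvPolynomial

section SepAux

variable {R : Type} [CommRing R]

/-- weighted grading map -/
noncomputable def sepPhi (w : Bool → ℕ) :
    MvPolynomial Bool R →ₐ[R] Polynomial (MvPolynomial Bool R) :=
  aeval (fun b => Polynomial.C (X b) * Polynomial.X ^ w b)

/-- evaluate a univariate polynomial at one of the two variables -/
noncomputable def sepEv (b : Bool) : Polynomial R →ₐ[R] MvPolynomial Bool R :=
  Polynomial.aeval (X b)

lemma sepPhi_C (w : Bool → ℕ) (r : R) : sepPhi w (C r) = Polynomial.C (C r) := by
  simp [sepPhi, Polynomial.algebraMap_apply]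
  

lemma sepPhi_X (w : Bool → ℕ) (b : Bool) :
    sepPhi (R := R) w (X b) = Polynomial.C (X b) * Polynomial.X ^ w b := by
  simp [sepPhi]

lemma sepPhi_coeff (w : Bool → ℕ) (q : MvPolynomial Bool R) : ∀ i,
    sepPhi w ((sepPhi w q).coeff i) = Polynomial.C ((sepPhi w q).coeff i) * Polynomial.X ^ i := by
  induction q using MvPolynomial.induction_on with
  | C r =>
    intro i
    rw [sepPhi_C, Polynomial.coeff_C]
    split_ifs with h
    · subst h; simp [sepPhi_C]
    · simp
  | add p q hp hq =>
    intro i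
    rw [map_add, Polynomial.coeff_add, map_add, hp, hq, map_add, add_mul]
  | mul_X q b hq =>
    intro i
    rw [map_mul, sepPhi_X, ← mul_assoc, Polynomial.coeff_mul_X_pow']
    split_ifs with h
    · rw [Polynomial.coeff_mul_C, map_mul, hq, sepPhi_X, map_mul]
      conv_rhs => rw [← Nat.sub_add_cancel h, pow_add]
      simp only [Nat.add_sub_cancel]
      ring
    · simp

lemma sepPhi_eval (w : Bool → ℕ) (q : MvPolynomial Bool R) :
    (sepPhi w q).eval 1 = q := by
  induction q using MvPolynomial.induction_on with
  | C r => simp [sepPhi_C]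
  | add p q hp hq => simp [hp, hq]
  | mul_X q b hq => simp [sepPhi_X, hq]

lemma sepPhi_ne_zero (w : Bool → ℕ) {q : MvPolynomial Bool R} (h : q ≠ 0) : sepPhi w q ≠ 0 := by
  intro h0
  apply h
  rw [← sepPhi_eval w q, h0, Polynomial.eval_zero]

lemma sepPhi_ev (w : Bool → ℕ) (b : Bool) (f : Polynomial R) :
    sepPhi w (sepEv b f) = ∑ i ∈ Finset.range (f.natDegree + 1),
      Polynomial.C (C (f.coeff i) * X b ^ i) * Polynomial.X ^ (w b * i) := by
  rw [sepEv, Polynomial.aeval_eq_sum_range, map_sum]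
  refine Finset.sum_congr rfl fun i _ => ?_
  rw [← C_mul', map_mul, map_pow, sepPhi_C, sepPhi_X, mul_pow, map_mul, pow_mul, map_pow, mul_assoc]

lemma sepPhi_ev_natDegree (w : Bool → ℕ) (b : Bool) (f : Polynomial R) :
    (sepPhi w (sepEv b f)).natDegree ≤ w b * f.natDegree := by
  rw [sepPhi_ev]
  refine Polynomial.natDegree_sum_le_of_forall_le _ _ fun i hi => ?_
  refine (Polynomial.natDegree_C_mul_X_pow_le _ _).trans ?_
  exact Nat.mul_le_mul_left _ (by simpa [Nat.lt_succ_iff] using hi)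

lemma sepPhi_ev_coeff (w : Bool → ℕ) (b : Bool) (hw : 0 < w b) (f : Polynomial R) (i : ℕ) :
    (sepPhi w (sepEv b f)).coeff (w b * i) = C (f.coeff i) * X b ^ i := by
  rw [sepPhi_ev, Polynomial.finsetSum_coeff]
  simp only [Polynomial.coeff_C_mul_X_pow]
  have : ∀ j, (w b * i = w b * j) ↔ i = j := fun j => Nat.mul_right_inj hw.ne'
  simp only [this]
  rw [Finset.sum_ite_eq]
  split_ifs with h
  · rfl
  · rw [Polynomial.coeff_eq_zero_of_natDegree_lt]
    · simp
    · simpa [Nat.lt_succ_iff] using h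

lemma sepPhi_ev_degree_lt (w : Bool → ℕ) (b : Bool) (hw : 0 < w b) (f : Polynomial R) (N : ℕ)
    (h : f.degree < (N : ℕ)) :
    (sepPhi w (sepEv b f)).degree < ((w b * N : ℕ) : WithBot ℕ) := by
  by_cases hf : f = 0
  · subst hf; rw [map_zero, map_zero, Polynomial.degree_zero]; exact WithBot.bot_lt_coe _
  refine lt_of_le_of_lt (Polynomial.degree_le_of_natDegree_le (sepPhi_ev_natDegree w b f)) ?_
  have := (Polynomial.natDegree_lt_iff_degree_lt hf).2 h
  exact_mod_cast Nat.mul_lt_mul_of_pos_left this hw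

variable [IsDomain R]

lemma sep_top_dvd (w : Bool → ℕ) {p q : MvPolynomial Bool R} (h : p ∣ q) (N : ℕ)
    (hN : (sepPhi w q).natDegree ≤ N) :
    (sepPhi w p).leadingCoeff ∣ (sepPhi w q).coeff N := by
  rcases hN.lt_or_eq with h1 | h1
  · rw [Polynomial.coeff_eq_zero_of_natDegree_lt h1]; exact dvd_zero _
  · obtain ⟨r, rfl⟩ := h
    rw [← h1, Polynomial.coeff_natDegree, map_mul, Polynomial.leadingCoeff_mul]
    exact dvd_mul_right _ _

lemma sep_top_unit (w : Bool → ℕ) {p : MvPolynomial Bool R}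
    (h : IsUnit (sepPhi w p).leadingCoeff) : IsUnit p := by
  have h1 := sepPhi_coeff w p (sepPhi w p).natDegree
  rw [Polynomial.coeff_natDegree] at h1
  set T := (sepPhi w p).leadingCoeff with hT
  have hT0 : T ≠ 0 := h.ne_zero
  have h2 : IsUnit (sepPhi w T) := h.map _
  have h3 : (sepPhi w T).natDegree = 0 := Polynomial.natDegree_eq_zero_of_isUnit h2
  rw [h1, Polynomial.natDegree_C_mul_X_pow _ _ hT0] at h3
  have h4 : p = T := by
    conv_lhs => rw [← sepPhi_eval w p, Polynomial.eq_C_of_natDegree_eq_zero h3]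
    rw [Polynomial.eval_C, hT, Polynomial.leadingCoeff, h3]
  rw [h4]; exact h

lemma sep_div (w : Bool → ℕ) (p Q W : MvPolynomial Bool R) (hp : p ≠ 0) (hQ : Q ≠ 0)
    (hW : (sepPhi w W).degree < (sepPhi w Q).degree)
    (hcop : ∀ m, (sepPhi w p).leadingCoeff ∣ m * (sepPhi w Q).leadingCoeff →
      (sepPhi w p).leadingCoeff ∣ m) :
    ∀ n : ℕ, ∀ z, (sepPhi w z).degree < (n : ℕ) → p ∣ z * Q - W → p ∣ z := by
  intro n
  induction n with
  | zero =>
    intro z hz _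
    have : sepPhi w z = 0 := by
      rw [← Polynomial.degree_eq_bot]
      exact Nat.WithBot.lt_zero_iff.1 (by simpa using hz)
    by_contra hne
    exact sepPhi_ne_zero w (fun h => hne (by rw [h]; exact dvd_zero _)) this
  | succ n ih =>
    intro z hz hd
    by_cases hz0 : z = 0
    · rw [hz0]; exact dvd_zero _
    have hPz := sepPhi_ne_zero w hz0
    have hPp := sepPhi_ne_zero w hp
    have hPQ := sepPhi_ne_zero w hQ
    have hlt : (sepPhi w W).degree < (sepPhi w z * sepPhi w Q).degree := by
      refine hW.trans_le ?_
      rw [mul_comm]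
      exact Polynomial.degree_le_mul_left _ hPz
    have hlc : (sepPhi w (z * Q - W)).leadingCoeff =
        (sepPhi w z).leadingCoeff * (sepPhi w Q).leadingCoeff := by
      rw [map_sub, map_mul, Polynomial.leadingCoeff_sub_of_degree_lt hlt,
        Polynomial.leadingCoeff_mul]
    have h1 := sep_top_dvd w hd _ le_rfl
    rw [Polynomial.coeff_natDegree, hlc] at h1
    obtain ⟨m, hm⟩ := hcop _ h1
    have hTp : (sepPhi w p).leadingCoeff ≠ 0 := Polynomial.leadingCoeff_ne_zero.2 hPp
    have hm0 : m ≠ 0 := by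
      rintro rfl
      rw [mul_zero] at hm
      exact hPz (Polynomial.leadingCoeff_eq_zero.1 hm)
    have e1 := sepPhi_coeff w p (sepPhi w p).natDegree
    have e2 := sepPhi_coeff w z (sepPhi w z).natDegree
    rw [Polynomial.coeff_natDegree] at e1 e2
    have e3 : Polynomial.X ^ (sepPhi w p).natDegree * sepPhi w m =
        Polynomial.C m * Polynomial.X ^ (sepPhi w z).natDegree := by
      have : Polynomial.C (sepPhi w p).leadingCoeff ≠ 0 := by simpa using hPp
      apply mul_left_cancel₀ this
      rw [← mul_assoc, ← e1, ← map_mul, ← hm, e2, hm, map_mul, mul_assoc]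
    have hdeg : (sepPhi w z).degree = (sepPhi w (p * m)).degree := by
      have := congrArg Polynomial.degree e3
      rw [Polynomial.degree_mul, Polynomial.degree_mul, Polynomial.degree_X_pow,
        Polynomial.degree_X_pow, Polynomial.degree_C hm0, zero_add] at this
      rw [map_mul, Polynomial.degree_mul, Polynomial.degree_eq_natDegree hPp,
        Polynomial.degree_eq_natDegree hPz, this]
    have hlm : (sepPhi w m).leadingCoeff = m := by
      have := congrArg Polynomial.leadingCoeff e3
      simpa [Polynomial.leadingCoeff_mul] using this
    have hlt2 : (sepPhi w (z - p * m)).degree < (sepPhi w z).degree := by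
      rw [map_sub]
      refine Polynomial.degree_sub_lt_left hdeg hPz ?_
      rw [map_mul, Polynomial.leadingCoeff_mul, hlm, hm]
    have h5 : p ∣ z - p * m := by
      apply ih
      · have h6 : (sepPhi w z).degree ≤ (n : ℕ) := by
          rw [Polynomial.degree_eq_natDegree hPz] at hz ⊢
          have : (sepPhi w z).natDegree < n + 1 := by exact_mod_cast hz
          exact_mod_cast Nat.lt_succ_iff.1 this
        exact hlt2.trans_le h6
      · have : (z - p * m) * Q - W = (z * Q - W) - p * (m * Q) := by ring
        rw [this]
        exact dvd_sub hd (dvd_mul_right _ _)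
    have : z = (z - p * m) + p * m := by ring
    rw [this]
    exact dvd_add h5 (dvd_mul_right _ _)

end SepAux

/-- approximate roots -/
lemma sep_root {S : Type} [CommRing S] [IsDomain S] [Algebra ℚ S] (k d : ℕ) (hk : 0 < k)
    (f : Polynomial S) (hf : f.Monic) (hd : f.natDegree = k * d) :
    ∃ h : Polynomial S, h.Monic ∧ h.natDegree = d ∧
      (f - h ^ k).degree < (((k - 1) * d : ℕ) : WithBot ℕ) := by
  have key : ∀ j, j ≤ d → ∃ h : Polynomial S, h.Monic ∧ h.natDegree = d ∧
      (f - h ^ k).degree < ((k * d - j : ℕ) : WithBot ℕ) := by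
    intro j
    induction j with
    | zero =>
      intro _
      refine ⟨Polynomial.X ^ d, Polynomial.monic_X_pow d, Polynomial.natDegree_X_pow d, ?_⟩
      have h1 : f.degree = ((Polynomial.X ^ d : Polynomial S) ^ k).degree := by
        rw [← pow_mul, Polynomial.degree_X_pow, Polynomial.degree_eq_natDegree hf.ne_zero, hd,
          mul_comm]
      have := Polynomial.degree_sub_lt_left h1 hf.ne_zero
        (by rw [hf.leadingCoeff, ((Polynomial.monic_X_pow d).pow k).leadingCoeff])
      rwa [Polynomial.degree_eq_natDegree hf.ne_zero, hd] at this
    | succ j ih =>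
      intro hj
      obtain ⟨h, hm, hn, hlt⟩ := ih (by omega)
      obtain ⟨k, rfl⟩ : ∃ k', k = k' + 1 := ⟨k - 1, by omega⟩
      obtain ⟨e, he⟩ : ∃ e, d = e + (j + 1) := ⟨d - (j + 1), by omega⟩
      have hkd : (k + 1) * d = k * d + d := by ring
      have hkd' : (k + 1) * d - j = k * d + e + 1 := by omega
      have hkd'' : (k + 1) * d - (j + 1) = k * d + e := by omega
      rw [hkd'] at hlt
      rw [hkd'']
      set c : S := algebraMap ℚ S ((k + 1 : ℚ)⁻¹) * (f - h ^ (k + 1)).coeff (k * d + e) with hc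
      have hkc : ((k : S) + 1) * c = (f - h ^ (k + 1)).coeff (k * d + e) := by
        rw [hc, ← mul_assoc]
        have : ((k : S) + 1) = algebraMap ℚ S (k + 1 : ℚ) := by simp
        rw [this, ← map_mul, mul_inv_cancel₀ (by positivity), map_one, one_mul]
      set y : Polynomial S := Polynomial.C c * Polynomial.X ^ e with hy
      have hyd : y.natDegree ≤ e := Polynomial.natDegree_C_mul_X_pow_le _ _
      have hylt : y.degree < h.degree := by
        rw [Polynomial.degree_eq_natDegree hm.ne_zero, hn]
        refine (Polynomial.degree_le_of_natDegree_le hyd).trans_lt ?_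
        exact_mod_cast (by omega : e < d)
      have hm' : (h + y).Monic := hm.add_of_left hylt
      have hn' : (h + y).natDegree = d := by
        rw [Polynomial.natDegree_add_eq_left_of_degree_lt hylt, hn]
      refine ⟨h + y, hm', hn', ?_⟩
      have hgeom : (h + y) ^ (k + 1) - h ^ (k + 1) =
          y * ∑ i ∈ Finset.range (k + 1), (h + y) ^ i * h ^ (k + 1 - 1 - i) := by
        rw [← Commute.geom_sum₂_mul (Commute.all _ _)]
        rw [mul_comm]; congr 1; ring
      set G := ∑ i ∈ Finset.range (k + 1), (h + y) ^ i * h ^ (k + 1 - 1 - i) with hG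
      have hterm : ∀ i ∈ Finset.range (k + 1),
          ((h + y) ^ i * h ^ (k + 1 - 1 - i)).Monic ∧
          ((h + y) ^ i * h ^ (k + 1 - 1 - i)).natDegree = k * d := by
        intro i hi
        have hi' : i ≤ k := by simpa [Nat.lt_succ_iff] using hi
        refine ⟨(hm'.pow i).mul (hm.pow _), ?_⟩
        rw [(hm'.pow i).natDegree_mul (hm.pow _), hm'.natDegree_pow, hm.natDegree_pow, hn, hn',
          ← add_mul]
        congr 1; omega
      have hGd : G.natDegree ≤ k * d :=
        Polynomial.natDegree_sum_le_of_forall_le _ _ fun i hi => (hterm i hi).2.le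
      have hGc : G.coeff (k * d) = (k : S) + 1 := by
        rw [hG, Polynomial.finsetSum_coeff, Finset.sum_congr rfl (g := fun _ => (1 : S))]
        · simp
        · intro i hi
          rw [← (hterm i hi).2]
          exact (hterm i hi).1.coeff_natDegree
      have heq : f - (h + y) ^ (k + 1) = (f - h ^ (k + 1)) - G * y := by
        rw [mul_comm G, ← hgeom]; ring
      have hle : (f - (h + y) ^ (k + 1)).degree ≤ ((k * d + e : ℕ) : WithBot ℕ) := by
        rw [heq]
        refine (Polynomial.degree_sub_le _ _).trans (max_le ?_ ?_)
        · rcases eq_or_ne (f - h ^ (k + 1)) 0 with h0 | h0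
          · rw [h0, Polynomial.degree_zero]; exact bot_le
          · exact Polynomial.degree_le_of_natDegree_le
              (Nat.lt_succ_iff.1 ((Polynomial.natDegree_lt_iff_degree_lt h0).2 hlt))
        · exact Polynomial.degree_le_of_natDegree_le
            (Polynomial.natDegree_mul_le.trans (add_le_add hGd hyd))
      rw [lt_iff_le_and_ne]
      refine ⟨hle, fun hE => ?_⟩
      have hz : (f - (h + y) ^ (k + 1)).coeff (k * d + e) = 0 := by
        rw [heq, Polynomial.coeff_sub, Polynomial.coeff_mul_add_eq_of_natDegree_le hGd hyd, hGc,
          ← hkc]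
        simp [hy]
      exact Polynomial.coeff_ne_zero_of_eq_degree hE hz
  obtain ⟨h, h1, h2, h3⟩ := key d le_rfl
  refine ⟨h, h1, h2, ?_⟩
  have : (k - 1) * d = k * d - d := by rw [Nat.sub_mul, one_mul]
  rwa [this]

section SepTop

variable {R : Type} [CommRing R] [IsDomain R] [UniqueFactorizationMonoid R]

/-- Facts about the top form of `p`. -/
structure SepTop (a b : ℕ) (u v : R) (T : MvPolynomial Bool R) : Prop where
  dvd : T ∣ C u * X true ^ a - C v * X false ^ b
  cancel_t : ∀ m i, T ∣ m * X true ^ i → T ∣ m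
  cancel_s : ∀ m i, T ∣ m * X false ^ i → T ∣ m
  const : ∀ r : R, T ∣ C r → r = 0

lemma sep_relprime_X (x y : Bool) (hxy : x ≠ y) (a b i : ℕ) (ha : 0 < a) (hb : 0 < b) (u v : R)
    (hu : IsUnit u) : IsRelPrime (C u * X x ^ a - C v * X y ^ b) (X y ^ i : MvPolynomial Bool R) := by
  apply IsRelPrime.pow_right
  have hy : Prime (X y : MvPolynomial Bool R) := MvPolynomial.X_prime
  refine ((hy.irreducible.isRelPrime_iff_not_dvd).2 ?_).symm
  intro hdvd
  have h1 : (X y : MvPolynomial Bool R) ∣ C v * X y ^ b :=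
    Dvd.dvd.mul_left (dvd_pow_self _ hb.ne') _
  have h2 : (X y : MvPolynomial Bool R) ∣ C u * X x ^ a := by
    have := dvd_add hdvd h1
    simpa using this
  have h3 : (X y : MvPolynomial Bool R) ∣ X x ^ a := by
    rwa [(hu.map C).dvd_mul_left] at h2
  have h4 := hy.dvd_of_dvd_pow h3
  rw [MvPolynomial.X_dvd_X] at h4
  exact hxy h4.symm

lemma sep_relprime_C (a b : ℕ) (ha : 0 < a) (u v : R)
    (hu : IsUnit u) (r : R) (hr : r ≠ 0) :
    IsRelPrime (C u * X true ^ a - C v * X false ^ b) (C r : MvPolynomial Bool R) := by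
  intro d h1 h2
  obtain ⟨r', _, rfl⟩ := (MvPolynomial.dvd_C_iff_exists hr).1 h2
  rw [MvPolynomial.C_dvd_iff_dvd_coeff] at h1
  have := h1 (Finsupp.single true a)
  rw [coeff_sub, coeff_C_mul, coeff_C_mul, coeff_X_pow, coeff_X_pow, if_pos rfl, if_neg] at this
  · simp at this
    exact (isUnit_of_dvd_unit this hu).map C
  · intro h
    have := DFunLike.congr_fun h true
    simp at this
    omega

lemma sepTop_of (p : MvPolynomial Bool R) (hp : ¬ IsUnit p) (a b : ℕ) (ha : 0 < a) (hb : 0 < b)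
    (w : Bool → ℕ) (hwt : w true = b) (hws : w false = a) (f g : Polynomial R)
    (hfa : f.natDegree = a) (hgb : g.natDegree = b) (hu : IsUnit f.leadingCoeff)
    (hv : IsUnit g.leadingCoeff) (hd : p ∣ sepEv true f - sepEv false g) :
    SepTop a b f.leadingCoeff g.leadingCoeff (sepPhi w p).leadingCoeff := by
  have h1 : (sepPhi w p).leadingCoeff ∣
      C f.leadingCoeff * X true ^ a - C g.leadingCoeff * X false ^ b := by
    have h2 := sepPhi_ev_natDegree w true f
    have h3 := sepPhi_ev_natDegree w false g
    have c1 := sepPhi_ev_coeff w true (by omega) f a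
    have c2 := sepPhi_ev_coeff w false (by omega) g b
    rw [hwt, hfa] at h2
    rw [hws, hgb, mul_comm] at h3
    rw [hwt] at c1
    rw [hws, mul_comm] at c2
    have h4 := sep_top_dvd w hd (b * a) (by
      rw [map_sub]
      exact (Polynomial.natDegree_sub_le _ _).trans (max_le h2 h3))
    rw [map_sub, Polynomial.coeff_sub, c1, c2] at h4
    rwa [← hfa, ← hgb, Polynomial.coeff_natDegree, Polynomial.coeff_natDegree, hfa, hgb] at h4
  have hT : ¬ IsUnit (sepPhi w p).leadingCoeff := fun h => hp (sep_top_unit w h)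
  refine ⟨h1, fun m i hm => ?_, fun m i hm => ?_, fun r hr => ?_⟩
  · have := sep_relprime_X false true (by simp) b a i hb ha g.leadingCoeff f.leadingCoeff hv
    refine IsRelPrime.dvd_of_dvd_mul_right (IsRelPrime.of_dvd_left this ?_) hm
    rw [← neg_sub, dvd_neg]; exact h1
  · have := sep_relprime_X true false (by simp) a b i ha hb f.leadingCoeff g.leadingCoeff hu
    exact IsRelPrime.dvd_of_dvd_mul_right (IsRelPrime.of_dvd_left this h1) hm
  · by_contra hr0
    have := sep_relprime_C a b ha f.leadingCoeff g.leadingCoeff hu r hr0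
    exact hT ((IsRelPrime.of_dvd_left this h1) dvd_rfl hr)

/-- degree proportionality and top form of a separated multiple -/
lemma sep_prop (p : MvPolynomial Bool R) (a b : ℕ) (ha : 0 < a) (hb : 0 < b)
    (w : Bool → ℕ) (hwt : w true = b) (hws : w false = a) (u v : R)
    (hT : SepTop a b u v (sepPhi w p).leadingCoeff) (f g : Polynomial R)
    (hd : p ∣ sepEv true f - sepEv false g) :
    b * f.natDegree = a * g.natDegree ∧
    (sepPhi w p).leadingCoeff ∣
      C f.leadingCoeff * X true ^ f.natDegree - C g.leadingCoeff * X false ^ g.natDegree := by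
  have h2 := sepPhi_ev_natDegree w true f
  have h3 := sepPhi_ev_natDegree w false g
  have c1 := sepPhi_ev_coeff w true (by omega) f f.natDegree
  have c2 := sepPhi_ev_coeff w false (by omega) g g.natDegree
  rw [hwt] at h2 c1
  rw [hws] at h3 c2
  have heq : b * f.natDegree = a * g.natDegree := by
    rcases lt_trichotomy (b * f.natDegree) (a * g.natDegree) with h | h | h
    · exfalso
      have h4 := sep_top_dvd w hd (a * g.natDegree) (by
        rw [map_sub]
        exact (Polynomial.natDegree_sub_le _ _).trans (max_le (h2.trans h.le) h3))
      rw [map_sub, Polynomial.coeff_sub, c2,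
        Polynomial.coeff_eq_zero_of_natDegree_lt (h2.trans_lt h), zero_sub, dvd_neg] at h4
      have := hT.const _ (hT.cancel_s _ _ h4)
      rw [Polynomial.coeff_natDegree, Polynomial.leadingCoeff_eq_zero] at this
      simp [this] at h
    · exact h
    · exfalso
      have h4 := sep_top_dvd w hd (b * f.natDegree) (by
        rw [map_sub]
        exact (Polynomial.natDegree_sub_le _ _).trans (max_le h2 (h3.trans h.le)))
      rw [map_sub, Polynomial.coeff_sub, c1,
        Polynomial.coeff_eq_zero_of_natDegree_lt (h3.trans_lt h), sub_zero] at h4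
      have := hT.const _ (hT.cancel_t _ _ h4)
      rw [Polynomial.coeff_natDegree, Polynomial.leadingCoeff_eq_zero] at this
      simp [this] at h
  refine ⟨heq, ?_⟩
  have h4 := sep_top_dvd w hd (b * f.natDegree) (by
        rw [map_sub]
        exact (Polynomial.natDegree_sub_le _ _).trans (max_le h2 (heq ▸ h3)))
  rw [map_sub, Polynomial.coeff_sub, c1, heq, c2] at h4
  exact h4

end SepTop

lemma sep_bezout {K Q : Type} [Field K] [CommRing Q] [Algebra K Q] (U V : Q) (k l : ℕ)
    (hkl : Nat.Coprime k l) (hl : 0 < l) (c c' : K) (hc' : c' ≠ 0)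
    (hcancel : ∀ (x : Q) (i : ℕ), x * V ^ i = 0 → x = 0)
    (h1 : U ^ k = algebraMap K Q c * V ^ k) (h2 : U ^ l = algebraMap K Q c' * V ^ l) :
    ∃ ζ : K, U = algebraMap K Q ζ * V := by
  rcases Nat.lt_or_ge 1 l with hl1 | hl1
  · obtain ⟨x, hx⟩ := Nat.exists_mul_mod_eq_one_of_coprime hkl hl1
    obtain ⟨y, hy⟩ : ∃ y, k * x = l * y + 1 := ⟨k * x / l, by
      have := Nat.div_add_mod (k * x) l; omega⟩
    have e1 : U ^ (l * y) * U = algebraMap K Q (c ^ x) * (V ^ (l * y) * V) := by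
      rw [← pow_succ, ← pow_succ, ← hy, pow_mul, h1, mul_pow, map_pow, ← pow_mul]
    have e2 : U ^ (l * y) = algebraMap K Q (c' ^ y) * V ^ (l * y) := by
      rw [pow_mul, h2, mul_pow, map_pow, ← pow_mul]
    have e3 : (algebraMap K Q (c' ^ y) * U - algebraMap K Q (c ^ x) * V) * V ^ (l * y) = 0 := by
      rw [e2] at e1
      linear_combination e1
    have e4 := sub_eq_zero.1 (hcancel _ _ e3)
    refine ⟨(c' ^ y)⁻¹ * c ^ x, ?_⟩
    rw [map_mul, mul_assoc, ← e4, ← mul_assoc, ← map_mul, inv_mul_cancel₀ (pow_ne_zero _ hc'),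
      map_one, one_mul]
  · obtain rfl : l = 1 := by omega
    exact ⟨c', by simpa using h2⟩

section SepStep

variable {K R R1 R2 : Type} [Field K] [CharZero K]
  [CommRing R] [IsDomain R] [UniqueFactorizationMonoid R] [Algebra K R]
  [CommRing R1] [IsDomain R1] [Algebra K R1]
  [CommRing R2] [IsDomain R2] [Algebra K R2]

lemma sep_root_K {S : Type} [CommRing S] [IsDomain S] [Algebra K S] (k d : ℕ) (hk : 0 < k)
    (f : Polynomial S) (u : K) (hu : u ≠ 0) (hf : f.leadingCoeff = algebraMap K S u)
    (hd : f.natDegree = k * d) :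
    ∃ h : Polynomial S, h.Monic ∧ h.natDegree = d ∧
      (Polynomial.C (algebraMap K S u⁻¹) * f - h ^ k).degree <
        (((k - 1) * d : ℕ) : WithBot ℕ) := by
  letI : Algebra ℚ S := ((algebraMap K S).comp (algebraMap ℚ K)).toAlgebra
  have hu' : algebraMap K S u⁻¹ ≠ 0 := by simpa using hu
  apply sep_root k d hk
  · rw [Polynomial.Monic, Polynomial.leadingCoeff_mul, Polynomial.leadingCoeff_C, hf, ← map_mul,
      inv_mul_cancel₀ hu, map_one]
  · rw [Polynomial.natDegree_C_mul hu', hd]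

lemma sepEv_C (b : Bool) (r : R) : sepEv b (Polynomial.C r) = C r := by
  simp [sepEv, MvPolynomial.algebraMap_eq]

lemma sep_root_step (i1 : R1 →ₐ[K] R) (i2 : R2 →ₐ[K] R) 
    (p : MvPolynomial Bool R) (hp0 : p ≠ 0) (k d e : ℕ) (hk : 0 < k) (hd : 0 < d) (he : 0 < e)
    (u v ζ : K) (hu : u ≠ 0) (hv : v ≠ 0) (hζ : u * ζ ^ k = v) (w : Bool → ℕ)
    (hwt : w true = k * e) (hws : w false = k * d)
    (hT : SepTop (k * d) (k * e) (algebraMap K R u) (algebraMap K R v)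
      (sepPhi w p).leadingCoeff)
    (f : Polynomial R1) (g : Polynomial R2)
    (hf : f.leadingCoeff = algebraMap K R1 u) (hg : g.leadingCoeff = algebraMap K R2 v)
    (hfd : f.natDegree = k * d) (hgd : g.natDegree = k * e)
    (hdvd : p ∣ sepEv true (f.map i1.toRingHom) - sepEv false (g.map i2.toRingHom))
    (hUV : (sepPhi w p).leadingCoeff ∣ X true ^ d - C (algebraMap K R ζ) * X false ^ e) :
    ∃ (h : Polynomial R1) (g' : Polynomial R2), h.natDegree = d ∧
      p ∣ sepEv true (h.map i1.toRingHom) - sepEv false (g'.map i2.toRingHom) := by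
  obtain ⟨h, hm, hn, hlt⟩ := sep_root_K k d hk f u hu hf hfd
  obtain ⟨h', hm', hn', hlt'⟩ := sep_root_K k e hk g v hv hg hgd
  refine ⟨h, Polynomial.C (algebraMap K R2 ζ) * h', hn, ?_⟩
  have hζ0 : ζ ≠ 0 := by
    rintro rfl
    rw [zero_pow hk.ne', mul_zero] at hζ
    exact hv hζ.symm
  set T := (sepPhi w p).leadingCoeff with hTdef
  set Z : MvPolynomial Bool R := C (algebraMap K R ζ) with hZ
  set H := sepEv true (h.map i1.toRingHom) with hH
  set G := sepEv false (h'.map i2.toRingHom) with hG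
  have hrw : sepEv false ((Polynomial.C (algebraMap K R2 ζ) * h').map i2.toRingHom) = Z * G := by
    rw [Polynomial.map_mul, map_mul, Polynomial.map_C, sepEv_C]
    simp [hZ, hG]
  rw [hrw]
  set F0 := sepEv true (f.map i1.toRingHom) with hF0
  set G0 := sepEv false (g.map i2.toRingHom) with hG0
  set r := Polynomial.C (algebraMap K R1 u⁻¹) * f - h ^ k with hr
  set s := Polynomial.C (algebraMap K R2 v⁻¹) * g - h' ^ k with hs
  have er : sepEv true (r.map i1.toRingHom) = C (algebraMap K R u⁻¹) * F0 - H ^ k := by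
    rw [hr, Polynomial.map_sub, Polynomial.map_mul, Polynomial.map_pow, map_sub, map_mul, map_pow,
      Polynomial.map_C, sepEv_C]
    simp [hF0, hH]
  have es : sepEv false (s.map i2.toRingHom) = C (algebraMap K R v⁻¹) * G0 - G ^ k := by
    rw [hs, Polynomial.map_sub, Polynomial.map_mul, Polynomial.map_pow, map_sub, map_mul, map_pow,
      Polynomial.map_C, sepEv_C]
    simp [hG0, hG]
  set Q := ∑ i ∈ Finset.range k, H ^ i * (Z * G) ^ (k - 1 - i) with hQ
  set W := Z ^ k * sepEv false (s.map i2.toRingHom) - sepEv true (r.map i1.toRingHom) with hW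
  have hzQ : (H - Z * G) * Q - W = C (algebraMap K R u⁻¹) * (F0 - G0) := by
    have e1 : (H - Z * G) * Q = H ^ k - (Z * G) ^ k := by
      rw [mul_comm, hQ, Commute.geom_sum₂_mul (Commute.all _ _)]
    have e2 : Z ^ k * C (algebraMap K R v⁻¹) = C (algebraMap K R u⁻¹) := by
      rw [hZ, ← C_pow, ← C_mul, ← map_pow, ← map_mul]
      congr 2
      rw [← hζ]
      field_simp
    rw [e1, hW, er, es, mul_pow]
    linear_combination (-G0) * e2
  set δ := k * e * d with hδ
  have hUdeg : (sepPhi w H).natDegree ≤ δ := by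
    refine (sepPhi_ev_natDegree w true _).trans ?_
    rw [hwt]
    exact Nat.mul_le_mul_left _ (Polynomial.natDegree_map_le.trans hn.le)
  have hVdeg' : (sepPhi w G).natDegree ≤ δ := by
    refine (sepPhi_ev_natDegree w false _).trans ?_
    rw [hws, hδ, show k * e * d = k * d * e by ring]
    exact Nat.mul_le_mul_left _ (Polynomial.natDegree_map_le.trans hn'.le)
  have hUc : (sepPhi w H).coeff δ = X true ^ d := by
    have := sepPhi_ev_coeff w true (by rw [hwt]; positivity) (h.map i1.toRingHom) d
    rw [hwt] at this
    rw [hδ, hH, this, Polynomial.coeff_map]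
    have h2 := hm.coeff_natDegree
    rw [hn] at h2
    simp [h2]
  have hVc' : (sepPhi w G).coeff δ = X false ^ e := by
    have := sepPhi_ev_coeff w false (by rw [hws]; positivity) (h'.map i2.toRingHom) e
    rw [hws] at this
    rw [hδ, show k * e * d = k * d * e by ring, hG, this, Polynomial.coeff_map]
    have h2 := hm'.coeff_natDegree
    rw [hn'] at h2
    simp [h2]
  have hVdeg : (sepPhi w (Z * G)).natDegree ≤ δ := by
    rw [map_mul, hZ, sepPhi_C]
    exact (Polynomial.natDegree_C_mul_le _ _).trans hVdeg'
  have hVc : (sepPhi w (Z * G)).coeff δ = Z * X false ^ e := by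
    rw [map_mul, hZ, sepPhi_C, Polynomial.coeff_C_mul, hVc']
  have hterm : ∀ i ∈ Finset.range k,
      (sepPhi w (H ^ i * (Z * G) ^ (k - 1 - i))).natDegree ≤ (k - 1) * δ ∧
      (sepPhi w (H ^ i * (Z * G) ^ (k - 1 - i))).coeff ((k - 1) * δ) =
        (X true ^ d) ^ i * (Z * X false ^ e) ^ (k - 1 - i) := by
    intro i hi
    have hi' : i < k := by simpa using hi
    have hsum : (k - 1) * δ = i * δ + (k - 1 - i) * δ := by
      rw [← add_mul]; congr 1; omega
    have n1 : (sepPhi w H ^ i).natDegree ≤ i * δ := Polynomial.natDegree_pow_le_of_le _ hUdeg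
    have n2 : (sepPhi w (Z * G) ^ (k - 1 - i)).natDegree ≤ (k - 1 - i) * δ :=
      Polynomial.natDegree_pow_le_of_le _ hVdeg
    rw [map_mul, map_pow, map_pow, hsum]
    refine ⟨Polynomial.natDegree_mul_le.trans (add_le_add n1 n2), ?_⟩
    rw [Polynomial.coeff_mul_add_eq_of_natDegree_le n1 n2,
      Polynomial.coeff_pow_of_natDegree_le hUdeg, Polynomial.coeff_pow_of_natDegree_le hVdeg,
      hUc, hVc]
  set q := ∑ i ∈ Finset.range k, (X true ^ d) ^ i * (Z * X false ^ e) ^ (k - 1 - i) with hq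
  have hQdeg : (sepPhi w Q).natDegree ≤ (k - 1) * δ := by
    rw [hQ, map_sum]
    exact Polynomial.natDegree_sum_le_of_forall_le _ _ fun i hi => (hterm i hi).1
  have hQc : (sepPhi w Q).coeff ((k - 1) * δ) = q := by
    rw [hQ, map_sum, Polynomial.finsetSum_coeff, hq]
    exact Finset.sum_congr rfl fun i hi => (hterm i hi).2
  have hcop : ∀ m, T ∣ m * q → T ∣ m := by
    intro m hmq
    have h1 : T ∣ q - (k : MvPolynomial Bool R) * (Z * X false ^ e) ^ (k - 1) := by
      have : (k : MvPolynomial Bool R) * (Z * X false ^ e) ^ (k - 1) =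
          ∑ i ∈ Finset.range k, (Z * X false ^ e) ^ i * (Z * X false ^ e) ^ (k - 1 - i) := by
        rw [Finset.sum_congr rfl (g := fun _ => (Z * X false ^ e) ^ (k - 1))]
        · simp
        · intro i hi
          have hi' : i < k := by simpa using hi
          rw [← pow_add]; congr 1; omega
      rw [this, hq, ← Finset.sum_sub_distrib]
      refine Finset.dvd_sum fun i _ => ?_
      rw [← sub_mul]
      exact Dvd.dvd.mul_right (hUV.trans (sub_dvd_pow_sub_pow _ _ _)) _
    have h2 : T ∣ m * ((k : MvPolynomial Bool R) * (Z * X false ^ e) ^ (k - 1)) := by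
      have := dvd_sub hmq (Dvd.dvd.mul_left h1 m)
      rwa [← mul_sub, sub_sub_cancel] at this
    have h3 : m * ((k : MvPolynomial Bool R) * (Z * X false ^ e) ^ (k - 1)) =
        C (algebraMap K R (k * ζ ^ (k - 1))) * m * X false ^ (e * (k - 1)) := by
      rw [mul_pow, hZ, pow_mul]
      simp only [map_mul, map_pow, map_natCast]
      ring
    rw [h3] at h2
    have h4 := hT.cancel_s _ _ h2
    have hunit : IsUnit (C (algebraMap K R (k * ζ ^ (k - 1))) : MvPolynomial Bool R) := by
      refine IsUnit.map C (IsUnit.map (algebraMap K R) (IsUnit.mk0 _ ?_))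
      exact mul_ne_zero (by exact_mod_cast hk.ne') (pow_ne_zero _ hζ0)
    rwa [hunit.dvd_mul_left] at h4
  have hq0 : q ≠ 0 := by
    intro h0
    have h1 := hcop (C 1) (by rw [h0, mul_zero]; exact dvd_zero _)
    exact one_ne_zero (hT.const _ h1)
  have hQnd : (sepPhi w Q).natDegree = (k - 1) * δ :=
    le_antisymm hQdeg (Polynomial.le_natDegree_of_ne_zero (by rw [hQc]; exact hq0))
  have hQlc : (sepPhi w Q).leadingCoeff = q := by
    rw [Polynomial.leadingCoeff, hQnd, hQc]
  have hQ0 : Q ≠ 0 := by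
    intro h0
    apply hq0
    rw [← hQc, h0]
    simp
  have hWdeg : (sepPhi w W).degree < (sepPhi w Q).degree := by
    rw [Polynomial.degree_eq_natDegree (sepPhi_ne_zero w hQ0), hQnd, hW, map_sub]
    refine (Polynomial.degree_sub_le _ _).trans_lt (max_lt ?_ ?_)
    · rw [map_mul, hZ, ← C_pow, sepPhi_C]
      refine lt_of_le_of_lt ?_ (lt_of_lt_of_eq (sepPhi_ev_degree_lt w false
        (by rw [hws]; positivity) (s.map i2.toRingHom) ((k - 1) * e)
        (Polynomial.degree_map_le.trans_lt hlt')) ?_)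
      · refine (Polynomial.degree_mul_le _ _).trans ?_
        exact (add_le_add_left Polynomial.degree_C_le _).trans (by rw [zero_add])
      · rw [hws, hδ]; congr 1; ring
    · refine lt_of_lt_of_eq (sepPhi_ev_degree_lt w true
        (by rw [hwt]; positivity) (r.map i1.toRingHom) ((k - 1) * d)
        (Polynomial.degree_map_le.trans_lt hlt)) ?_
      rw [hwt, hδ]; congr 1; ring
  refine sep_div w p Q W hp0 hQ0 hWdeg (by rw [hQlc]; exact hcop)
    ((sepPhi w (H - Z * G)).natDegree + 1) _ ?_ ?_
  · exact Polynomial.degree_le_natDegree.trans_lt (by exact_mod_cast Nat.lt_succ_self _)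
  · rw [hzQ]
    exact Dvd.dvd.mul_left hdvd _

/-- weights -/
def sepW (a b : ℕ) : Bool → ℕ := fun x => if x then b else a

/-- A separated multiple with scalar leading coefficients -/
structure SepBase (i1 : R1 →ₐ[K] R) (i2 : R2 →ₐ[K] R) (p : MvPolynomial Bool R)
    (f : Polynomial R1) (g : Polynomial R2) (a b : ℕ) (u v : K) : Prop where
  dvd : p ∣ sepEv true (f.map i1.toRingHom) - sepEv false (g.map i2.toRingHom)
  fa : f.natDegree = a
  gb : g.natDegree = b
  ha : 0 < a
  hb : 0 < b
  hu : u ≠ 0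
  hv : v ≠ 0
  fu : f.leadingCoeff = algebraMap K R1 u
  gv : g.leadingCoeff = algebraMap K R2 v

lemma SepBase.top {i1 : R1 →ₐ[K] R} {i2 : R2 →ₐ[K] R} {p : MvPolynomial Bool R}
    {f : Polynomial R1} {g : Polynomial R2} {a b : ℕ} {u v : K}
    (hi1 : Function.Injective i1) (hi2 : Function.Injective i2) (hp : ¬ IsUnit p)
    (B : SepBase i1 i2 p f g a b u v) :
    SepTop a b (algebraMap K R u) (algebraMap K R v) (sepPhi (sepW a b) p).leadingCoeff := by
  have e1 : (f.map i1.toRingHom).leadingCoeff = algebraMap K R u := by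
    rw [Polynomial.leadingCoeff_map_of_injective (f := i1.toRingHom) hi1, B.fu]; simp
  have e2 : (g.map i2.toRingHom).leadingCoeff = algebraMap K R v := by
    rw [Polynomial.leadingCoeff_map_of_injective (f := i2.toRingHom) hi2, B.gv]; simp
  have := sepTop_of p hp a b B.ha B.hb (sepW a b) (by simp [sepW]) (by simp [sepW])
    (f.map i1.toRingHom) (g.map i2.toRingHom)
    (by rw [Polynomial.natDegree_map_eq_of_injective (f := i1.toRingHom) hi1, B.fa])
    (by rw [Polynomial.natDegree_map_eq_of_injective (f := i2.toRingHom) hi2, B.gb])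
    (by rw [e1]; exact (IsUnit.mk0 u B.hu).map _) (by rw [e2]; exact (IsUnit.mk0 v B.hv).map _)
    B.dvd
  rwa [e1, e2] at this

lemma SepBase.prop {i1 : R1 →ₐ[K] R} {i2 : R2 →ₐ[K] R} {p : MvPolynomial Bool R}
    {f : Polynomial R1} {g : Polynomial R2} {a b : ℕ} {u v : K}
    (hi1 : Function.Injective i1) (hi2 : Function.Injective i2) (hp : ¬ IsUnit p)
    (B : SepBase i1 i2 p f g a b u v)
    (f' : Polynomial R1) (g' : Polynomial R2)
    (hd : p ∣ sepEv true (f'.map i1.toRingHom) - sepEv false (g'.map i2.toRingHom)) :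
    b * f'.natDegree = a * g'.natDegree ∧
    (sepPhi (sepW a b) p).leadingCoeff ∣
      C (i1 f'.leadingCoeff) * X true ^ f'.natDegree -
        C (i2 g'.leadingCoeff) * X false ^ g'.natDegree := by
  have := sep_prop p a b B.ha B.hb (sepW a b) (by simp [sepW]) (by simp [sepW]) _ _
    (B.top hi1 hi2 hp) _ _ hd
  rw [Polynomial.natDegree_map_eq_of_injective (f := i1.toRingHom) hi1,
    Polynomial.natDegree_map_eq_of_injective (f := i2.toRingHom) hi2,
    Polynomial.leadingCoeff_map_of_injective (f := i1.toRingHom) hi1,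
    Polynomial.leadingCoeff_map_of_injective (f := i2.toRingHom) hi2] at this
  exact this

lemma sep_pow_cancel {T : MvPolynomial Bool R} {a b : ℕ} {u v l m : R} {α β : ℕ}
    (hT : SepTop a b u v T) (hab : b * α = a * β)
    (h : T ∣ C l * X true ^ α - C m * X false ^ β) :
    l ^ a * v ^ α = m ^ a * u ^ α := by
  have h1 : T ∣ (C u * X true ^ a) ^ α - (C v * X false ^ b) ^ α :=
    hT.dvd.trans (sub_dvd_pow_sub_pow _ _ _)
  have h2 : T ∣ (C l * X true ^ α) ^ a - (C m * X false ^ β) ^ a :=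
    h.trans (sub_dvd_pow_sub_pow _ _ _)
  have h3 := dvd_sub (Dvd.dvd.mul_left h2 (C u ^ α)) (Dvd.dvd.mul_left h1 (C l ^ a))
  have h4 : C u ^ α * ((C l * X true ^ α) ^ a - (C m * X false ^ β) ^ a) -
      C l ^ a * ((C u * X true ^ a) ^ α - (C v * X false ^ b) ^ α) =
      C (l ^ a * v ^ α - m ^ a * u ^ α) * X false ^ (b * α) := by
    simp only [map_sub, map_mul, map_pow]
    have e1 : (X false : MvPolynomial Bool R) ^ (b * α) = (X false ^ b) ^ α := pow_mul _ _ _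
    have e2 : (X false : MvPolynomial Bool R) ^ (b * α) = (X false ^ β) ^ a := by
      rw [hab, mul_comm, pow_mul]
    have e3 : ((X true : MvPolynomial Bool R) ^ a) ^ α = (X true ^ α) ^ a := by
      rw [← pow_mul, ← pow_mul, mul_comm]
    simp only [mul_pow]
    rw [sub_mul, e3, ← e2, ← e1]
    ring
  rw [h4] at h3
  exact sub_eq_zero.1 (hT.const _ (hT.cancel_s _ _ h3))

theorem sep_core (i1 : R1 →ₐ[K] R) (i2 : R2 →ₐ[K] R) (p : MvPolynomial Bool R)
    (hi1 : Function.Injective i1) (hi2 : Function.Injective i2) (hp : ¬ IsUnit p) (hp0 : p ≠ 0)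
    (hconst : ∀ (x : R1) (y : R2), i1 x = i2 y →
      ∃ κ : K, x = algebraMap K R1 κ ∧ y = algebraMap K R2 κ)
    (hpow1 : ∀ (x : R1) (n : ℕ) (κ : K), κ ≠ 0 → 0 < n → x ^ n = algebraMap K R1 κ →
      ∃ κ' : K, x = algebraMap K R1 κ')
    (hpow2 : ∀ (x : R2) (n : ℕ) (κ : K), κ ≠ 0 → 0 < n → x ^ n = algebraMap K R2 κ →
      ∃ κ' : K, x = algebraMap K R2 κ')
    (f₁ : Polynomial R1) (g₁ : Polynomial R2) (a₁ b₁ : ℕ) (u₁ v₁ : K)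
    (B₁ : SepBase i1 i2 p f₁ g₁ a₁ b₁ u₁ v₁) :
    ∃ (f₀ : Polynomial R1) (g₀ : Polynomial R2),
      p ∣ sepEv true (f₀.map i1.toRingHom) - sepEv false (g₀.map i2.toRingHom) ∧
      ∀ (f : Polynomial R1) (g : Polynomial R2),
        p ∣ sepEv true (f.map i1.toRingHom) - sepEv false (g.map i2.toRingHom) →
        sepEv true (f₀.map i1.toRingHom) - sepEv false (g₀.map i2.toRingHom) ∣
          sepEv true (f.map i1.toRingHom) - sepEv false (g.map i2.toRingHom) := by
  have hinj : Function.Injective (algebraMap K R) := (algebraMap K R).injective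
  have hinj1 : Function.Injective (algebraMap K R1) := (algebraMap K R1).injective
  have hinj2 : Function.Injective (algebraMap K R2) := (algebraMap K R2).injective
  -- every nontrivial separated multiple has scalar leading coefficients
  have hbase : ∀ (f : Polynomial R1) (g : Polynomial R2),
      p ∣ sepEv true (f.map i1.toRingHom) - sepEv false (g.map i2.toRingHom) →
      0 < f.natDegree → ∃ u v, SepBase i1 i2 p f g f.natDegree g.natDegree u v := by
    intro f g hd hpos
    obtain ⟨h1, h2⟩ := B₁.prop hi1 hi2 hp f g hd
    have hposg : 0 < g.natDegree := by
      rcases Nat.eq_zero_or_pos g.natDegree with h | h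
      · rw [h, mul_zero] at h1
        have := Nat.mul_pos B₁.hb hpos
        omega
      · exact h
    have h3 := sep_pow_cancel (B₁.top hi1 hi2 hp) h1 h2
    have hf0 : f.leadingCoeff ≠ 0 := by
      rw [Ne, Polynomial.leadingCoeff_eq_zero]; rintro rfl; simp at hpos
    have hg0 : g.leadingCoeff ≠ 0 := by
      rw [Ne, Polynomial.leadingCoeff_eq_zero]; rintro rfl; simp at hposg
    obtain ⟨κ, k1, k2⟩ := hconst (f.leadingCoeff ^ a₁ * algebraMap K R1 (v₁ ^ f.natDegree))
      (g.leadingCoeff ^ a₁ * algebraMap K R2 (u₁ ^ f.natDegree)) (by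
        simpa using h3)
    have hvn : v₁ ^ f.natDegree ≠ 0 := pow_ne_zero _ B₁.hv
    have hun : u₁ ^ f.natDegree ≠ 0 := pow_ne_zero _ B₁.hu
    have hκ : κ ≠ 0 := by
      rintro rfl
      rw [map_zero] at k1
      rcases mul_eq_zero.1 k1 with h | h
      · exact pow_ne_zero _ hf0 h
      · exact hvn (hinj1 (by rw [h, map_zero]))
    obtain ⟨u, hu⟩ := hpow1 f.leadingCoeff a₁ (κ * (v₁ ^ f.natDegree)⁻¹)
      (mul_ne_zero hκ (inv_ne_zero hvn)) B₁.ha (by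
        rw [map_mul, ← k1, mul_assoc, ← map_mul, mul_inv_cancel₀ hvn, map_one, mul_one])
    obtain ⟨v, hv⟩ := hpow2 g.leadingCoeff a₁ (κ * (u₁ ^ f.natDegree)⁻¹)
      (mul_ne_zero hκ (inv_ne_zero hun)) B₁.ha (by
        rw [map_mul, ← k2, mul_assoc, ← map_mul, mul_inv_cancel₀ hun, map_one, mul_one])
    refine ⟨u, v, hd, rfl, rfl, hpos, hposg, ?_, ?_, hu, hv⟩
    · rintro rfl; exact hf0 (by rw [hu, map_zero])
    · rintro rfl; exact hg0 (by rw [hv, map_zero])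
  classical
  have hex : ∃ n : ℕ, 0 < n ∧ ∃ (f : Polynomial R1) (g : Polynomial R2), f.natDegree = n ∧
      p ∣ sepEv true (f.map i1.toRingHom) - sepEv false (g.map i2.toRingHom) :=
    ⟨a₁, B₁.ha, f₁, g₁, B₁.fa, B₁.dvd⟩
  obtain ⟨hnpos, f₀, g₀, hn, hd₀⟩ := Nat.find_spec hex
  have hmin : ∀ (f : Polynomial R1) (g : Polynomial R2), 0 < f.natDegree →
      p ∣ sepEv true (f.map i1.toRingHom) - sepEv false (g.map i2.toRingHom) →
      f₀.natDegree ≤ f.natDegree := by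
    intro f g hpos hd
    rw [hn]
    exact Nat.find_min' hex ⟨hpos, f, g, rfl, hd⟩
  obtain ⟨u, v, B⟩ := hbase f₀ g₀ hd₀ (by rw [hn]; exact hnpos)
  refine ⟨f₀, g₀, hd₀, ?_⟩
  set a := f₀.natDegree with ha
  set b := g₀.natDegree with hb
  have hT := B.top hi1 hi2 hp
  set T := (sepPhi (sepW a b) p).leadingCoeff with hTdef
  have key : ∀ (N : ℕ) (f : Polynomial R1) (g : Polynomial R2), f.natDegree ≤ N →
      p ∣ sepEv true (f.map i1.toRingHom) - sepEv false (g.map i2.toRingHom) →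
        sepEv true (f₀.map i1.toRingHom) - sepEv false (g₀.map i2.toRingHom) ∣
          sepEv true (f.map i1.toRingHom) - sepEv false (g.map i2.toRingHom) := by
    intro N
    induction N using Nat.strong_induction_on with
    | _ N ih =>
    intro f g hfN hd
    obtain ⟨h1, h2⟩ := B.prop hi1 hi2 hp f g hd
    rcases Nat.eq_zero_or_pos f.natDegree with hz | hpos
    · -- constant case
      rw [hz, mul_zero] at h1
      have hgz : g.natDegree = 0 := by
        rcases Nat.mul_eq_zero.1 h1.symm with h | h
        · exact absurd h B.ha.ne'
        · exact h
      rw [hz, hgz, pow_zero, pow_zero, mul_one, mul_one, ← map_sub] at h2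
      have h3 := sub_eq_zero.1 (hT.const _ h2)
      have hf : f = Polynomial.C f.leadingCoeff := by
        conv_lhs => rw [Polynomial.eq_C_of_natDegree_eq_zero hz]
        rw [Polynomial.leadingCoeff, hz]
      have hg : g = Polynomial.C g.leadingCoeff := by
        conv_lhs => rw [Polynomial.eq_C_of_natDegree_eq_zero hgz]
        rw [Polynomial.leadingCoeff, hgz]
      rw [hf, hg, Polynomial.map_C, Polynomial.map_C, sepEv_C, sepEv_C]
      simp [h3]
    · obtain ⟨l, m, B'⟩ := hbase f g hd hpos
      set α := f.natDegree with hα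
      set β := g.natDegree with hβ
      rw [B'.fu, B'.gv, AlgHom.commutes, AlgHom.commutes] at h2
      have hdiv : a ∣ α := by
        obtain ⟨k, hk⟩ : Nat.gcd a α ∣ a := Nat.gcd_dvd_left _ _
        obtain ⟨kk, hkk⟩ : Nat.gcd a α ∣ α := Nat.gcd_dvd_right _ _
        have hdpos : 0 < Nat.gcd a α := Nat.gcd_pos_of_pos_left _ B.ha
        have hcopr : Nat.Coprime k kk := by
          have := Nat.coprime_div_gcd_div_gcd hdpos
          rwa [Nat.div_eq_of_eq_mul_right hdpos hk, Nat.div_eq_of_eq_mul_right hdpos hkk] at this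
        set d := Nat.gcd a α with hd'
        have hk' : a = k * d := by rw [mul_comm]; exact hk
        have hkk' : α = kk * d := by rw [mul_comm]; exact hkk
        have hkpos : 0 < k := by
          rcases Nat.eq_zero_or_pos k with h | h
          · rw [h, zero_mul] at hk'; have := B.ha; omega
          · exact h
        have hkkpos : 0 < kk := by
          rcases Nat.eq_zero_or_pos kk with h | h
          · rw [h, zero_mul] at hkk'; omega
          · exact h
        have h4 : b * kk = k * β := by
          rw [hk', hkk'] at h1
          have : d * (b * kk) = d * (k * β) := by linarith
          exact Nat.eq_of_mul_eq_mul_left hdpos this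
        obtain ⟨e, he⟩ : k ∣ b := hcopr.dvd_of_dvd_mul_right ⟨β, h4⟩
        have hβe : β = kk * e := by
          rw [he] at h4
          have : k * β = k * (kk * e) := by linarith
          exact Nat.eq_of_mul_eq_mul_left hkpos this
        have hepos : 0 < e := by
          rcases Nat.eq_zero_or_pos e with h | h
          · rw [h, mul_zero] at he; have := B.hb; omega
          · exact h
        -- quotient ring computation
        let I : Ideal (MvPolynomial Bool R) := Ideal.span {T}
        let π := Ideal.Quotient.mk I
        have hπ : ∀ x, π x = 0 ↔ T ∣ x := fun x => by
          rw [Ideal.Quotient.eq_zero_iff_mem, Ideal.mem_span_singleton]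
        letI : Algebra K (MvPolynomial Bool R ⧸ I) :=
          ((π.comp C).comp (algebraMap K R)).toAlgebra
        have hal : ∀ x : K, algebraMap K (MvPolynomial Bool R ⧸ I) x =
          π (C (algebraMap K R x)) := fun x => rfl
        have hconv : ∀ (x y : K) (j : ℕ), x ≠ 0 →
            T ∣ C (algebraMap K R x) * X true ^ (j * d) - C (algebraMap K R y) * X false ^ (j * e) →
            π (X true ^ d) ^ j = algebraMap K (MvPolynomial Bool R ⧸ I) (y / x) *
              π (X false ^ e) ^ j := by
          intro x y j hx hxy
          rw [hal, ← map_pow, ← map_pow, ← map_mul, ← sub_eq_zero, ← map_sub, hπ]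
          have := Dvd.dvd.mul_left hxy (C (algebraMap K R x⁻¹))
          rw [mul_sub, ← mul_assoc, ← mul_assoc, ← C_mul, ← C_mul, ← map_mul, ← map_mul,
            inv_mul_cancel₀ hx, map_one, C_1, one_mul, inv_mul_eq_div, mul_comm j d, mul_comm j e,
            pow_mul, pow_mul] at this
          exact this
        have hc1 := hconv u v k B.hu (by rw [← hk', ← he]; exact hT.dvd)
        have hc2 := hconv l m kk B'.hu (by rw [← hkk', ← hβe]; exact h2)
        have hcan : ∀ (x : MvPolynomial Bool R ⧸ I) (i : ℕ), x * π (X false ^ e) ^ i = 0 → x = 0 := by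
          intro x i hx
          obtain ⟨x, rfl⟩ := Ideal.Quotient.mk_surjective x
          change π x * _ = 0 at hx
          change π x = 0
          rw [← map_pow, ← map_mul, hπ, ← pow_mul] at hx
          rw [hπ]
          exact hT.cancel_s _ _ hx
        obtain ⟨ζ, hζ⟩ := sep_bezout _ _ k kk hcopr hkkpos (v / u) (m / l)
          (div_ne_zero B'.hv B'.hu) hcan hc1 hc2
        have hζk : u * ζ ^ k = v := by
          rw [hζ, mul_pow, ← map_pow, ← sub_eq_zero, ← sub_mul, ← map_sub] at hc1
          have h5 := hcan _ _ hc1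
          rw [hal, hπ] at h5
          have h6 := hT.const _ h5
          have h7 : ζ ^ k - v / u = 0 := hinj (by rw [h6, map_zero])
          rw [sub_eq_zero.1 h7]
          have := B.hu
          field_simp
        rw [hal, ← map_mul, ← sub_eq_zero, ← map_sub, hπ] at hζ
        obtain ⟨h, g', hh, hhd⟩ := sep_root_step i1 i2 p hp0 k d e hkpos hdpos hepos u v ζ B.hu B.hv
          hζk (sepW a b) (by simp [sepW, he]) (by simp [sepW, ← hk'])
          (by rw [← hk', ← he]; exact hT) f₀ g₀ B.fu B.gv (by rw [← hk']) (by rw [← he])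
          hd₀ hζ
        have h8 := hmin h g' (by rw [hh]; exact hdpos) hhd
        rw [hh] at h8
        have h9 : d ≤ a := Nat.gcd_le_left _ B.ha
        have h10 : d = a := le_antisymm h9 h8
        rw [← h10]
        exact Nat.gcd_dvd_right _ _
      obtain ⟨j, hj⟩ := hdiv
      have hβj : β = b * j := by
        rw [hj] at h1
        have : a * β = a * (b * j) := by linarith
        exact Nat.eq_of_mul_eq_mul_left B.ha this
      have hlm : l * v ^ j = m * u ^ j := by
        have d1 : T ∣ (C (algebraMap K R u) * X true ^ a) ^ j -
            (C (algebraMap K R v) * X false ^ b) ^ j :=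
          hT.dvd.trans (sub_dvd_pow_sub_pow _ _ _)
        have d2 := dvd_sub (Dvd.dvd.mul_left h2 (C (algebraMap K R u) ^ j))
          (Dvd.dvd.mul_left d1 (C (algebraMap K R l)))
        have d3 : C (algebraMap K R u) ^ j * (C (algebraMap K R l) * X true ^ α -
            C (algebraMap K R m) * X false ^ β) - C (algebraMap K R l) *
            ((C (algebraMap K R u) * X true ^ a) ^ j - (C (algebraMap K R v) * X false ^ b) ^ j) =
            C (algebraMap K R (l * v ^ j - m * u ^ j)) * X false ^ β := by
          rw [hj, hβj]
          simp only [map_sub, map_mul, map_pow]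
          rw [pow_mul, pow_mul, mul_pow, mul_pow]
          ring
        rw [d3] at d2
        have h6 := hT.const _ (hT.cancel_s _ _ d2)
        exact sub_eq_zero.1 (hinj (by rw [h6, map_zero]))
      set ν := l / u ^ j with hν
      have hν1 : ν * u ^ j = l := by
        have := B.hu
        rw [hν]; field_simp
      have hν2 : ν * v ^ j = m := by
        have := B.hu
        rw [hν, div_mul_eq_mul_div, hlm]; field_simp
      have hν0 : ν ≠ 0 := by rw [hν]; exact div_ne_zero B'.hu (pow_ne_zero _ B.hu)
      set f' := f - Polynomial.C (algebraMap K R1 ν) * f₀ ^ j with hf'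
      set g' := g - Polynomial.C (algebraMap K R2 ν) * g₀ ^ j with hg'
      have ef : sepEv true (f'.map i1.toRingHom) = sepEv true (f.map i1.toRingHom) -
          C (algebraMap K R ν) * sepEv true (f₀.map i1.toRingHom) ^ j := by
        rw [hf', Polynomial.map_sub, Polynomial.map_mul, Polynomial.map_pow, map_sub, map_mul,
          map_pow, Polynomial.map_C, sepEv_C]
        simp
      have eg : sepEv false (g'.map i2.toRingHom) = sepEv false (g.map i2.toRingHom) -
          C (algebraMap K R ν) * sepEv false (g₀.map i2.toRingHom) ^ j := by
        rw [hg', Polynomial.map_sub, Polynomial.map_mul, Polynomial.map_pow, map_sub, map_mul,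
          map_pow, Polynomial.map_C, sepEv_C]
        simp
      set D := sepEv true (f₀.map i1.toRingHom) - sepEv false (g₀.map i2.toRingHom) with hD
      have hDj : D ∣ C (algebraMap K R ν) * sepEv true (f₀.map i1.toRingHom) ^ j -
          C (algebraMap K R ν) * sepEv false (g₀.map i2.toRingHom) ^ j := by
        rw [← mul_sub]
        exact Dvd.dvd.mul_left (sub_dvd_pow_sub_pow _ _ _) _
      have hsub : sepEv true (f'.map i1.toRingHom) - sepEv false (g'.map i2.toRingHom) =
          (sepEv true (f.map i1.toRingHom) - sepEv false (g.map i2.toRingHom)) -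
          (C (algebraMap K R ν) * sepEv true (f₀.map i1.toRingHom) ^ j -
          C (algebraMap K R ν) * sepEv false (g₀.map i2.toRingHom) ^ j) := by
        rw [ef, eg]; ring
      have hlt : f'.natDegree < f.natDegree := by
        have hf0 : f ≠ 0 := by rintro rfl; simp [hα] at hpos
        have hf00 : f₀ ≠ 0 := by
          intro h
          have := B.ha
          rw [ha, h] at this
          simp at this
        have hc0 : Polynomial.C (algebraMap K R1 ν) ≠ 0 := by
          simpa using hν0
        have hdeg : f.degree = (Polynomial.C (algebraMap K R1 ν) * f₀ ^ j).degree := by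
          rw [Polynomial.degree_eq_natDegree hf0,
            Polynomial.degree_eq_natDegree (mul_ne_zero hc0 (pow_ne_zero _ hf00)),
            Polynomial.natDegree_C_mul (by simpa using hν0), Polynomial.natDegree_pow,
            ← ha, ← hα, hj, mul_comm]
        have h5 := Polynomial.degree_sub_lt_left hdeg hf0 (by
          rw [Polynomial.leadingCoeff_mul, Polynomial.leadingCoeff_C, Polynomial.leadingCoeff_pow,
            B.fu, B'.fu, ← map_pow, ← map_mul, hν1])
        rcases eq_or_ne f' 0 with h0 | h0
        · rw [h0, Polynomial.natDegree_zero]; exact hpos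
        · exact Polynomial.natDegree_lt_natDegree h0 h5
      have h6 := ih f'.natDegree (hlt.trans_le hfN) f' g' le_rfl (by
        rw [hsub]; exact dvd_sub hd (hd₀.trans hDj))
      rw [hsub] at h6
      have := dvd_add h6 hDj
      rwa [sub_add_cancel] at this
  intro f g hd
  exact key _ f g le_rfl hd

end SepStep

section SepFinal

variable {K : Type} [Field K] [CharZero K]

/-- restriction to the line through the generic point with direction `a` -/
noncomputable def sepLine {n : ℕ} (a : Fin n → K) :
    MvPolynomial (Fin n) K →ₐ[K] Polynomial (MvPolynomial (Fin n) K) :=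
  aeval (fun i => Polynomial.C (X i) + Polynomial.C (C (a i)) * Polynomial.X)

lemma sepLine_monomial {n : ℕ} (a : Fin n → K) (s : Fin n →₀ ℕ) (c : K) :
    (sepLine a (monomial s c)).natDegree ≤ s.sum (fun _ e => e) ∧
    (sepLine a (monomial s c)).coeff (s.sum (fun _ e => e)) = C (eval a (monomial s c)) := by
  have h0 : sepLine a (monomial s c) = Polynomial.C (C c) *
      ∏ i, (Polynomial.C (X i) + Polynomial.C (C (a i)) * Polynomial.X) ^ s i := by
    rw [sepLine, aeval_monomial, Finsupp.prod_fintype _ _ (by simp)]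
    congr 1
  have hlin : ∀ i : Fin n, (Polynomial.C (X i) +
      Polynomial.C (C (a i)) * Polynomial.X : Polynomial (MvPolynomial (Fin n) K)).natDegree ≤ 1 := by
    intro i
    rw [add_comm]
    exact Polynomial.natDegree_linear_le
  have hpow : ∀ i : Fin n, ((Polynomial.C (X i) +
      Polynomial.C (C (a i)) * Polynomial.X : Polynomial (MvPolynomial (Fin n) K)) ^ s i).natDegree
        ≤ s i := by
    intro i
    simpa using Polynomial.natDegree_pow_le_of_le (s i) (hlin i)
  have hsum : s.sum (fun _ e => e) = ∑ i, s i := Finsupp.sum_fintype _ _ (by simp)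
  have key : ∀ A : Finset (Fin n),
      (∏ i ∈ A, (Polynomial.C (X i) + Polynomial.C (C (a i)) * Polynomial.X :
        Polynomial (MvPolynomial (Fin n) K)) ^ s i).natDegree ≤ ∑ i ∈ A, s i ∧
      (∏ i ∈ A, (Polynomial.C (X i) + Polynomial.C (C (a i)) * Polynomial.X :
        Polynomial (MvPolynomial (Fin n) K)) ^ s i).coeff (∑ i ∈ A, s i) =
        C (∏ i ∈ A, a i ^ s i) := by
    intro A
    classical
    induction A using Finset.induction_on with
    | empty => simp
    | insert i A hi ih =>
      rw [Finset.prod_insert hi, Finset.sum_insert hi, Finset.prod_insert hi]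
      refine ⟨Polynomial.natDegree_mul_le.trans (add_le_add (hpow i) ih.1), ?_⟩
      rw [Polynomial.coeff_mul_add_eq_of_natDegree_le (hpow i) ih.1, ih.2, map_mul]
      congr 1
      have := Polynomial.coeff_pow_of_natDegree_le (m := s i) (hlin i)
      rw [mul_one] at this
      rw [this]
      simp
  obtain ⟨k1, k2⟩ := key Finset.univ
  rw [h0, hsum]
  refine ⟨(Polynomial.natDegree_C_mul_le _ _).trans k1, ?_⟩
  rw [Polynomial.coeff_C_mul, k2, ← C_mul, eval_monomial, Finsupp.prod_fintype _ _ (by simp)]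

lemma sepLine_natDegree_le {n : ℕ} (a : Fin n → K) (f : MvPolynomial (Fin n) K) :
    (sepLine a f).natDegree ≤ f.totalDegree := by
  conv_lhs => rw [f.as_sum, map_sum]
  refine Polynomial.natDegree_sum_le_of_forall_le _ _ fun s hs => ?_
  exact (sepLine_monomial a s _).1.trans (le_totalDegree hs)

lemma sepLine_coeff {n : ℕ} (a : Fin n → K) (f : MvPolynomial (Fin n) K) :
    (sepLine a f).coeff f.totalDegree =
      C (eval a (homogeneousComponent f.totalDegree f)) := by
  have h1 : (sepLine a f).coeff f.totalDegree = ∑ s ∈ f.support,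
      (sepLine a (monomial s (f.coeff s))).coeff f.totalDegree := by
    conv_lhs => rw [f.as_sum, map_sum, Polynomial.finsetSum_coeff, ← f.as_sum]
  rw [h1, homogeneousComponent_apply, map_sum, map_sum, Finset.sum_filter]
  refine Finset.sum_congr rfl fun s hs => ?_
  have hdeg : s.degree = s.sum (fun _ e => e) := by
    rfl
  split_ifs with h
  · rw [hdeg] at h
    rw [← h, (sepLine_monomial a s _).2]
  · apply Polynomial.coeff_eq_zero_of_natDegree_lt
    refine lt_of_le_of_ne ((sepLine_monomial a s _).1.trans (le_totalDegree hs)) ?_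
    intro h2
    have h3 := (sepLine_monomial a s (f.coeff s)).1
    have h4 := le_totalDegree hs
    rw [hdeg] at h
    omega

lemma sep_exists_dir {n : ℕ} (f : MvPolynomial (Fin n) K) (hf : 0 < f.totalDegree) :
    ∃ (a : Fin n → K) (u : K), u ≠ 0 ∧ (sepLine a f).natDegree = f.totalDegree ∧
      (sepLine a f).leadingCoeff = algebraMap K _ u := by
  have hne : homogeneousComponent f.totalDegree f ≠ 0 := by
    intro h
    have hf0 : f ≠ 0 := by rintro rfl; simp at hf
    obtain ⟨s, hs, hs2⟩ := Finset.exists_mem_eq_sup f.support (support_nonempty.2 hf0)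
      (fun s => s.sum fun _ e => e)
    have hdeg : s.degree = f.totalDegree := by
      rw [totalDegree, hs2]
      rfl
    have h2 := congrArg (coeff s) h
    rw [coeff_homogeneousComponent, if_pos hdeg, coeff_zero] at h2
    exact (mem_support_iff.1 hs) h2
  obtain ⟨a, ha⟩ : ∃ a : Fin n → K, eval a (homogeneousComponent f.totalDegree f) ≠ 0 := by
    by_contra hcon
    push Not at hcon
    exact hne (MvPolynomial.funext fun x => by rw [hcon x, map_zero])
  have hc := sepLine_coeff a f
  have hnd : (sepLine a f).natDegree = f.totalDegree := by
    refine le_antisymm (sepLine_natDegree_le a f) (Polynomial.le_natDegree_of_ne_zero ?_)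
    rw [hc]
    simpa using ha
  refine ⟨a, _, ha, hnd, ?_⟩
  rw [Polynomial.leadingCoeff, hnd, hc]
  rfl

/-- the two-line substitution -/
noncomputable def sepSub {n m : ℕ} (a : Fin n → K) (b : Fin m → K) :
    MvPolynomial (Fin n ⊕ Fin m) K →ₐ[K] MvPolynomial Bool (MvPolynomial (Fin n ⊕ Fin m) K) :=
  aeval (Sum.elim (fun i => C (X (Sum.inl i)) + C (C (a i)) * X true)
    (fun j => C (X (Sum.inr j)) + C (C (b j)) * X false))

lemma sepSub_inl {n m : ℕ} (a : Fin n → K) (b : Fin m → K) (f : MvPolynomial (Fin n) K) :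
    sepSub a b (rename Sum.inl f) = sepEv true ((sepLine a f).map
      (rename (Sum.inl : Fin n → Fin n ⊕ Fin m) :
        MvPolynomial (Fin n) K →ₐ[K] MvPolynomial (Fin n ⊕ Fin m) K).toRingHom) := by
  induction f using MvPolynomial.induction_on with
  | C r =>
    simp only [sepSub, sepLine, rename_C, algHom_C, Polynomial.algebraMap_apply,
      Polynomial.map_C, sepEv_C]
    simp [MvPolynomial.algebraMap_eq]
  | add p q hp hq => simp only [map_add, hp, hq, Polynomial.map_add]
  | mul_X p i hp =>
    rw [map_mul, map_mul, hp, map_mul, Polynomial.map_mul, map_mul]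
    congr 1
    simp [sepSub, sepLine, sepEv_C]
    simp [sepEv]

lemma sepSub_inr {n m : ℕ} (a : Fin n → K) (b : Fin m → K) (f : MvPolynomial (Fin m) K) :
    sepSub a b (rename Sum.inr f) = sepEv false ((sepLine b f).map
      (rename (Sum.inr : Fin m → Fin n ⊕ Fin m) :
        MvPolynomial (Fin m) K →ₐ[K] MvPolynomial (Fin n ⊕ Fin m) K).toRingHom) := by
  induction f using MvPolynomial.induction_on with
  | C r =>
    simp only [sepSub, sepLine, rename_C, algHom_C, Polynomial.algebraMap_apply,
      Polynomial.map_C, sepEv_C]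
    simp [MvPolynomial.algebraMap_eq]
  | add p q hp hq => simp only [map_add, hp, hq, Polynomial.map_add]
  | mul_X p i hp =>
    rw [map_mul, map_mul, hp, map_mul, Polynomial.map_mul, map_mul]
    congr 1
    simp [sepSub, sepLine, sepEv_C]
    simp [sepEv]

lemma sepSub_retract {n m : ℕ} (a : Fin n → K) (b : Fin m → K)
    (f : MvPolynomial (Fin n ⊕ Fin m) K) :
    constantCoeff (sepSub a b f) = f := by
  induction f using MvPolynomial.induction_on with
  | C r =>
    simp only [sepSub, algHom_C]
    rw [MvPolynomial.algebraMap_apply]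
    simp [MvPolynomial.algebraMap_eq]
  | add p q hp hq => rw [map_add, map_add, hp, hq]
  | mul_X p i hp =>
    rw [map_mul, map_mul, hp]
    congr 1
    rcases i with i | i <;> simp [sepSub]

lemma sepEv_constantCoeff {R : Type} [CommRing R] [IsDomain R] [UniqueFactorizationMonoid R] (x : Bool) (f : Polynomial R) :
    constantCoeff (sepEv x f) = f.coeff 0 := by
  induction f using Polynomial.induction_on' with
  | add p q hp hq => simp [hp, hq]
  | monomial n r =>
    rw [← Polynomial.C_mul_X_pow_eq_monomial, map_mul, sepEv_C]
    rcases n with _ | n <;> simp [sepEv]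

lemma sep_pow_const {n : ℕ} (x : MvPolynomial (Fin n) K) (k : ℕ) (κ : K) (hκ : κ ≠ 0)
    (hk : 0 < k) (h : x ^ k = algebraMap K (MvPolynomial (Fin n) K) κ) :
    ∃ κ' : K, x = algebraMap K (MvPolynomial (Fin n) K) κ' := by
  have h1 : IsUnit (x ^ k) := by rw [h]; exact (IsUnit.mk0 κ hκ).map _
  have h2 : IsUnit x := (isUnit_pow_iff hk.ne').1 h1
  obtain ⟨r, _, hr⟩ := MvPolynomial.isUnit_iff_eq_C_of_isReduced.1 h2
  exact ⟨r, hr⟩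

lemma sep_const {n m : ℕ} (x : MvPolynomial (Fin n) K) (y : MvPolynomial (Fin m) K)
    (h : rename (Sum.inl : Fin n → Fin n ⊕ Fin m) x = rename Sum.inr y) :
    ∃ κ : K, x = algebraMap K _ κ ∧ y = algebraMap K _ κ := by
  have e1 : ∀ x : MvPolynomial (Fin n) K, aeval (Sum.elim X (fun _ => 0))
      (rename (Sum.inl : Fin n → Fin n ⊕ Fin m) x) = x := by
    intro x
    rw [aeval_rename]
    simp [Sum.elim_comp_inl, aeval_X_left]
  have e2 : ∀ y : MvPolynomial (Fin m) K, aeval (Sum.elim X (fun _ => 0) : _ → MvPolynomial (Fin n) K)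
      (rename (Sum.inr : Fin m → Fin n ⊕ Fin m) y) = C (constantCoeff y) := by
    intro y
    rw [aeval_rename, Sum.elim_comp_inr]
    have := MvPolynomial.aeval_zero (S₁ := MvPolynomial (Fin n) K) y
    exact this
  have hx : x = C (constantCoeff y) := by rw [← e2, ← h, e1]
  refine ⟨constantCoeff y, hx, ?_⟩
  apply rename_injective _ (Sum.inr_injective : Function.Injective (Sum.inr : Fin m → Fin n ⊕ Fin m))
  rw [← h, hx]
  simp [MvPolynomial.algebraMap_eq]

lemma sep_supported_of_dvd {σ : Type} (s : Set σ) (p q : MvPolynomial σ K) (hq : q ≠ 0)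
    (h : p ∣ q) (hs : q ∈ supported K s) : p ∈ supported K s := by
  obtain ⟨r, rfl⟩ := h
  rw [mem_supported] at hs ⊢
  intro i hi
  apply hs
  have hp0 : p ≠ 0 := left_ne_zero_of_mul hq
  have hr0 : r ≠ 0 := right_ne_zero_of_mul hq
  rw [Finset.mem_coe, mem_vars_iff_degreeOf_ne_zero] at hi ⊢
  rw [degreeOf_mul_eq hp0 hr0]
  omega

lemma sep_totalDegree_pos {n m : ℕ} (p : MvPolynomial (Fin n ⊕ Fin m) K)
    (hpX : p ∉ supported K (Set.range (Sum.inl : Fin n → Fin n ⊕ Fin m)))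
    (hpY : p ∉ supported K (Set.range (Sum.inr : Fin m → Fin n ⊕ Fin m)))
    (f : MvPolynomial (Fin n) K) (g : MvPolynomial (Fin m) K)
    (hne : rename Sum.inl f - rename Sum.inr g ≠ 0)
    (hd : p ∣ (rename Sum.inl f - rename Sum.inr g)) :
    0 < f.totalDegree ∧ 0 < g.totalDegree := by
  have m1 : rename (Sum.inl : Fin n → Fin n ⊕ Fin m) f ∈
      supported K (Set.range (Sum.inl : Fin n → Fin n ⊕ Fin m)) := by
    rw [mem_supported]
    intro j hj
    obtain ⟨i, _, rfl⟩ := mem_vars_rename _ _ hj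
    exact ⟨i, rfl⟩
  have m2 : rename (Sum.inr : Fin m → Fin n ⊕ Fin m) g ∈
      supported K (Set.range (Sum.inr : Fin m → Fin n ⊕ Fin m)) := by
    rw [mem_supported]
    intro j hj
    obtain ⟨i, _, rfl⟩ := mem_vars_rename _ _ hj
    exact ⟨i, rfl⟩
  constructor
  · by_contra h
    obtain h : f.totalDegree = 0 := by omega
    apply hpY
    refine sep_supported_of_dvd _ _ _ hne hd (sub_mem ?_ m2)
    rw [totalDegree_eq_zero_iff_eq_C.1 h, rename_C]
    exact Subalgebra.algebraMap_mem _ _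
  · by_contra h
    obtain h : g.totalDegree = 0 := by omega
    apply hpX
    refine sep_supported_of_dvd _ _ _ hne hd (sub_mem m1 ?_)
    rw [totalDegree_eq_zero_iff_eq_C.1 h, rename_C]
    exact Subalgebra.algebraMap_mem _ _

end SepFinal

/-- Corollary: if `p ∈ K[X,Y] \ (K[X] ∪ K[Y])` has a nonzero separated multiple, then it has
a minimal separated multiple, i.e. one dividing every separated multiple of `p`. -/
theorem exists_minimal_separated_multiple (K : Type) [Field K] [CharZero K] (n m : ℕ)
    (p : MvPolynomial (Fin n ⊕ Fin m) K)
    (hpX : p ∉ supported K (Set.range (Sum.inl : Fin n → Fin n ⊕ Fin m)))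
    (hpY : p ∉ supported K (Set.range (Sum.inr : Fin m → Fin n ⊕ Fin m)))
    (hsep : ∃ (f : MvPolynomial (Fin n) K) (g : MvPolynomial (Fin m) K),
      rename Sum.inl f - rename Sum.inr g ≠ 0 ∧ p ∣ (rename Sum.inl f - rename Sum.inr g)) :
    ∃ (f₀ : MvPolynomial (Fin n) K) (g₀ : MvPolynomial (Fin m) K),
      rename Sum.inl f₀ - rename Sum.inr g₀ ≠ 0 ∧
      p ∣ (rename Sum.inl f₀ - rename Sum.inr g₀) ∧
      ∀ (f : MvPolynomial (Fin n) K) (g : MvPolynomial (Fin m) K),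
        p ∣ (rename Sum.inl f - rename Sum.inr g) →
        (rename Sum.inl f₀ - rename Sum.inr g₀) ∣ (rename Sum.inl f - rename Sum.inr g) := by
  obtain ⟨f₁, g₁, hne, hd⟩ := hsep
  obtain ⟨hf, hg⟩ := sep_totalDegree_pos p hpX hpY f₁ g₁ hne hd
  obtain ⟨a, u, hu, ha1, ha2⟩ := sep_exists_dir f₁ hf
  obtain ⟨b, v, hv, hb1, hb2⟩ := sep_exists_dir g₁ hg
  have hsub : ∀ (f : MvPolynomial (Fin n) K) (g : MvPolynomial (Fin m) K),
      p ∣ (rename Sum.inl f - rename Sum.inr g) → sepSub a b p ∣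
        sepEv true ((sepLine a f).map
      (rename (Sum.inl : Fin n → Fin n ⊕ Fin m) :
        MvPolynomial (Fin n) K →ₐ[K] MvPolynomial (Fin n ⊕ Fin m) K).toRingHom) -
        sepEv false ((sepLine b g).map
      (rename (Sum.inr : Fin m → Fin n ⊕ Fin m) :
        MvPolynomial (Fin m) K →ₐ[K] MvPolynomial (Fin n ⊕ Fin m) K).toRingHom) := by
    intro f g h
    rw [← sepSub_inl a b, ← sepSub_inr a b, ← map_sub]
    exact map_dvd _ h
  have hpu : ¬ IsUnit (sepSub a b p) := by
    intro h
    have h1 : IsUnit p := by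
      rw [← sepSub_retract a b p]
      exact h.map _
    obtain ⟨r, _, hr⟩ := MvPolynomial.isUnit_iff_eq_C_of_isReduced.1 h1
    apply hpX
    rw [hr]
    exact Subalgebra.algebraMap_mem _ _
  have hp0 : sepSub a b p ≠ 0 := by
    intro h
    apply hpX
    rw [← sepSub_retract a b p, h, map_zero]
    exact zero_mem _
  obtain ⟨F, G, h1, h2⟩ := sep_core (rename (Sum.inl : Fin n → Fin n ⊕ Fin m))
    (rename (Sum.inr : Fin m → Fin n ⊕ Fin m)) (sepSub a b p)
    (rename_injective _ Sum.inl_injective) (rename_injective _ Sum.inr_injective) hpu hp0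
    sep_const sep_pow_const sep_pow_const (sepLine a f₁) (sepLine b g₁) _ _ u v
    ⟨hsub f₁ g₁ hd, ha1, hb1, hf, hg, hu, hv, ha2, hb2⟩
  have hcc : constantCoeff (sepEv true (F.map
      (rename (Sum.inl : Fin n → Fin n ⊕ Fin m) :
        MvPolynomial (Fin n) K →ₐ[K] MvPolynomial (Fin n ⊕ Fin m) K).toRingHom) -
        sepEv false (G.map
      (rename (Sum.inr : Fin m → Fin n ⊕ Fin m) :
        MvPolynomial (Fin m) K →ₐ[K] MvPolynomial (Fin n ⊕ Fin m) K).toRingHom)) =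
      rename Sum.inl (F.coeff 0) - rename Sum.inr (G.coeff 0) := by
    rw [map_sub, sepEv_constantCoeff, sepEv_constantCoeff, Polynomial.coeff_map,
      Polynomial.coeff_map]
    rfl
  have hall : ∀ (f : MvPolynomial (Fin n) K) (g : MvPolynomial (Fin m) K),
        p ∣ (rename Sum.inl f - rename Sum.inr g) →
        (rename Sum.inl (F.coeff 0) - rename Sum.inr (G.coeff 0)) ∣
          (rename Sum.inl f - rename Sum.inr g) := by
    intro f g h
    have h3 := h2 _ _ (hsub f g h)
    rw [← sepSub_inl a b, ← sepSub_inr a b, ← map_sub (sepSub a b)] at h3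
    have h4 := map_dvd constantCoeff h3
    rwa [hcc, sepSub_retract] at h4
  refine ⟨F.coeff 0, G.coeff 0, ?_, ?_, hall⟩
  · intro h0
    have := hall f₁ g₁ hd
    rw [h0, zero_dvd_iff] at this
    exact hne this
  · have h4 := map_dvd constantCoeff h1
    rwa [hcc, sepSub_retract] at h4
end
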